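/- (Uniform approximate null-controllability, small time.) Let V ∈ C_b(ℝ^d;ℝ) and let ω ⊂ ℝ^d be (L,γ)-equidistributed. For every 0<ε≤1 there exist K_ε>0 and h_ε>0 such that: if 0 < T < K_ε(1+‖V‖_∞^{2/3}), then there exists C>0 depending only on d, ω, V and ε such that for all h with 0<h ≤ h_ε·(T/(1+‖V‖_∞^{2/3}))^{(1+ε)/2} and all u₀ ∈ ℓ²(hℤ^d), there exists a control f ∈ L²((0,T); ℓ²(hℤ^d)) with ‖f‖_{L²((0,T);ℓ²(hℤ^d))} ≤ (C/T)·exp(C·(1+‖V‖_∞^{2/3})^{2(1+ε)}/T^{1+ε})·‖u₀‖_{ℓ²(hℤ^d)} such that the mild solution u(t) = e^{−tP_h}u₀ + ∫₀^t e^{−(t−s)P_h}(𝟙_ω f(s)) ds satisfies ‖u(T)‖_{ℓ²(hℤ^d)} ≤ C·e^{−CT/h²}·‖u₀‖_{ℓ²(hℤ^d)}. -/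

import Mathlib

open scoped BigOperators
open MeasureTheory

noncomputable section

/-- The canonical basis vector `e j` of `ℤ^d`. -/
def latE (d : ℕ) (j : Fin d) : Fin d → ℤ := fun i => if i = j then 1 else 0

/-- The point `h•k ∈ hℤ^d ⊂ ℝ^d` associated with `k ∈ ℤ^d`. -/
def pt (d : ℕ) (h : ℝ) (k : Fin d → ℤ) : Fin d → ℝ := fun i => h * (k i : ℝ)

/-- Forward difference operator `D_{j,h}^+`. -/
def Dp (d : ℕ) (h : ℝ) (j : Fin d) (u : (Fin d → ℤ) → ℂ) (k : Fin d → ℤ) : ℂ :=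
  (u (k + latE d j) - u k) / (h : ℂ)

/-- Backward difference operator `D_{j,h}^-`. -/
def Dm (d : ℕ) (h : ℝ) (j : Fin d) (u : (Fin d → ℤ) → ℂ) (k : Fin d → ℤ) : ℂ :=
  (u k - u (k - latE d j)) / (h : ℂ)

/-- The discrete Laplacian `Δ_h` on `hℤ^d`. -/
def discLap (d : ℕ) (h : ℝ) (u : (Fin d → ℤ) → ℂ) (k : Fin d → ℤ) : ℂ :=
  ∑ j : Fin d, (u (k + latE d j) + u (k - latE d j) - 2 * u k) / ((h : ℂ)) ^ 2

/-- The averaging operator `M_j^-`. -/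
def Mminus (d : ℕ) (h : ℝ) (j : Fin d) (u : (Fin d → ℤ) → ℂ) (k : Fin d → ℤ) : ℂ :=
  (u (k - latE d j) + u k) / 2
open scoped ENNReal

/-- An open set `ω ⊂ ℝ^d` is `(L,γ)`-equidistributed if each cube `Lk+[−L/2,L/2]^d`
contains a cube `z_k+[−γL/2,γL/2]^d` included in `ω`. -/
def Equidistributed (d : ℕ) (L γ : ℝ) (ω : Set (Fin d → ℝ)) : Prop :=
  0 < L ∧ 0 < γ ∧ γ ≤ 1 ∧
    ∃ z : (Fin d → ℤ) → Fin d → ℝ, ∀ k : Fin d → ℤ,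
      {x : Fin d → ℝ | ∀ i, |x i - z k i| ≤ γ * L / 2}
        ⊆ ω ∩ {x : Fin d → ℝ | ∀ i, |x i - L * (k i : ℝ)| ≤ L / 2}

instance : Fact ((1:ℝ≥0∞) ≤ 2) := ⟨one_le_two⟩

/-- The Hilbert space `ℓ²(hℤ^d)` (indexed by `ℤ^d`). -/
abbrev Hsp (d : ℕ) : Type := lp (fun _ : (Fin d → ℤ) => ℂ) 2

/-- `P` realizes the discrete Schrödinger operator `P_h = −Δ_h + V` on `ℓ²(hℤ^d)`. -/
def RealizesPh (d : ℕ) (h : ℝ) (V : (Fin d → ℝ) → ℝ) (P : Hsp d →L[ℂ] Hsp d) : Prop :=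
  ∀ (w : Hsp d) (k : Fin d → ℤ),
    (P w : ∀ _ : (Fin d → ℤ), ℂ) k
      = -discLap d h (w : ∀ _ : (Fin d → ℤ), ℂ) k
        + (V (pt d h k) : ℂ) * (w : ∀ _ : (Fin d → ℤ), ℂ) k

/-- `‖V‖_{L^∞} = sup |V|`. -/
def supNorm (d : ℕ) (V : (Fin d → ℝ) → ℝ) : ℝ := ⨆ x, |V x|

section

/-- `B` contains a neighbourhood (sup-distance 3) of the support of `F`. -/
def NearB (d : ℕ) (F : (Fin d → ℤ) → ℝ) (B : Finset (Fin d → ℤ)) : Prop :=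
  ∀ x v, F x ≠ 0 → (∀ i, |v i| ≤ 3) → x + v ∈ B

lemma latE_self (d : ℕ) (j : Fin d) : latE d j j = 1 := by simp [latE]
lemma latE_ne (d : ℕ) {i j : Fin d} (h : i ≠ j) : latE d j i = 0 := by simp [latE, h]
lemma latE_abs (d : ℕ) (i j : Fin d) : |latE d j i| ≤ 1 := by
  unfold latE; split_ifs <;> simp

lemma shift_sum {d : ℕ} {F : (Fin d → ℤ) → ℝ} {B : Finset (Fin d → ℤ)} (hB : NearB d F B)
    (G : (Fin d → ℤ) → ℝ) (w v : Fin d → ℤ) (hw : ∀ i, |w i| ≤ 1) (hv : ∀ i, |v i| ≤ 2)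
    (hG : ∀ x, F (x + w) = 0 → G x = 0) :
    ∑ x ∈ B, G (x + v) = ∑ x ∈ B, G x := by
  have h1 : ∀ x, G x ≠ 0 → x ∈ B := by
    intro x hx
    have h2 : F (x + w) ≠ 0 := fun h => hx (hG x h)
    have := hB (x + w) (-w) h2 (fun i => by have := hw i; simp; omega)
    simpa using this
  have h2 : ∀ x, G (x + v) ≠ 0 → x ∈ B := by
    intro x hx
    have h2 : F (x + v + w) ≠ 0 := fun h => hx (hG _ h)
    have := hB (x + v + w) (-(v + w)) h2 (fun i => by
      have h1 := hw i
      have h2 := hv i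
      rw [Pi.neg_apply, abs_neg]
      exact (abs_add_le _ _).trans (by omega))
    simpa [add_assoc] using this
  rw [← finsum_eq_sum_of_support_subset (fun x => G (x + v)) (s := B) (fun x hx => h2 x hx),
    ← finsum_eq_sum_of_support_subset G (s := B) (fun x hx => h1 x hx)]
  exact finsum_comp_equiv (Equiv.addRight v) (f := G)

section OneDir
variable {d : ℕ} {F : (Fin d → ℤ) → ℝ} {B : Finset (Fin d → ℤ)}

lemma shiftE (hB : NearB d F B) (j : Fin d) (G : (Fin d → ℤ) → ℝ)
    (hG : ∀ x, F x = 0 → G x = 0) :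
    ∑ x ∈ B, G (x + latE d j) = ∑ x ∈ B, G x :=
  shift_sum hB G 0 (latE d j) (by simp) (fun i => (latE_abs d i j).trans (by norm_num))
    (by simpa using hG)

lemma shiftE' (hB : NearB d F B) (j : Fin d) (G : (Fin d → ℤ) → ℝ)
    (hG : ∀ x, F x = 0 → G x = 0) :
    ∑ x ∈ B, G (x - latE d j) = ∑ x ∈ B, G x := by
  simpa [sub_eq_add_neg] using shift_sum hB G 0 (-latE d j) (by simp)
    (fun i => by simpa using (latE_abs d i j).trans (by norm_num))
    (by simpa using hG)

/-- unscaled symmetric part -/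
def sOp (d : ℕ) (q : Fin d → (Fin d → ℤ) → ℝ) (F : (Fin d → ℤ) → ℝ) (j : Fin d) (x : Fin d → ℤ) : ℝ :=
  Real.cosh (q j x) * F (x + latE d j) + Real.cosh (q j (x - latE d j)) * F (x - latE d j) - 2 * F x

/-- unscaled antisymmetric part -/
def aOp (d : ℕ) (q : Fin d → (Fin d → ℤ) → ℝ) (F : (Fin d → ℤ) → ℝ) (j : Fin d) (x : Fin d → ℤ) : ℝ :=
  Real.sinh (q j x) * F (x + latE d j) - Real.sinh (q j (x - latE d j)) * F (x - latE d j)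

/-- unscaled derivative of symmetric part -/
def rOp (d : ℕ) (q : Fin d → (Fin d → ℤ) → ℝ) (F : (Fin d → ℤ) → ℝ) (j : Fin d) (x : Fin d → ℤ) : ℝ :=
  q j x * Real.sinh (q j x) * F (x + latE d j)
    + q j (x - latE d j) * Real.sinh (q j (x - latE d j)) * F (x - latE d j)

variable {q : Fin d → (Fin d → ℤ) → ℝ}

lemma sum_sa_ne (hB : NearB d F B) {i j : Fin d} (hij : i ≠ j)
    (hq : ∀ i j x, i ≠ j → q i (x + latE d j) = q i x) :
    ∑ x ∈ B, sOp d q F i x * aOp d q F j x = 0 := by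
  have hq' : ∀ i j x, i ≠ j → q i (x - latE d j) = q i x := by
    intro i j x h
    have := hq i j (x - latE d j) h
    simpa using this.symm
  have e1 : ∀ x, sOp d q F i x * aOp d q F j x =
     (Real.cosh (q i x) * F (x + latE d i) * (Real.sinh (q j x) * F (x + latE d j))
      - Real.cosh (q i (x - latE d i)) * F (x - latE d i) *
          (Real.sinh (q j (x - latE d j)) * F (x - latE d j)))
     + (Real.cosh (q i (x - latE d i)) * F (x - latE d i) * (Real.sinh (q j x) * F (x + latE d j))
       - Real.cosh (q i x) * F (x + latE d i) *
          (Real.sinh (q j (x - latE d j)) * F (x - latE d j)))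
     - 2 * (F x * (Real.sinh (q j x) * F (x + latE d j))
        - F x * (Real.sinh (q j (x - latE d j)) * F (x - latE d j))) := by
    intro x; unfold sOp aOp; ring
  simp_rw [e1]
  rw [Finset.sum_sub_distrib, Finset.sum_add_distrib, Finset.sum_sub_distrib,
    Finset.sum_sub_distrib, ← Finset.mul_sum, Finset.sum_sub_distrib]
  have a1 := shift_sum hB (fun x => Real.cosh (q i (x - latE d i)) * F (x - latE d i) *
          (Real.sinh (q j (x - latE d j)) * F (x - latE d j))) (-latE d i) (latE d i + latE d j)
     (fun k => by simpa using latE_abs d k i)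
     (fun k => (abs_add_le _ _).trans (by have := latE_abs d k i; have := latE_abs d k j; omega))
     (fun x hx => by
        rw [← sub_eq_add_neg] at hx
        rw [hx]; ring)
  have a2 := shift_sum hB (fun x => Real.cosh (q i (x - latE d i)) * F (x - latE d i) *
          (Real.sinh (q j x) * F (x + latE d j))) (-latE d i) (latE d i - latE d j)
     (fun k => by simpa using latE_abs d k i)
     (fun k => (abs_sub _ _).trans (by have := latE_abs d k i; have := latE_abs d k j; omega))
     (fun x hx => by
        rw [← sub_eq_add_neg] at hx
        rw [hx]; ring)
  have a3 := shiftE hB j (fun x => F x * (Real.sinh (q j (x - latE d j)) * F (x - latE d j)))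
     (fun x hx => by rw [hx]; ring)
  rw [← a1, ← a2, ← a3]
  have b1 : ∀ x, Real.cosh (q i (x + (latE d i + latE d j) - latE d i)) * F (x + (latE d i + latE d j) - latE d i) *
          (Real.sinh (q j (x + (latE d i + latE d j) - latE d j)) * F (x + (latE d i + latE d j) - latE d j))
      = Real.cosh (q i x) * F (x + latE d i) * (Real.sinh (q j x) * F (x + latE d j)) := by
    intro x
    rw [show x + (latE d i + latE d j) - latE d i = x + latE d j by abel,
      show x + (latE d i + latE d j) - latE d j = x + latE d i by abel, hq i j x hij,
      hq j i x hij.symm]; ring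
  have b2 : ∀ x, Real.cosh (q i (x + (latE d i - latE d j) - latE d i)) * F (x + (latE d i - latE d j) - latE d i) *
          (Real.sinh (q j (x + (latE d i - latE d j))) * F (x + (latE d i - latE d j) + latE d j))
      = Real.cosh (q i x) * F (x + latE d i) *
          (Real.sinh (q j (x - latE d j)) * F (x - latE d j)) := by
    intro x
    rw [show x + (latE d i - latE d j) - latE d i = x - latE d j by abel,
      show x + (latE d i - latE d j) + latE d j = x + latE d i by abel, hq' i j x hij,
      show x + (latE d i - latE d j) = x - latE d j + latE d i by abel, 
      hq j i _ hij.symm]; ring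
  simp only [b1, b2, add_sub_cancel_right, sub_self]
  have : ∀ x, F (x + latE d j) * (Real.sinh (q j x) * F x) = F x * (Real.sinh (q j x) * F (x + latE d j)) := by
    intro x; ring
  simp only [this]; ring

lemma sum_sa_eq (hB : NearB d F B) (j : Fin d) {p : ℝ}
    (hq : ∀ x, q j (x + latE d j) = q j x + p) :
    ∑ x ∈ B, sOp d q F j x * aOp d q F j x =
     - Real.sinh p * (∑ x ∈ B, Real.cosh (2 * q j x - p) * F x ^ 2
        - ∑ x ∈ B, F (x + latE d j) * F (x - latE d j)) := by
  have hq' : ∀ x, q j (x - latE d j) = q j x - p := by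
    intro x
    have := hq (x - latE d j)
    rw [sub_add_cancel] at this; linarith
  have e1 : ∀ x, sOp d q F j x * aOp d q F j x =
     (Real.cosh (q j x) * Real.sinh (q j x)) * F (x + latE d j) ^ 2
     - (Real.cosh (q j (x - latE d j)) * Real.sinh (q j (x - latE d j))) * F (x - latE d j) ^ 2
     + Real.sinh p * (F (x + latE d j) * F (x - latE d j))
     - 2 * (F x * (Real.sinh (q j x) * F (x + latE d j))
        - F x * (Real.sinh (q j (x - latE d j)) * F (x - latE d j))) := by
    intro x
    have : Real.sinh p = Real.cosh (q j (x - latE d j)) * Real.sinh (q j x) -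
      Real.cosh (q j x) * Real.sinh (q j (x - latE d j)) := by
      rw [show p = q j x - q j (x - latE d j) by rw [hq']; ring, Real.sinh_sub]; ring
    rw [this]
    unfold sOp aOp; ring
  simp_rw [e1]
  rw [Finset.sum_sub_distrib, Finset.sum_add_distrib, Finset.sum_sub_distrib,
    ← Finset.mul_sum, ← Finset.mul_sum, Finset.sum_sub_distrib]
  have a3 := shiftE hB j (fun x => F x * (Real.sinh (q j (x - latE d j)) * F (x - latE d j)))
     (fun x hx => by rw [hx]; ring)
  have a1 := shiftE' hB j (fun x => (Real.cosh (q j x) * Real.sinh (q j x)) * F x ^ 2)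
     (fun x hx => by rw [hx]; ring)
  have a2 := shiftE hB j (fun x => (Real.cosh (q j (x - latE d j)) * Real.sinh (q j (x - latE d j))) * F x ^ 2)
     (fun x hx => by rw [hx]; ring)
  simp only [add_sub_cancel_right] at a2 a3
  rw [a1, a2, ← a3]
  have : ∀ x, F (x + latE d j) * (Real.sinh (q j x) * F x) = F x * (Real.sinh (q j x) * F (x + latE d j)) := by
    intro x; ring
  simp only [this, sub_self, mul_zero, sub_zero]
  suffices hh : ∑ x ∈ B, (Real.cosh (q j (x - latE d j)) * Real.sinh (q j (x - latE d j)) * F x ^ 2 -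
          Real.cosh (q j x) * Real.sinh (q j x) * F x ^ 2) =
      -Real.sinh p * ∑ x ∈ B, Real.cosh (2 * q j x - p) * F x ^ 2 by
    rw [← Finset.sum_sub_distrib, hh]; ring
  rw [Finset.mul_sum]
  refine Finset.sum_congr rfl fun x _ => ?_
  rw [hq']
  have e2 : Real.cosh (q j x - p) * Real.sinh (q j x - p) = (Real.cosh (q j x) * Real.cosh p - Real.sinh (q j x) * Real.sinh p) * (Real.sinh (q j x) * Real.cosh p - Real.cosh (q j x) * Real.sinh p) := by
    rw [Real.cosh_sub, Real.sinh_sub]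
  rw [e2, show 2 * q j x - p = q j x + (q j x - p) by ring, Real.cosh_add, Real.cosh_sub, Real.sinh_sub]
  have h1 := Real.cosh_sq (q j x)
  have h2 := Real.cosh_sq p
  have h3 : ∀ c s C S f : ℝ, c ^ 2 = s ^ 2 + 1 → C ^ 2 = S ^ 2 + 1 →
    (c * C - s * S) * (s * C - c * S) * f ^ 2 - c * s * f ^ 2 =
     -S * ((c * (c * C - s * S) + s * (s * C - c * S)) * f ^ 2) := by
    intro c s C S f h1 h2
    linear_combination (c * s * f^2) * h2 
  exact h3 _ _ _ _ _ h1 h2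

lemma sum_ta (hB : NearB d F B) (j : Fin d) {σ : ℝ} {Ft : (Fin d → ℤ) → ℝ}
    (hFt : ∀ x, Ft (x + latE d j) = Ft x - q j x / σ) :
    ∑ x ∈ B, Ft x * F x * aOp d q F j x =
      ∑ x ∈ B, q j x * Real.sinh (q j x) * (F x * F (x + latE d j)) / σ := by
  have e1 : ∀ x, Ft x * F x * aOp d q F j x =
     Ft x * F x * (Real.sinh (q j x) * F (x + latE d j))
        - Ft x * F x * (Real.sinh (q j (x - latE d j)) * F (x - latE d j)) := by
    intro x; unfold aOp; ring
  simp_rw [e1]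
  rw [Finset.sum_sub_distrib]
  have a3 := shiftE hB j (fun x => Ft x * F x * (Real.sinh (q j (x - latE d j)) * F (x - latE d j)))
     (fun x hx => by rw [hx]; ring)
  simp only [add_sub_cancel_right] at a3
  rw [← a3, ← Finset.sum_sub_distrib]
  refine Finset.sum_congr rfl fun x _ => ?_
  rw [hFt]; ring

lemma sum_r (hB : NearB d F B) (j : Fin d) :
    ∑ x ∈ B, rOp d q F j x * F x =
      2 * ∑ x ∈ B, q j x * Real.sinh (q j x) * (F x * F (x + latE d j)) := by
  have a3 := shiftE hB j (fun x => q j (x - latE d j) * Real.sinh (q j (x - latE d j)) * F (x - latE d j) * F x)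
     (fun x hx => by rw [hx]; ring)
  simp only [add_sub_cancel_right] at a3
  unfold rOp
  simp_rw [add_mul]
  rw [Finset.sum_add_distrib, ← a3, two_mul]
  congr 1 <;> exact Finset.sum_congr rfl fun x _ => by ring

lemma sum_s (hB : NearB d F B) (j : Fin d) :
    ∑ x ∈ B, sOp d q F j x * F x =
      2 * ∑ x ∈ B, Real.cosh (q j x) * (F x * F (x + latE d j)) - 2 * ∑ x ∈ B, F x ^ 2 := by
  have a3 := shiftE hB j (fun x => Real.cosh (q j (x - latE d j)) * F (x - latE d j) * F x)
     (fun x hx => by rw [hx]; ring)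
  simp only [add_sub_cancel_right] at a3
  unfold sOp
  simp_rw [sub_mul, add_mul]
  rw [Finset.sum_sub_distrib, Finset.sum_add_distrib, ← a3, two_mul, Finset.mul_sum]
  congr 1
  · congr 1 <;> exact Finset.sum_congr rfl fun x _ => by ring
  · exact Finset.sum_congr rfl fun x _ => by ring

lemma sum_s_symm {F' : (Fin d → ℤ) → ℝ} (hB : NearB d F B) (hB' : NearB d F' B) (j : Fin d) :
    ∑ x ∈ B, sOp d q F' j x * F x = ∑ x ∈ B, sOp d q F j x * F' x := by
  have a3 := shiftE hB j (fun x => Real.cosh (q j (x - latE d j)) * F' (x - latE d j) * F x)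
     (fun x hx => by rw [hx]; ring)
  have a4 := shiftE hB' j (fun x => Real.cosh (q j (x - latE d j)) * F (x - latE d j) * F' x)
     (fun x hx => by rw [hx]; ring)
  simp only [add_sub_cancel_right] at a3 a4
  unfold sOp
  simp_rw [sub_mul, add_mul]
  rw [Finset.sum_sub_distrib, Finset.sum_add_distrib, ← a3, Finset.sum_sub_distrib, Finset.sum_add_distrib,
   ← a4, ← Finset.sum_add_distrib, ← Finset.sum_add_distrib]
  congr 1
  · exact Finset.sum_congr rfl fun x _ => by ring
  · exact Finset.sum_congr rfl fun x _ => by ring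

lemma sum_w (hB : NearB d F B) (j : Fin d) (w : (Fin d → ℤ) → ℝ) :
    ∑ x ∈ B, w x * (F x * F (x + latE d j)) =
      ∑ x ∈ B, (1/2) * (w x + w (x - latE d j)) * F x ^ 2
       - ∑ x ∈ B, (1/2) * w x * (F (x + latE d j) - F x) ^ 2 := by
  have a3 := shiftE hB j (fun x => (1/2) * w (x - latE d j) * F x ^ 2)
     (fun x hx => by rw [hx]; ring)
  simp only [add_sub_cancel_right] at a3
  have : ∑ x ∈ B, (1/2) * (w x + w (x - latE d j)) * F x ^ 2 =
    ∑ x ∈ B, (1/2) * w x * F x ^ 2 + ∑ x ∈ B, (1/2) * w (x - latE d j) * F x ^ 2 := by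
    rw [← Finset.sum_add_distrib]; exact Finset.sum_congr rfl fun x _ => by ring
  rw [this, ← a3, ← Finset.sum_add_distrib, ← Finset.sum_sub_distrib]
  exact Finset.sum_congr rfl fun x _ => by ring

lemma sum_pm (hB : NearB d F B) (j : Fin d) :
    ∑ x ∈ B, F x ^ 2 - 2 * ∑ x ∈ B, (F (x + latE d j) - F x) ^ 2 ≤ 
     ∑ x ∈ B, F (x + latE d j) * F (x - latE d j) := by
  have a1 := shift_sum hB (fun x => (F x - F (x - latE d j)) ^ 2 - F (x - latE d j) ^ 2) 0 (latE d j) (by simp)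
    (fun i => (latE_abs d i j).trans (by norm_num)) (by intro x hx; simp at hx; simp [hx])
  have a2 := shiftE hB j (fun x => F x * (F x - F (x - latE d j))) (fun x hx => by rw [hx]; ring)
  have a3 := shiftE' hB j (fun x => F x ^ 2) (fun x hx => by rw [hx]; ring)
  simp only [add_sub_cancel_right] at a1 a2
  rw [Finset.sum_sub_distrib, Finset.sum_sub_distrib, a3] at a1
  have h : ∀ x, F x ^ 2 + F x * (F (x + latE d j) - F x) - F x * (F x - F (x - latE d j))
     - (1/2) * (F (x + latE d j) - F x) ^ 2 - (1/2) * (F x - F (x - latE d j)) ^ 2 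
      ≤ F (x + latE d j) * F (x - latE d j) := by
    intro x
    nlinarith [sq_nonneg ((F (x + latE d j) - F x) - (F x - F (x - latE d j)))]
  have h2 := Finset.sum_le_sum (fun x (_ : x ∈ B) => h x)
  simp only [Finset.sum_sub_distrib, Finset.sum_add_distrib, ← Finset.mul_sum] at h2
  have h3 : ∑ x ∈ B, F (x + latE d j) * (F (x + latE d j) - F x) = 
    ∑ x ∈ B, F x * (F (x + latE d j) - F x) + ∑ x ∈ B, (F (x + latE d j) - F x) ^ 2 := by
    rw [← Finset.sum_add_distrib]; exact Finset.sum_congr rfl fun x _ => by ring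
  linarith
end OneDir

end

section

lemma exp_bd4 (x : ℝ) (hx : |x| ≤ 1) : |Real.exp x - (1 + x + x^2/2 + x^3/6)| ≤ x^4 * (5/96) := by
  have := Real.exp_bound hx (n := 4) (by norm_num)
  simp only [Finset.sum_range_succ, Finset.sum_range_zero, Nat.factorial] at this
  norm_num at this
  have e : |x|^4 = x^4 := by rw [← abs_pow]; exact abs_of_nonneg (by positivity)
  rw [e] at this
  convert this using 3

lemma exp_bd5 (x : ℝ) (hx : |x| ≤ 1) : |Real.exp x - (1 + x + x^2/2 + x^3/6 + x^4/24)| ≤ |x|^5 * (1/100) := by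
  have := Real.exp_bound hx (n := 5) (by norm_num)
  simp only [Finset.sum_range_succ, Finset.sum_range_zero, Nat.factorial] at this
  norm_num at this
  convert this using 3

lemma cosh_le4 (x : ℝ) (hx : |x| ≤ 1) : Real.cosh x ≤ 1 + x^2/2 + x^4/16 := by
  have h1 := abs_le.1 (exp_bd4 x hx)
  have h2 := abs_le.1 (exp_bd4 (-x) (by simpa using hx))
  rw [Real.cosh_eq]
  nlinarith [sq_nonneg (x^2), h1.2, h2.2]

lemma x_sinh_ge (x : ℝ) : x^2 ≤ x * Real.sinh x := by
  rcases le_total 0 x with h | h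
  · nlinarith [Real.self_le_sinh_iff.2 h]
  · nlinarith [Real.sinh_le_self_iff.2 h]

lemma sinh_le3 (x : ℝ) (h0 : 0 ≤ x) (hx : x ≤ 1) : Real.sinh x ≤ x * (1 + x^2/5) := by
  have h1 := abs_le.1 (exp_bd5 x (by rwa [abs_of_nonneg h0]))
  have h2 := abs_le.1 (exp_bd5 (-x) (by simpa [abs_of_nonneg h0] using hx))
  rw [abs_neg, abs_of_nonneg h0] at h2
  rw [abs_of_nonneg h0] at h1
  rw [Real.sinh_eq]
  have : x^5 ≤ x^3 := pow_le_pow_of_le_one h0 hx (by norm_num)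
  have : 0 ≤ x^3 := by positivity
  nlinarith [h1.2, h2.1]

lemma x_sinh_le (x : ℝ) (hx : |x| ≤ 1) : x * Real.sinh x ≤ x^2 * (6/5) := by
  have key : ∀ y : ℝ, 0 ≤ y → y ≤ 1 → y * Real.sinh y ≤ y^2 * (6/5) := by
    intro y h0 h1
    have := sinh_le3 y h0 h1
    have h2 : y^2 ≤ 1 := by nlinarith
    nlinarith [sq_nonneg y, mul_le_mul_of_nonneg_left this h0, mul_nonneg (sq_nonneg y) (sub_nonneg.2 h2)]
  rcases le_total 0 x with h | h
  · exact key x h (by rwa [abs_of_nonneg h] at hx)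
  · have := key (-x) (by linarith) (by rwa [abs_of_nonpos h] at hx)
    simp [Real.sinh_neg] at this; linarith

lemma abs_le_one_of_sq {x ρ : ℝ} (hρ : ρ ≤ 1/4) (hx : x^2 ≤ ρ/40) : |x| ≤ 1/10 := by
  apply abs_le_of_sq_le_sq _ (by norm_num)
  nlinarith

lemma grad_nonneg (ρ q p s : ℝ) (h0 : 0 < ρ) (h1 : ρ ≤ 1/4) (hq : q^2 ≤ ρ/40) (hp : p^2 ≤ ρ/40)
    (hs : s ≤ 1 + p^2/5) :
    0 ≤ (1+2*ρ) * Real.cosh q - 2*(1+ρ)*(q * Real.sinh q) - (1+ρ)*s := by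
  have h2 := x_sinh_le q ((abs_le_one_of_sq h1 hq).trans (by norm_num))
  have h3 := Real.one_le_cosh q
  have h4 : (1+2*ρ) * 1 ≤ (1+2*ρ) * Real.cosh q := by gcongr
  have h5 : 2*(1+ρ)*(q * Real.sinh q) ≤ 2*(1+ρ)*(ρ/40 * (6/5)) := by
    exact mul_le_mul_of_nonneg_left (by linarith) (by linarith)
  have h6 : (1+ρ)*s ≤ (1+ρ)*(1+(ρ/40)/5) := by gcongr; linarith
  nlinarith

lemma zero_poly (ρ u r : ℝ) (h0 : 0 < ρ) (h1 : ρ ≤ 1/4) (hu : 0 ≤ u) (hr : 0 ≤ r)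
    (hQ : u ≤ ρ/40) :
    2*u + (1/2)*(1+ρ)*(1+r/5)*(2*u+u^2) + (1+2*ρ)*(u + r/4 + (ρ/40)*(2*u+r/2)/16)
     ≤ 2*(1+ρ)*(2*u+r/2) := by
  have c1 : u^2 ≤ ρ/40*u := by nlinarith
  have hρu : 0 ≤ ρ*u := mul_nonneg h0.le hu
  have hρr : 0 ≤ ρ*r := mul_nonneg h0.le hr
  have d4 : ρ*(ρ*u) ≤ (1/4)*(ρ*u) := mul_le_mul_of_nonneg_right h1 hρu
  have d5 : ρ*r ≤ (1/4)*r := mul_le_mul_of_nonneg_right h1 hr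
  have d6 : ρ*(ρ*r) ≤ (1/4)*(ρ*r) := mul_le_mul_of_nonneg_right h1 hρr
  have c2 : (1/2)*(1+ρ)*(1+r/5)*(2*u+u^2) ≤ (1+ρ)*u + (1/4)*r + (1/32)*ρ*u := by
    have : (1/2)*(1+ρ)*(1+r/5)*(2*u+u^2) ≤ (1/2)*(1+ρ)*(1+r/5)*(2*u+ρ/40*u) := by gcongr
    have hw : 0 ≤ r*u := mul_nonneg hr hu
    have d1 : r*u ≤ r*(1/160) := mul_le_mul_of_nonneg_left (by linarith) hr
    have d2 : ρ*(r*u) ≤ (1/4)*(r*u) := mul_le_mul_of_nonneg_right h1 hw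
    have d3 : ρ*(ρ*(r*u)) ≤ (1/4)*(ρ*(r*u)) := mul_le_mul_of_nonneg_right h1 (mul_nonneg h0.le hw)
    have e : (1/2)*(1+ρ)*(1+r/5)*(2*u+ρ/40*u) = (1+ρ)*u + (1/80)*(ρ*u) + (1/80)*(ρ*(ρ*u))
      + (1/5)*(r*u) + (1/5)*(ρ*(r*u)) + (1/400)*(ρ*(r*u)) + (1/400)*(ρ*(ρ*(r*u))) := by ring
    rw [e] at this
    linarith
  have c3 : (1+2*ρ)*(u + r/4 + (ρ/40)*(2*u+r/2)/16) ≤ (1+2*ρ)*u + r*(2/5) + ρ*u*(1/100) := by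
    have e : (1+2*ρ)*(u + r/4 + (ρ/40)*(2*u+r/2)/16) = (1+2*ρ)*u + r/4 + (ρ*r)/2
      + (1/320)*(ρ*u) + (1/1280)*(ρ*r) + (1/160)*(ρ*(ρ*u)) + (1/640)*(ρ*(ρ*r)) := by ring
    rw [e]; linarith
  linarith

lemma zero_nonneg (ρ Q p s : ℝ) (h0 : 0 < ρ) (h1 : ρ ≤ 1/4) (hq : (Q+p/2)^2 ≤ ρ/40)
    (hq' : (Q-p/2)^2 ≤ ρ/40) (hp : p^2 ≤ ρ/40)
    (hs0 : 0 ≤ s) (hs : s ≤ 1 + p^2/5) :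
    2*Q^2 ≤ 2*(1+ρ)*((Q+p/2)*Real.sinh (Q+p/2) + (Q-p/2)*Real.sinh (Q-p/2))
      - (1/2)*(1+ρ)*s*(Real.cosh (2*Q) - 1)
      - (1+2*ρ)*(Real.cosh (Q+p/2) + Real.cosh (Q-p/2) - 2) := by
  have hQ : Q^2 ≤ ρ/40 := by nlinarith [sq_nonneg p]
  have a1 := x_sinh_ge (Q+p/2)
  have a2 := x_sinh_ge (Q-p/2)
  have a3 := cosh_le4 (2*Q) (by 
    rw [abs_mul]; have := abs_le_one_of_sq h1 hQ; norm_num; linarith)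
  have a4 := cosh_le4 (Q+p/2) ((abs_le_one_of_sq h1 hq).trans (by norm_num))
  have a5 := cosh_le4 (Q-p/2) ((abs_le_one_of_sq h1 hq').trans (by norm_num))
  have a6 : (Q+p/2)^4 ≤ ρ/40 * (Q+p/2)^2 := by nlinarith [sq_nonneg (Q+p/2)]
  have a7 : (Q-p/2)^4 ≤ ρ/40 * (Q-p/2)^2 := by nlinarith [sq_nonneg (Q-p/2)]
  have b1 : 2*(1+ρ)*((Q+p/2)^2+(Q-p/2)^2) ≤ 2*(1+ρ)*((Q+p/2)*Real.sinh (Q+p/2) + (Q-p/2)*Real.sinh (Q-p/2)) := by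
    gcongr
  have b0 : 0 ≤ Real.cosh (2*Q) - 1 := by linarith [Real.one_le_cosh (2*Q)]
  have b2 : (1/2)*(1+ρ)*s*(Real.cosh (2*Q) - 1) ≤ (1/2)*(1+ρ)*(1+p^2/5)*(2*Q^2+Q^4) := by
    gcongr; nlinarith
  have b3 : (1+2*ρ)*(Real.cosh (Q+p/2) + Real.cosh (Q-p/2) - 2) ≤ 
     (1+2*ρ)*((Q+p/2)^2/2 + (Q-p/2)^2/2 + (ρ/40)*((Q+p/2)^2+(Q-p/2)^2)/16) := by
    gcongr; linarith
  have e1 : (Q+p/2)^2+(Q-p/2)^2 = 2*Q^2+p^2/2 := by ring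
  have e2 : (Q+p/2)^2/2+(Q-p/2)^2/2 = Q^2+p^2/4 := by ring
  rw [e1] at b1 b3
  rw [e2] at b3
  have e3 : Q^4 = (Q^2)^2 := by ring
  rw [e3] at b2
  have hu : 0 ≤ Q^2 := sq_nonneg _
  have hr : 0 ≤ p^2 := sq_nonneg _
  generalize Q^2 = u at *
  generalize p^2 = r at *
  have := zero_poly ρ u r h0 h1 hu hr hQ
  linarith

end

section

lemma perj_unscaled {d : ℕ} {F : (Fin d → ℤ) → ℝ} {B : Finset (Fin d → ℤ)}
    {q : Fin d → (Fin d → ℤ) → ℝ} (hB : NearB d F B) (j : Fin d) {p ρ s : ℝ}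
    (hq : ∀ x, q j (x + latE d j) = q j x + p) (h0 : 0 < ρ) (h1 : ρ ≤ 1/4)
    (hp : p^2 ≤ ρ/40) (hs0 : 0 ≤ s) (hs : s ≤ 1 + p^2/5)
    (hsm : ∀ x, F x ≠ 0 ∨ F (x + latE d j) ≠ 0 → (q j x)^2 ≤ ρ/40) :
    ∑ x ∈ B, 2 * (q j x - p/2)^2 * F x ^ 2 ≤
      -(1+2*ρ) * (2 * ∑ x ∈ B, Real.cosh (q j x) * (F x * F (x + latE d j)) - 2 * ∑ x ∈ B, F x ^ 2)
      + 4*(1+ρ) * ∑ x ∈ B, q j x * Real.sinh (q j x) * (F x * F (x + latE d j))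
      - (1/2)*(1+ρ)*s*(∑ x ∈ B, Real.cosh (2 * q j x - p) * F x ^ 2
        - ∑ x ∈ B, F (x + latE d j) * F (x - latE d j)) := by
  have hq' : ∀ x, q j (x - latE d j) = q j x - p := by
    intro x
    have := hq (x - latE d j)
    rw [sub_add_cancel] at this; linarith
  rw [sum_w hB j (fun x => Real.cosh (q j x)), sum_w hB j (fun x => q j x * Real.sinh (q j x))]
  have hpm := sum_pm hB j
  have hpm2 : (1/2)*(1+ρ)*s*(∑ x ∈ B, F x ^ 2 - 2 * ∑ x ∈ B, (F (x + latE d j) - F x) ^ 2) ≤ 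
     (1/2)*(1+ρ)*s*∑ x ∈ B, F (x + latE d j) * F (x - latE d j) := by gcongr
  have hz : ∑ x ∈ B, 2 * (q j x - p/2)^2 * F x ^ 2 ≤
     -(1+2*ρ) * (2 * ∑ x ∈ B, (1/2) * (Real.cosh (q j x) + Real.cosh (q j (x - latE d j))) * F x ^ 2 - 2 * ∑ x ∈ B, F x ^ 2)
      + 4*(1+ρ) * ∑ x ∈ B, (1/2) * (q j x * Real.sinh (q j x) + q j (x - latE d j) * Real.sinh (q j (x - latE d j))) * F x ^ 2
      - (1/2)*(1+ρ)*s*(∑ x ∈ B, Real.cosh (2 * q j x - p) * F x ^ 2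
        - ∑ x ∈ B, F x ^ 2) := by
    simp only [Finset.mul_sum, ← Finset.sum_sub_distrib, ← Finset.sum_add_distrib]
    refine Finset.sum_le_sum fun x _ => ?_
    by_cases hF : F x = 0
    · rw [hF]; simp
    have k := zero_nonneg ρ (q j x - p/2) p s h0 h1
      (by have := hsm x (Or.inl hF); simpa using this)
      (by have := hsm (x - latE d j) (Or.inr (by simpa using hF)); rw [hq'] at this
          convert this using 2; ring) hp hs0 hs
    rw [hq']
    rw [show q j x - p/2 + p/2 = q j x by ring, show q j x - p/2 - p/2 = q j x - p by ring,
      show 2 * (q j x - p/2) = 2 * q j x - p by ring] at k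
    have := mul_le_mul_of_nonneg_right k (sq_nonneg (F x))
    linarith
  have hg : 0 ≤ (1+2*ρ) * ∑ x ∈ B, Real.cosh (q j x) * (F (x + latE d j) - F x) ^ 2
     - 2*(1+ρ) * ∑ x ∈ B, (q j x * Real.sinh (q j x)) * (F (x + latE d j) - F x) ^ 2
     - (1+ρ)*s*∑ x ∈ B, (F (x + latE d j) - F x) ^ 2 := by
    simp only [Finset.mul_sum, ← Finset.sum_sub_distrib, ← Finset.sum_add_distrib]
    refine Finset.sum_nonneg fun x _ => ?_
    by_cases hF : F x = 0 ∧ F (x + latE d j) = 0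
    · rw [hF.1, hF.2]; simp
    have k := grad_nonneg ρ (q j x) p s h0 h1 (hsm x (by tauto)) hp hs
    have := mul_nonneg k (sq_nonneg (F (x + latE d j) - F x))
    linarith
  have e1 : ∑ x ∈ B, (1/2) * Real.cosh (q j x) * (F (x + latE d j) - F x) ^ 2 = 
     (1/2) * ∑ x ∈ B, Real.cosh (q j x) * (F (x + latE d j) - F x) ^ 2 := by
    rw [Finset.mul_sum]; exact Finset.sum_congr rfl fun x _ => by ring
  have e2 : ∑ x ∈ B, (1/2) * (q j x * Real.sinh (q j x)) * (F (x + latE d j) - F x) ^ 2 = 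
     (1/2) * ∑ x ∈ B, (q j x * Real.sinh (q j x)) * (F (x + latE d j) - F x) ^ 2 := by
    rw [Finset.mul_sum]; exact Finset.sum_congr rfl fun x _ => by ring
  rw [e1, e2]
  linarith

def qv (d : ℕ) (h σ : ℝ) (z : Fin d → ℝ) (j : Fin d) (x : Fin d → ℤ) : ℝ :=
  h * (h * x j + h/2 - z j) / (4 * σ)
def Y2 (d : ℕ) (h : ℝ) (z : Fin d → ℝ) (x : Fin d → ℤ) : ℝ := ∑ j, (h * x j - z j)^2
def Ftv (d : ℕ) (h σ ℓ α : ℝ) (z : Fin d → ℝ) (x : Fin d → ℤ) : ℝ :=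
  - Y2 d h z x / (8 * σ^2) + α * (1/σ - 1/(4*ℓ))
def Fttv (d : ℕ) (h σ α : ℝ) (z : Fin d → ℝ) (x : Fin d → ℤ) : ℝ :=
  - Y2 d h z x / (4 * σ^3) + α / σ^2
def Stot (d : ℕ) (h σ ℓ α : ℝ) (z : Fin d → ℝ) (F : (Fin d → ℤ) → ℝ) (x : Fin d → ℤ) : ℝ :=
  (∑ j, sOp d (qv d h σ z) F j x) / h^2 + Ftv d h σ ℓ α z x * F x
def Atot (d : ℕ) (h σ : ℝ) (z : Fin d → ℝ) (F : (Fin d → ℤ) → ℝ) (x : Fin d → ℤ) : ℝ :=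
  (∑ j, aOp d (qv d h σ z) F j x) / h^2
def Rtot (d : ℕ) (h σ α : ℝ) (z : Fin d → ℝ) (F : (Fin d → ℤ) → ℝ) (x : Fin d → ℤ) : ℝ :=
  (∑ j, rOp d (qv d h σ z) F j x) / (σ * h^2) + Fttv d h σ α z x * F x

lemma qv_shift (d : ℕ) (h σ : ℝ) (z : Fin d → ℝ) (j : Fin d) (x : Fin d → ℤ) :
    qv d h σ z j (x + latE d j) = qv d h σ z j x + h^2/(4*σ) := by
  simp only [qv, Pi.add_apply, latE_self]; push_cast; ring
lemma qv_shift_ne (d : ℕ) (h σ : ℝ) (z : Fin d → ℝ) (i j : Fin d) (x : Fin d → ℤ) (hij : i ≠ j) :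
    qv d h σ z i (x + latE d j) = qv d h σ z i x := by
  simp only [qv, Pi.add_apply, latE_ne d hij]; push_cast; ring
lemma Y2_shift (d : ℕ) (h : ℝ) (z : Fin d → ℝ) (j : Fin d) (x : Fin d → ℤ) :
    Y2 d h z (x + latE d j) = Y2 d h z x + 2*h*(h * x j + h/2 - z j) := by
  unfold Y2
  rw [← Finset.add_sum_erase _ _ (Finset.mem_univ j), ← Finset.add_sum_erase _ _ (Finset.mem_univ j)]
  have : ∀ i ∈ Finset.univ.erase j, (h * ((x + latE d j) i : ℝ) - z i)^2 = (h * (x i) - z i)^2 := by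
    intro i hi
    simp [latE_ne d (Finset.ne_of_mem_erase hi)]
  rw [Finset.sum_congr rfl this]
  simp only [Pi.add_apply, latE_self]; push_cast; ring
lemma Ftv_shift (d : ℕ) (h σ ℓ α : ℝ) (hσ : 0 < σ) (z : Fin d → ℝ) (j : Fin d) (x : Fin d → ℤ) :
    Ftv d h σ ℓ α z (x + latE d j) = Ftv d h σ ℓ α z x - qv d h σ z j x / σ := by
  unfold Ftv qv
  rw [Y2_shift]; field_simp; ring

lemma Stot_symm {d : ℕ} {h σ ℓ α : ℝ} {z : Fin d → ℝ} {F F' : (Fin d → ℤ) → ℝ}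
    {B : Finset (Fin d → ℤ)} (hB : NearB d F B) (hB' : NearB d F' B) :
    ∑ x ∈ B, Stot d h σ ℓ α z F' x * F x = ∑ x ∈ B, Stot d h σ ℓ α z F x * F' x := by
  have e : ∀ F F' : (Fin d → ℤ) → ℝ, ∑ x ∈ B, Stot d h σ ℓ α z F' x * F x =
    (∑ j, ∑ x ∈ B, sOp d (qv d h σ z) F' j x * F x) / h^2 + ∑ x ∈ B, Ftv d h σ ℓ α z x * (F' x * F x) := by
    intro F F'
    rw [Finset.sum_comm, Finset.sum_div, ← Finset.sum_add_distrib]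
    refine Finset.sum_congr rfl fun x _ => ?_
    unfold Stot
    rw [← Finset.sum_mul]; ring
  rw [e, e]
  congr 1
  · congr 1
    exact Finset.sum_congr rfl fun j _ => sum_s_symm hB hB' j
  · exact Finset.sum_congr rfl fun x _ => by ring

theorem static_lemma {d : ℕ} {h σ ℓ α : ℝ} (z : Fin d → ℝ) {F E : (Fin d → ℤ) → ℝ}
    {B : Finset (Fin d → ℤ)} (hB : NearB d F B) (hh : 0 < h) (hσ : 0 < σ) (hℓ : 0 < ℓ)
    (hα : 0 ≤ α) (h1 : σ/(8*ℓ) ≤ 1/4) (hp : (h^2/(4*σ))^2 ≤ (σ/(8*ℓ))/40)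
    (hsm : ∀ j x, F x ≠ 0 ∨ F (x + latE d j) ≠ 0 → (qv d h σ z j x)^2 ≤ (σ/(8*ℓ))/40) :
    α/(8*ℓ) * ∑ x ∈ B, F x ^ 2 - (1/2) * (σ + σ^2/(8*ℓ)) * ∑ x ∈ B, E x ^ 2 ≤
     -(1 + σ/(4*ℓ)) * ∑ x ∈ B, Stot d h σ ℓ α z F x * F x
     + (σ + σ^2/(8*ℓ)) * (∑ x ∈ B, Rtot d h σ α z F x * F x
        + 2 * ∑ x ∈ B, Stot d h σ ℓ α z F x * (Stot d h σ ℓ α z F x + Atot d h σ z F x + E x)) := by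
  set q := qv d h σ z with hqdef
  set p := h^2/(4*σ) with hpdef
  have hp0 : 0 < p := by positivity
  set ρ := σ/(8*ℓ) with hρdef
  have hρ0 : 0 < ρ := by positivity
  set s := Real.sinh p / p with hsdef
  have hs0 : 0 ≤ s := div_nonneg (Real.sinh_nonneg_iff.2 hp0.le) hp0.le
  have hp1 : p ≤ 1 := by
    have := abs_le_one_of_sq h1 hp
    rw [abs_of_pos hp0] at this; linarith
  have hs : s ≤ 1 + p^2/5 := by
    rw [hsdef, div_le_iff₀ hp0]; linarith [sinh_le3 p hp0.le hp1]
  have hj := fun j => perj_unscaled hB j (qv_shift d h σ z j) hρ0 h1 hp hs0 hs (hsm j)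
  set N := ∑ x ∈ B, F x ^ 2 with hN
  set c := fun j => ∑ x ∈ B, Real.cosh (q j x) * (F x * F (x + latE d j)) with hc
  set g := fun j => ∑ x ∈ B, q j x * Real.sinh (q j x) * (F x * F (x + latE d j)) with hg
  set m := fun j => (∑ x ∈ B, Real.cosh (2 * q j x - p) * F x ^ 2
        - ∑ x ∈ B, F (x + latE d j) * F (x - latE d j)) with hm
  have eD : ∑ x ∈ B, Stot d h σ ℓ α z F x * F x =
     (∑ j, (2 * c j - 2 * N)) / h^2 + ∑ x ∈ B, Ftv d h σ ℓ α z x * F x ^ 2 := by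
    have : ∀ j, 2 * c j - 2 * N = ∑ x ∈ B, sOp d q F j x * F x := fun j => (sum_s hB j).symm
    simp_rw [this]
    rw [Finset.sum_comm, Finset.sum_div, ← Finset.sum_add_distrib]
    refine Finset.sum_congr rfl fun x _ => ?_
    unfold Stot
    rw [← Finset.sum_mul]; ring
  have eR : ∑ x ∈ B, Rtot d h σ α z F x * F x =
     (∑ j, 2 * g j) / (σ * h^2) + ∑ x ∈ B, Fttv d h σ α z x * F x ^ 2 := by
    have : ∀ j, 2 * g j = ∑ x ∈ B, rOp d q F j x * F x := fun j => (sum_r hB j).symm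
    simp_rw [this]
    rw [Finset.sum_comm, Finset.sum_div, ← Finset.sum_add_distrib]
    refine Finset.sum_congr rfl fun x _ => ?_
    unfold Rtot
    rw [← Finset.sum_mul]; ring
  have eA : ∑ x ∈ B, Stot d h σ ℓ α z F x * Atot d h σ z F x =
     (∑ j, -Real.sinh p * m j) / h^4 + (∑ j, g j) / (σ * h^2) := by
    have a1 : ∀ j, -Real.sinh p * m j = ∑ i, ∑ x ∈ B, sOp d q F i x * aOp d q F j x := by
      intro j
      rw [Finset.sum_eq_single j]
      · exact (sum_sa_eq hB j (qv_shift d h σ z j)).symm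
      · intro i _ hij
        exact sum_sa_ne hB hij (fun i j x h' => qv_shift_ne d h σ z i j x h')
      · simp
    have a2 : ∀ j, g j / σ = ∑ x ∈ B, Ftv d h σ ℓ α z x * F x * aOp d q F j x := by
      intro j
      rw [sum_ta hB j (fun x => Ftv_shift d h σ ℓ α hσ z j x), ← Finset.sum_div]
    have a3 : (∑ j, g j) / (σ * h^2) = (∑ j, g j / σ) / h^2 := by
      rw [← Finset.sum_div]; field_simp
    rw [a3]
    simp_rw [a1, a2]
    have : ∀ x, Stot d h σ ℓ α z F x * Atot d h σ z F x = 
       (∑ j, ∑ i, sOp d q F i x * aOp d q F j x) / h^4 + 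
        (∑ j, Ftv d h σ ℓ α z x * F x * aOp d q F j x) / h^2 := by
      intro x
      unfold Stot Atot
      rw [← Finset.mul_sum, Finset.sum_congr rfl (fun j _ => (Finset.sum_mul _ _ _).symm), ← Finset.mul_sum]
      rw [← hqdef]
      field_simp
    simp_rw [this]
    rw [Finset.sum_add_distrib, ← Finset.sum_div, ← Finset.sum_div, Finset.sum_comm]
    congr 2
    · refine Finset.sum_congr rfl fun j _ => ?_
      rw [Finset.sum_comm]
    · rw [Finset.sum_comm]
  have eS : ∑ x ∈ B, Stot d h σ ℓ α z F x * (Stot d h σ ℓ α z F x + Atot d h σ z F x + E x) ≥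
     ∑ x ∈ B, Stot d h σ ℓ α z F x * Atot d h σ z F x - (1/4) * ∑ x ∈ B, E x ^ 2 := by
    rw [Finset.mul_sum, ← Finset.sum_sub_distrib]
    refine Finset.sum_le_sum fun x _ => ?_
    nlinarith [sq_nonneg (Stot d h σ ℓ α z F x + E x / 2)]
  have hη : 0 < σ + σ^2/(8*ℓ) := by positivity
  have key : α/(8*ℓ) * N ≤ -(1 + σ/(4*ℓ)) * ∑ x ∈ B, Stot d h σ ℓ α z F x * F x
     + (σ + σ^2/(8*ℓ)) * (∑ x ∈ B, Rtot d h σ α z F x * F x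
        + 2 * ∑ x ∈ B, Stot d h σ ℓ α z F x * Atot d h σ z F x) := by
    have hsum := Finset.sum_le_sum (fun j (_ : j ∈ Finset.univ) => hj j)
    have hpot : α/(8*ℓ) * N ≤ (∑ j, ∑ x ∈ B, 2 * (q j x - p/2)^2 * F x ^ 2)/h^2
       + (-(1 + σ/(4*ℓ)) * ∑ x ∈ B, Ftv d h σ ℓ α z x * F x ^ 2
       + (σ + σ^2/(8*ℓ)) * ∑ x ∈ B, Fttv d h σ α z x * F x ^ 2) := by
      rw [Finset.sum_comm, hN, Finset.sum_div]
      simp only [Finset.mul_sum, ← Finset.sum_add_distrib]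
      refine Finset.sum_le_sum fun x _ => ?_
      rw [← Finset.sum_mul]
      have e1 : ∑ j, 2 * (q j x - p/2)^2 = h^2 * Y2 d h z x / (8*σ^2) := by
        unfold Y2
        rw [Finset.mul_sum, Finset.sum_div]
        refine Finset.sum_congr rfl fun j _ => ?_
        rw [hqdef, hpdef]; unfold qv; field_simp; ring
      rw [e1]
      unfold Ftv Fttv
      have : h^2 * Y2 d h z x / (8*σ^2) * F x ^ 2 / h^2 + (-(1 + σ/(4*ℓ)) * ((-Y2 d h z x / (8*σ^2) + α * (1/σ - 1/(4*ℓ))) * F x ^ 2) + (σ + σ^2/(8*ℓ)) * ((-Y2 d h z x / (4*σ^3) + α/σ^2) * F x ^ 2)) = (α/(8*ℓ) + α*σ/(16*ℓ^2)) * F x ^ 2 := by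
        field_simp; ring
      rw [this]
      gcongr
      have : 0 ≤ α*σ/(16*ℓ^2) := by positivity
      linarith
    refine hpot.trans ?_
    rw [eD, eR, eA]
    have h2 : (∑ j, ∑ x ∈ B, 2 * (q j x - p/2)^2 * F x ^ 2)/h^2 ≤ 
      (∑ j, (-(1+2*ρ) * (2 * c j - 2 * N) + 4*(1+ρ) * g j - (1/2)*(1+ρ)*s*m j))/h^2 := by
      gcongr
    have h3 : (∑ j, (-(1+2*ρ) * (2 * c j - 2 * N) + 4*(1+ρ) * g j - (1/2)*(1+ρ)*s*m j))/h^2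
      = -(1 + σ/(4*ℓ)) * ((∑ j, (2 * c j - 2 * N)) / h^2) + 
       (σ + σ^2/(8*ℓ)) * ((∑ j, 2 * g j) / (σ * h^2) + 2 * ((∑ j, -Real.sinh p * m j) / h^4 + (∑ j, g j) / (σ * h^2))) := by
      rw [Finset.sum_sub_distrib, Finset.sum_add_distrib, ← Finset.mul_sum, ← Finset.mul_sum,
        ← Finset.mul_sum, ← Finset.mul_sum, ← Finset.mul_sum]
      have hsp : Real.sinh p = s * (h^2/(4*σ)) := by
        rw [hsdef, ← hpdef]; field_simp
      rw [hsp, hρdef]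
      field_simp
      ring
    rw [h3] at h2
    linarith
  have : (σ + σ^2/(8*ℓ)) * (∑ x ∈ B, Stot d h σ ℓ α z F x * Atot d h σ z F x - (1/4) * ∑ x ∈ B, E x ^ 2)
    ≤ (σ + σ^2/(8*ℓ)) * ∑ x ∈ B, Stot d h σ ℓ α z F x * (Stot d h σ ℓ α z F x + Atot d h σ z F x + E x) := by
    gcongr
  linarith

end

section

def lapR (d : ℕ) (h : ℝ) (u : (Fin d → ℤ) → ℝ) (x : Fin d → ℤ) : ℝ :=
  ∑ j, (u (x + latE d j) + u (x - latE d j) - 2 * u x) / h^2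
def Phi (d : ℕ) (h ℓ b α : ℝ) (z : Fin d → ℝ) (t : ℝ) (x : Fin d → ℤ) : ℝ :=
  - Y2 d h z x / (8 * (ℓ + b - t)) - α * (Real.log (ℓ + b - t) - (ℓ + b - t) / (4*ℓ))
def Fv (d : ℕ) (h ℓ b α : ℝ) (z : Fin d → ℝ) (χ : (Fin d → ℤ) → ℝ) (u : ℝ → (Fin d → ℤ) → ℝ)
    (t : ℝ) (x : Fin d → ℤ) : ℝ :=
  t / ℓ * χ x * Real.exp (Phi d h ℓ b α z t x) * u t x
def lcomm (d : ℕ) (h : ℝ) (χ u : (Fin d → ℤ) → ℝ) (x : Fin d → ℤ) : ℝ :=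
  ∑ j, ((χ (x + latE d j) + χ (x - latE d j) - 2 * χ x) * u x
    + (χ (x + latE d j) - χ x) * (u (x + latE d j) - u x)
    + (χ (x - latE d j) - χ x) * (u (x - latE d j) - u x)) / h^2
def Ev (d : ℕ) (h ℓ b α : ℝ) (z : Fin d → ℝ) (χ Vx : (Fin d → ℤ) → ℝ) (u : ℝ → (Fin d → ℤ) → ℝ)
    (t : ℝ) (x : Fin d → ℤ) : ℝ :=
  1 / ℓ * χ x * Real.exp (Phi d h ℓ b α z t x) * u t x - Vx x * Fv d h ℓ b α z χ u t x
    - t / ℓ * Real.exp (Phi d h ℓ b α z t x) * lcomm d h χ (u t) x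

lemma Phi_shift (d : ℕ) (h ℓ b α : ℝ) (z : Fin d → ℝ) (t : ℝ) (ht : 0 < ℓ + b - t) (j : Fin d)
    (x : Fin d → ℤ) :
    Phi d h ℓ b α z t (x + latE d j) = Phi d h ℓ b α z t x - qv d h (ℓ + b - t) z j x := by
  unfold Phi qv
  rw [Y2_shift]; field_simp; ring

lemma Phi_shift' (d : ℕ) (h ℓ b α : ℝ) (z : Fin d → ℝ) (t : ℝ) (ht : 0 < ℓ + b - t) (j : Fin d)
    (x : Fin d → ℤ) :
    Phi d h ℓ b α z t (x - latE d j) = Phi d h ℓ b α z t x + qv d h (ℓ + b - t) z j (x - latE d j) := by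
  have := Phi_shift d h ℓ b α z t ht j (x - latE d j)
  rw [sub_add_cancel] at this; linarith

lemma sig_deriv (ℓ b t : ℝ) : HasDerivAt (fun t => ℓ + b - t) (-1) t := by
  simpa using (hasDerivAt_id t).const_sub (ℓ + b)

lemma Phi_deriv (d : ℕ) (h ℓ b α : ℝ) (z : Fin d → ℝ) (t : ℝ) (ht : 0 < ℓ + b - t) (hℓ : 0 < ℓ)
    (x : Fin d → ℤ) :
    HasDerivAt (fun t => Phi d h ℓ b α z t x) (Ftv d h (ℓ + b - t) ℓ α z x) t := by
  have hs := sig_deriv ℓ b t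
  have h1 : HasDerivAt (fun t => - Y2 d h z x / (8 * (ℓ + b - t)))
     (- Y2 d h z x / (8 * (ℓ + b - t)^2)) t := by
    have := (hs.const_mul 8).inv (by positivity) |>.const_mul (- Y2 d h z x)
    refine (this.congr_deriv ?_).congr_of_eventuallyEq (Filter.Eventually.of_forall fun s => ?_)
    · field_simp
    · simp [div_eq_mul_inv]
  have h2 := ((hs.log ht.ne').sub (hs.div_const (4*ℓ))).const_mul α
  refine ((h1.sub h2).congr_deriv ?_).congr_of_eventuallyEq (Filter.Eventually.of_forall fun s => ?_)
  · unfold Ftv; field_simp; ring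
  · simp [Phi]

lemma F_deriv {d : ℕ} {h ℓ b α : ℝ} (z : Fin d → ℝ) {χ Vx : (Fin d → ℤ) → ℝ}
    {u : ℝ → (Fin d → ℤ) → ℝ} (hℓ : 0 < ℓ)
    (hu : ∀ t x, HasDerivAt (fun t => u t x) (lapR d h (u t) x - Vx x * u t x) t)
    (t : ℝ) (ht : 0 < ℓ + b - t) (x : Fin d → ℤ) :
    HasDerivAt (fun t => Fv d h ℓ b α z χ u t x)
      (Stot d h (ℓ + b - t) ℓ α z (Fv d h ℓ b α z χ u t) x
        + Atot d h (ℓ + b - t) z (Fv d h ℓ b α z χ u t) x + Ev d h ℓ b α z χ Vx u t x) t := by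
  have h1 := ((((hasDerivAt_id t).div_const ℓ).mul_const (χ x)).mul
    (Phi_deriv d h ℓ b α z t ht hℓ x).exp).mul (hu t x)
  refine (h1.congr_deriv ?_).congr_of_eventuallyEq (Filter.Eventually.of_forall fun s => ?_)
  swap
  · simp [Fv]
  have e1 : ∀ j, sOp d (qv d h (ℓ+b-t) z) (Fv d h ℓ b α z χ u t) j x
      + aOp d (qv d h (ℓ+b-t) z) (Fv d h ℓ b α z χ u t) j x = 
     t / ℓ * Real.exp (Phi d h ℓ b α z t x) * (χ (x + latE d j) * u t (x + latE d j)
      + χ (x - latE d j) * u t (x - latE d j) - 2 * (χ x * u t x)) := by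
    intro j
    unfold sOp aOp Fv
    rw [Phi_shift d h ℓ b α z t ht, Phi_shift' d h ℓ b α z t ht]
    set q := qv d h (ℓ+b-t) z j x
    set q' := qv d h (ℓ+b-t) z j (x - latE d j)
    have c1 := Real.cosh_add_sinh q
    have c2 := Real.cosh_sub_sinh q'
    have c3 : Real.exp (Phi d h ℓ b α z t x - q) * Real.exp q = Real.exp (Phi d h ℓ b α z t x) := by
      rw [← Real.exp_add]; ring_nf
    have c4 : Real.exp (Phi d h ℓ b α z t x + q') * Real.exp (-q') = Real.exp (Phi d h ℓ b α z t x) := by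
      rw [← Real.exp_add]; ring_nf
    rw [← c1] at c3
    rw [← c2] at c4
    linear_combination (t/ℓ * χ (x + latE d j) * u t (x + latE d j)) * c3 + (t/ℓ * χ (x - latE d j) * u t (x - latE d j)) * c4
  have e2 : Stot d h (ℓ + b - t) ℓ α z (Fv d h ℓ b α z χ u t) x
        + Atot d h (ℓ + b - t) z (Fv d h ℓ b α z χ u t) x = 
      t / ℓ * Real.exp (Phi d h ℓ b α z t x) * (∑ j, (χ (x + latE d j) * u t (x + latE d j)
      + χ (x - latE d j) * u t (x - latE d j) - 2 * (χ x * u t x)) / h^2) 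
      + Ftv d h (ℓ+b-t) ℓ α z x * Fv d h ℓ b α z χ u t x := by
    rw [Finset.mul_sum]
    simp_rw [← mul_div_assoc, ← e1]
    rw [← Finset.sum_div, Finset.sum_add_distrib]
    unfold Stot Atot; ring
  have e3 : ∑ j, (χ (x + latE d j) * u t (x + latE d j)
      + χ (x - latE d j) * u t (x - latE d j) - 2 * (χ x * u t x)) / h^2 =
     lcomm d h χ (u t) x + χ x * lapR d h (u t) x := by
    unfold lcomm lapR
    rw [Finset.mul_sum, ← Finset.sum_add_distrib]
    exact Finset.sum_congr rfl fun j _ => by ring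
  rw [e2, e3]
  unfold Ev Fv
  simp only [id, Pi.mul_apply]
  ring

lemma q_deriv (d : ℕ) (h ℓ b : ℝ) (z : Fin d → ℝ) (t : ℝ) (ht : 0 < ℓ + b - t) (j : Fin d) (x : Fin d → ℤ) :
    HasDerivAt (fun t => qv d h (ℓ+b-t) z j x) (qv d h (ℓ+b-t) z j x / (ℓ+b-t)) t := by
  have := ((sig_deriv ℓ b t).const_mul 4).inv (by positivity) |>.const_mul (h * (h * x j + h/2 - z j))
  refine (this.congr_deriv ?_).congr_of_eventuallyEq (Filter.Eventually.of_forall fun s => ?_)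
  · unfold qv; field_simp
  · simp [qv, div_eq_mul_inv]

lemma Ft_deriv (d : ℕ) (h ℓ b α : ℝ) (z : Fin d → ℝ) (t : ℝ) (ht : 0 < ℓ + b - t) (x : Fin d → ℤ) :
    HasDerivAt (fun t => Ftv d h (ℓ+b-t) ℓ α z x) (Fttv d h (ℓ+b-t) α z x) t := by
  have hs := sig_deriv ℓ b t
  have h1 := ((hs.pow 2).const_mul 8).inv (by simp only [Pi.pow_apply]; positivity) |>.const_mul (- Y2 d h z x)
  have h2 := ((hs.inv ht.ne').sub_const (1/(4*ℓ))).const_mul α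
  refine ((h1.add h2).congr_deriv ?_).congr_of_eventuallyEq (Filter.Eventually.of_forall fun s => ?_)
  · unfold Fttv; simp; field_simp; ring
  · simp [Ftv, div_eq_mul_inv]

lemma S_deriv {d : ℕ} {h ℓ b α : ℝ} (z : Fin d → ℝ) {F : ℝ → (Fin d → ℤ) → ℝ} {F' : (Fin d → ℤ) → ℝ}
    (t : ℝ) (ht : 0 < ℓ + b - t)
    (hF : ∀ x, HasDerivAt (fun t => F t x) (F' x) t) (x : Fin d → ℤ) :
    HasDerivAt (fun t => Stot d h (ℓ+b-t) ℓ α z (F t) x)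
      (Rtot d h (ℓ+b-t) α z (F t) x + Stot d h (ℓ+b-t) ℓ α z F' x) t := by
  have h1 : ∀ j, HasDerivAt (fun t => sOp d (qv d h (ℓ+b-t) z) (F t) j x)
    (rOp d (qv d h (ℓ+b-t) z) (F t) j x / (ℓ+b-t) + sOp d (qv d h (ℓ+b-t) z) F' j x) t := by
    intro j
    have a1 := ((q_deriv d h ℓ b z t ht j x).cosh).mul (hF (x + latE d j))
    have a2 := ((q_deriv d h ℓ b z t ht j (x - latE d j)).cosh).mul (hF (x - latE d j))
    have a3 := (hF x).const_mul 2
    refine (((a1.add a2).sub a3).congr_deriv ?_).congr_of_eventuallyEq (Filter.Eventually.of_forall fun s => ?_)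
    · unfold rOp sOp; ring
    · simp [sOp]
  have h2 := (HasDerivAt.fun_sum (fun j (_ : j ∈ Finset.univ) => h1 j)).div_const (h^2)
  have h3 := (Ft_deriv d h ℓ b α z t ht x).mul (hF x)
  refine ((h2.add h3).congr_deriv ?_).congr_of_eventuallyEq (Filter.Eventually.of_forall fun s => ?_)
  · unfold Rtot Stot
    rw [Finset.sum_add_distrib, ← Finset.sum_div]; field_simp; ring
  · simp [Stot]

end

section

lemma sq3m (a b c : ℝ) : (a-b-c)^2 ≤ 3*(a^2+b^2+c^2) := by
  nlinarith [sq_nonneg (a+b), sq_nonneg (b-c), sq_nonneg (a+c)]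
lemma sq3p (a b c : ℝ) : (a+b+c)^2 ≤ 3*(a^2+b^2+c^2) := by
  nlinarith [sq_nonneg (a-b), sq_nonneg (b-c), sq_nonneg (a-c)]

def mEn (d : ℕ) (h : ℝ) (B : Finset (Fin d → ℤ)) (u : (Fin d → ℤ) → ℝ) : ℝ :=
  ∑ x ∈ B, (u x ^ 2 + ∑ j, ((u (x + latE d j) - u x)^2/h^2 + (u (x - latE d j) - u x)^2/h^2))

lemma comm_bound {d : ℕ} {h c : ℝ} (hh : 0 < h) {χ u : (Fin d → ℤ) → ℝ} 
    (hχ1 : ∀ x j, |χ (x + latE d j) - χ x| ≤ c * h)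
    (hχ2 : ∀ x j, |χ (x + latE d j) + χ (x - latE d j) - 2 * χ x| ≤ c * h^2) (x : Fin d → ℤ) :
    (lcomm d h χ u x)^2 ≤ 3 * d * (d+1) * c^2 *
      (u x ^ 2 + ∑ j, ((u (x + latE d j) - u x)^2/h^2 + (u (x - latE d j) - u x)^2/h^2)) := by
  have hχ1' : ∀ j, |χ (x - latE d j) - χ x| ≤ c * h := by
    intro j
    have := hχ1 (x - latE d j) j
    rw [sub_add_cancel, abs_sub_comm] at this; exact this
  have h1 : ∀ j, (((χ (x + latE d j) + χ (x - latE d j) - 2 * χ x) * u x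
    + (χ (x + latE d j) - χ x) * (u (x + latE d j) - u x)
    + (χ (x - latE d j) - χ x) * (u (x - latE d j) - u x)) / h^2)^2 ≤ 
     3 * c^2 * (u x ^ 2 + ((u (x + latE d j) - u x)^2/h^2 + (u (x - latE d j) - u x)^2/h^2)) := by
    intro j
    have a1 : ((χ (x + latE d j) + χ (x - latE d j) - 2 * χ x)/h^2)^2 ≤ c^2 := by
      rw [div_pow, div_le_iff₀ (by positivity), ← mul_pow, ← sq_abs]
      exact pow_le_pow_left₀ (abs_nonneg _) (hχ2 x j) 2
    have a2 : ((χ (x + latE d j) - χ x)/h)^2 ≤ c^2 := by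
      rw [div_pow, div_le_iff₀ (by positivity), ← mul_pow, ← sq_abs]
      exact pow_le_pow_left₀ (abs_nonneg _) (hχ1 x j) 2
    have a3 : ((χ (x - latE d j) - χ x)/h)^2 ≤ c^2 := by
      rw [div_pow, div_le_iff₀ (by positivity), ← mul_pow, ← sq_abs]
      exact pow_le_pow_left₀ (abs_nonneg _) (hχ1' j) 2
    set A := (χ (x + latE d j) + χ (x - latE d j) - 2 * χ x)/h^2
    set A1 := (χ (x + latE d j) - χ x)/h
    set A2 := (χ (x - latE d j) - χ x)/h
    have e : ((χ (x + latE d j) + χ (x - latE d j) - 2 * χ x) * u x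
    + (χ (x + latE d j) - χ x) * (u (x + latE d j) - u x)
    + (χ (x - latE d j) - χ x) * (u (x - latE d j) - u x)) / h^2 = A * u x + A1 * ((u (x + latE d j) - u x)/h) + A2 * ((u (x - latE d j) - u x)/h) := by
      simp only [A, A1, A2]; field_simp
    rw [e, ← div_pow, ← div_pow]
    generalize (u (x + latE d j) - u x)/h = U1
    generalize (u (x - latE d j) - u x)/h = U2
    have t3 := sq3p
    refine (t3 _ _ _).trans ?_
    have b1 := mul_le_mul_of_nonneg_right a1 (sq_nonneg (u x))
    have b2 := mul_le_mul_of_nonneg_right a2 (sq_nonneg U1)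
    have b3 := mul_le_mul_of_nonneg_right a3 (sq_nonneg U2)
    simp only [mul_pow]
    linarith
  unfold lcomm
  have h2 := sq_sum_le_card_mul_sum_sq (s := (Finset.univ : Finset (Fin d))) (f := fun j => ((χ (x + latE d j) + χ (x - latE d j) - 2 * χ x) * u x
    + (χ (x + latE d j) - χ x) * (u (x + latE d j) - u x)
    + (χ (x - latE d j) - χ x) * (u (x - latE d j) - u x)) / h^2)
  refine h2.trans ?_
  rw [Finset.card_univ, Fintype.card_fin]
  have h3 := Finset.sum_le_sum (fun j (_ : j ∈ (Finset.univ : Finset (Fin d))) => h1 j)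
  rw [← Finset.mul_sum, Finset.sum_add_distrib, Finset.sum_const, Finset.card_univ, Fintype.card_fin, nsmul_eq_mul] at h3
  refine (mul_le_mul_of_nonneg_left h3 (Nat.cast_nonneg d)).trans ?_
  set SJ := ∑ j, ((u (x + latE d j) - u x)^2/h^2 + (u (x - latE d j) - u x)^2/h^2)
  have hSJ : 0 ≤ SJ := Finset.sum_nonneg fun j _ => by positivity
  have : (3 * d * (d+1) * c^2 * (u x ^ 2 + SJ) : ℝ) - d * (3*c^2*(d * u x ^ 2 + SJ)) = 3*d*c^2*(u x ^2 + d * SJ) := by ring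
  have h5 : 0 ≤ 3*d*c^2*(u x ^2 + d * SJ) := by positivity
  linarith

lemma hE_aux {d : ℕ} {ℓ η α v0 W c m F2 E2 : ℝ} (hℓ : 0 < ℓ) (hη : η ≤ 5/2*ℓ) (hη0 : 0 ≤ η)
    (hα : 256 ≤ α) (hαv : 64 * ℓ^2 * v0^2 ≤ α) (hW0 : 0 ≤ W) (hm : 0 ≤ m) (hF : 0 ≤ F2) (hE0 : 0 ≤ E2)
    (h1 : E2 ≤ 3 * ((W * m + 4 * F2)/ℓ^2 + v0^2 * F2 + W * (3 * d * (d+1) * c^2 * m))) :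
    (1/2) * η * E2 ≤ (4/ℓ + 12*ℓ*d*(d+1)*c^2) * W * m + α/(8*ℓ) * F2 := by
  obtain ⟨Q, hQ⟩ : ∃ Q, Q = (W * m + 4 * F2)/ℓ^2 + v0^2 * F2 + W * (3 * d * (d+1) * c^2 * m) := ⟨_, rfl⟩
  rw [← hQ] at h1
  have hQ0 : 0 ≤ Q := by linarith
  have h2 : (1/2) * η * E2 ≤ (1/2) * (5/2*ℓ) * (3 * Q) := by gcongr
  have h3 : (1/2) * (5/2*ℓ) * (3 * Q) ≤ 4 * ℓ * Q := by linarith [mul_nonneg hℓ.le hQ0]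
  have h4 : 4 * ℓ * Q = (4/ℓ + 12*ℓ*d*(d+1)*c^2) * W * m + (16/ℓ + 4*ℓ*v0^2) * F2 := by
    rw [hQ]; field_simp; ring
  have h5 : (16/ℓ + 4*ℓ*v0^2) ≤ α/(8*ℓ) := by
    rw [le_div_iff₀ (by positivity)]
    have : (16/ℓ + 4*ℓ*v0^2) * (8*ℓ) = 128 + 32*ℓ^2*v0^2 := by field_simp; ring
    linarith
  have h6 := mul_le_mul_of_nonneg_right h5 hF
  linarith

set_option maxHeartbeats 1000000 in
theorem dyn_step {d : ℕ} {h ℓ b α c v0 W R : ℝ} (z : Fin d → ℝ) {χ Vx : (Fin d → ℤ) → ℝ}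
    {u : ℝ → (Fin d → ℤ) → ℝ} {B : Finset (Fin d → ℤ)} (hh : 0 < h) (hℓ : 0 < ℓ) (hb : 0 < b) (hbℓ : b ≤ ℓ)
    (hα : 256 ≤ α) (hαv : 64 * ℓ^2 * v0^2 ≤ α) (hV : ∀ x, |Vx x| ≤ v0)
    (hp : (h^2/(4*b))^2 ≤ (b/(8*ℓ))/40)
    (hsm : ∀ j x, χ x ≠ 0 ∨ χ (x + latE d j) ≠ 0 → (qv d h b z j x)^2 ≤ (b/(8*ℓ))/40)
    (hχ0 : ∀ x, 0 ≤ χ x ∧ χ x ≤ 1)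
    (hχ1 : ∀ x j, |χ (x + latE d j) - χ x| ≤ c * h)
    (hχ2 : ∀ x j, |χ (x + latE d j) + χ (x - latE d j) - 2 * χ x| ≤ c * h^2)
    (hχR : ∀ x j, χ (x + latE d j) ≠ χ x ∨ χ (x - latE d j) ≠ χ x → R ≤ Y2 d h z x)
    (hB : NearB d χ B)
    (hu : ∀ t x, HasDerivAt (fun t => u t x) (lapR d h (u t) x - Vx x * u t x) t)
    (hW1 : ∀ t x, 0 ≤ t → t ≤ ℓ/2 → Real.exp (Phi d h ℓ b α z t x)^2 ≤ W)
    (hW2 : ∀ t x, 0 ≤ t → t ≤ ℓ → R ≤ Y2 d h z x → Real.exp (Phi d h ℓ b α z t x)^2 ≤ W)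
    (t : ℝ) (ht0 : 0 ≤ t) (htℓ : t ≤ ℓ) :
    ∃ D', HasDerivAt (fun t => ((ℓ+b-t) + (ℓ+b-t)^2/(8*ℓ)) *
        ∑ x ∈ B, Stot d h (ℓ+b-t) ℓ α z (Fv d h ℓ b α z χ u t) x * Fv d h ℓ b α z χ u t x) D' t ∧
      -((4/ℓ + 12*ℓ*d*(d+1)*c^2) * W * mEn d h B (u t)) ≤ D' := by
  have hσ : 0 < ℓ + b - t := by linarith
  have hσb : b ≤ ℓ + b - t := by linarith
  set σ := ℓ + b - t with hσdef
  set F := Fv d h ℓ b α z χ u t with hF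
  set E := Ev d h ℓ b α z χ Vx u t with hE
  have hFd := fun x => F_deriv (α := α) (χ := χ) z hℓ hu t hσ x
  set F' := fun x => Stot d h σ ℓ α z F x + Atot d h σ z F x + E x with hF'
  have hFB : NearB d F B := by
    intro x v hx hv
    refine hB x v (fun h0 => hx ?_) hv
    simp [hF, Fv, h0]
  have hF'B : NearB d F' B := by
    intro x v hx hv
    refine hB x v (fun h0 => hx ?_) hv
    have h1 : HasDerivAt (fun t => Fv d h ℓ b α z χ u t x) 0 t := by
      have : (fun t => Fv d h ℓ b α z χ u t x) = fun _ => (0:ℝ) := by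
        funext s; simp [Fv, h0]
      rw [this]; exact hasDerivAt_const t 0
    exact (hFd x).unique h1
  have hSd := fun x => S_deriv (α := α) (h := h) z t hσ hFd x
  have hηd : HasDerivAt (fun t => (ℓ+b-t) + (ℓ+b-t)^2/(8*ℓ)) (-(1 + σ/(4*ℓ))) t := by
    have hs := sig_deriv ℓ b t
    refine ((hs.add ((hs.pow 2).div_const (8*ℓ))).congr_deriv ?_).congr_of_eventuallyEq (Filter.Eventually.of_forall fun s => ?_)
    · simp [hσdef]; field_simp; ring
    · simp
  have hDd := HasDerivAt.fun_sum (u := B) (fun x _ => (hSd x).mul (hFd x))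
  refine ⟨_, hηd.mul hDd, ?_⟩
  have hst := static_lemma (h := h) (α := α) (E := E) z hFB hh hσ hℓ (by linarith) (by
      rw [div_le_iff₀ (by positivity)]; linarith) (by
      refine le_trans ?_ (hp.trans ?_)
      · gcongr
      · gcongr) (by
      intro j x hx
      have h1 := hsm j x (by
        rcases hx with hx | hx
        · left; intro h0; apply hx; simp [hF, Fv, h0]
        · right; intro h0; apply hx; simp [hF, Fv, h0])
      refine le_trans ?_ (h1.trans ?_)
      · unfold qv
        rw [div_pow, div_pow]
        gcongr
      · gcongr)
  have hsy := Stot_symm (h := h) (σ := σ) (ℓ := ℓ) (α := α) (z := z) hFB hF'B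
  have e1 : ∑ x ∈ B, ((Rtot d h σ α z F x + Stot d h σ ℓ α z F' x) * F x + Stot d h σ ℓ α z F x * F' x)
     = ∑ x ∈ B, Rtot d h σ α z F x * F x + 2 * ∑ x ∈ B, Stot d h σ ℓ α z F x * F' x := by
    rw [Finset.sum_add_distrib]
    simp_rw [add_mul]
    rw [Finset.sum_add_distrib, hsy]; ring
  have e2 : -(1 + σ/(4*ℓ)) * ∑ x ∈ B, Stot d h σ ℓ α z F x * F x
     + (σ + σ^2/(8*ℓ)) * (∑ x ∈ B, Rtot d h σ α z F x * F x
        + 2 * ∑ x ∈ B, Stot d h σ ℓ α z F x * F' x) = 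
     -(1 + σ/(4*ℓ)) * ∑ x ∈ B, Stot d h σ ℓ α z F x * F x + (σ + σ^2/(8*ℓ)) * ∑ x ∈ B, ((Rtot d h σ α z F x + Stot d h σ ℓ α z F' x) * F x + Stot d h σ ℓ α z F x * F' x) := by
     rw [e1]
  refine le_trans ?_ (hst.trans (e2.le.trans ?_))
  swap
  · exact le_refl _
  have hη : (σ + σ^2/(8*ℓ)) ≤ 5/2*ℓ := by
    have h1 : σ^2/(8*ℓ) ≤ (2*ℓ)^2/(8*ℓ) := by gcongr; linarith
    have h2 : (2*ℓ)^2/(8*ℓ) = ℓ/2 := by field_simp; norm_num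
    linarith
  have hη0 : 0 < σ + σ^2/(8*ℓ) := by positivity
  have hW0 : 0 ≤ W := by
    have := hW1 0 0 le_rfl (by positivity)
    exact (sq_nonneg _).trans this
  set ml := fun x => (u t x ^ 2 + ∑ j, ((u t (x + latE d j) - u t x)^2/h^2 + (u t (x - latE d j) - u t x)^2/h^2)) with hml
  have hml0 : ∀ x, u t x ^ 2 ≤ ml x := by
    intro x
    have : 0 ≤ ∑ j, ((u t (x + latE d j) - u t x)^2/h^2 + (u t (x - latE d j) - u t x)^2/h^2) :=
      Finset.sum_nonneg fun j _ => by positivity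
    simp only [hml]; linarith
  have hE1 : ∀ x, (1 / ℓ * χ x * Real.exp (Phi d h ℓ b α z t x) * u t x)^2 ≤ (W * ml x + 4 * F x ^ 2)/ℓ^2 := by
    intro x
    have hml1 : 0 ≤ ml x := (sq_nonneg _).trans (hml0 x)
    rw [le_div_iff₀ (by positivity)]
    have hχs : χ x ^ 2 ≤ 1 := pow_le_one₀ (hχ0 x).1 (hχ0 x).2
    rcases le_total t (ℓ/2) with h1 | h1
    · have h2 := hW1 t x ht0 h1
      have : (1 / ℓ * χ x * Real.exp (Phi d h ℓ b α z t x) * u t x)^2 * ℓ^2 = χ x ^ 2 * (Real.exp (Phi d h ℓ b α z t x) ^ 2 * u t x ^ 2) := by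
        field_simp
      rw [this]
      calc _ ≤ 1 * (W * ml x) := by
            gcongr; exact hml0 x
        _ ≤ _ := by linarith [sq_nonneg (F x)]
    · have : (1 / ℓ * χ x * Real.exp (Phi d h ℓ b α z t x) * u t x)^2 * ℓ^2 = (ℓ/t)^2 * F x ^ 2 := by
        have : t ≠ 0 := by linarith
        simp only [hF, Fv]; field_simp
      rw [this]
      have h3 : (ℓ/t)^2 ≤ 4 := by
        have k1 : ℓ/t ≤ 2 := by rw [div_le_iff₀ (by linarith)]; linarith
        have k2 : 0 ≤ ℓ/t := by positivity
        exact (pow_le_pow_left₀ k2 k1 2).trans (by norm_num)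
      have := mul_le_mul_of_nonneg_right h3 (sq_nonneg (F x))
      have := mul_nonneg hW0 hml1
      linarith
  have hE2 : ∀ x, (Vx x * F x)^2 ≤ v0^2 * F x ^ 2 := by
    intro x
    rw [mul_pow]
    exact mul_le_mul_of_nonneg_right (sq_le_sq' (by linarith [abs_le.1 (hV x)]) (abs_le.1 (hV x)).2) (sq_nonneg _)
  have hE3 : ∀ x, (t / ℓ * Real.exp (Phi d h ℓ b α z t x) * lcomm d h χ (u t) x)^2 ≤ W * (3 * d * (d+1) * c^2 * ml x) := by
    intro x
    have hml1 : 0 ≤ ml x := (sq_nonneg _).trans (hml0 x)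
    by_cases hc : lcomm d h χ (u t) x = 0
    · rw [hc]; simp; positivity
    have hR : R ≤ Y2 d h z x := by
      by_contra hcon
      apply hc
      have h1 : ∀ j, χ (x + latE d j) = χ x ∧ χ (x - latE d j) = χ x := by
        intro j
        have := mt (hχR x j) hcon
        push Not at this; exact this
      unfold lcomm
      refine Finset.sum_eq_zero fun j _ => ?_
      rw [(h1 j).1, (h1 j).2]; ring
    have h2 := hW2 t x ht0 htℓ hR
    have h3 := comm_bound hh hχ1 hχ2 x (u := u t)
    rw [mul_pow, mul_pow]
    have h4 : (t/ℓ)^2 ≤ 1 := pow_le_one₀ (by positivity) (by rw [div_le_one hℓ]; exact htℓ)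
    have h5 : (t/ℓ)^2 * Real.exp (Phi d h ℓ b α z t x)^2 ≤ 1 * W := by gcongr
    calc _ ≤ (1 * W) * (3 * d * (d+1) * c^2 * ml x) := by gcongr
      _ = _ := by ring
  have hE : ∀ x, (1/2) * (σ + σ^2/(8*ℓ)) * E x ^ 2 ≤ (4/ℓ + 12*ℓ*d*(d+1)*c^2) * W * ml x + α/(8*ℓ) * F x ^ 2 := by
    intro x
    have hml1 : 0 ≤ ml x := (sq_nonneg _).trans (hml0 x)
    have t3 := sq3m
    have h1 : E x ^ 2 ≤ 3 * ((W * ml x + 4 * F x ^ 2)/ℓ^2 + v0^2 * F x ^ 2 + W * (3 * d * (d+1) * c^2 * ml x)) := by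
      refine (t3 _ _ _).trans ?_
      have := hE1 x; have := hE2 x; have := hE3 x
      linarith
    exact hE_aux hℓ hη hη0.le hα hαv hW0 hml1 (sq_nonneg _) (sq_nonneg _) h1
  have hsum := Finset.sum_le_sum (fun x (_ : x ∈ B) => hE x)
  rw [Finset.sum_add_distrib, ← Finset.mul_sum, ← Finset.mul_sum, ← Finset.mul_sum] at hsum
  have : mEn d h B (u t) = ∑ x ∈ B, ml x := rfl
  rw [this]
  linarith

end

section

lemma final_D {d : ℕ} {h b ℓ α : ℝ} (z : Fin d → ℝ) {F : (Fin d → ℤ) → ℝ} {B : Finset (Fin d → ℤ)}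
    (hB : NearB d F B) (hh : 0 < h) (hb : 0 < b) (hℓ : 0 < ℓ) (hbℓ : b ≤ ℓ) (hα : 0 ≤ α)
    (hsm : ∀ j x, F x ≠ 0 ∨ F (x + latE d j) ≠ 0 → (qv d h b z j x)^2 ≤ (b/(8*ℓ))/40)
    (hd : (d:ℝ) * h^2 ≤ 32 * α * b) :
    ∑ x ∈ B, Stot d h b ℓ α z F x * F x ≤ ∑ x ∈ B, (- Y2 d h z x/(32*b^2) + 2*α/b) * F x^2 := by
  have hbl : (b/(8*ℓ)) ≤ 1/8 := by
    rw [div_le_div_iff₀ (by positivity) (by norm_num)]; linarith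
  have e : ∑ x ∈ B, Stot d h b ℓ α z F x * F x =
    (∑ j, ∑ x ∈ B, sOp d (qv d h b z) F j x * F x) / h^2 + ∑ x ∈ B, Ftv d h b ℓ α z x * (F x * F x) := by
    rw [Finset.sum_comm, Finset.sum_div, ← Finset.sum_add_distrib]
    refine Finset.sum_congr rfl fun x _ => ?_
    unfold Stot
    rw [← Finset.sum_mul]; ring
  have hj : ∀ j, ∑ x ∈ B, sOp d (qv d h b z) F j x * F x ≤
     ∑ x ∈ B, h^2 * ((3/32) * (h * x j - z j)^2/b^2 + h^2/(32*b^2)) * F x^2 := by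
    intro j
    rw [sum_s hB j, sum_w hB j (fun x => Real.cosh (qv d h b z j x))]
    have h1 : 0 ≤ ∑ x ∈ B, (1/2) * Real.cosh (qv d h b z j x) * (F (x + latE d j) - F x)^2 :=
      Finset.sum_nonneg fun x _ => by have := Real.cosh_pos (qv d h b z j x); positivity
    have h2 : 2 * ∑ x ∈ B, (1/2) * (Real.cosh (qv d h b z j x) + Real.cosh (qv d h b z j (x - latE d j))) * F x^2
       - 2 * ∑ x ∈ B, F x^2 ≤ ∑ x ∈ B, h^2 * ((3/32) * (h * x j - z j)^2/b^2 + h^2/(32*b^2)) * F x^2 := by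
      simp only [Finset.mul_sum, ← Finset.sum_sub_distrib]
      refine Finset.sum_le_sum fun x _ => ?_
      by_cases hF : F x = 0
      · rw [hF]; simp
      have a1 := hsm j x (Or.inl hF)
      have a2 := hsm j (x - latE d j) (Or.inr (by simpa using hF))
      have b1 : ∀ q : ℝ, q^2 ≤ (b/(8*ℓ))/40 → Real.cosh q ≤ 1 + 3/4*q^2 := by
        intro q hq
        have hq1 : |q| ≤ 1 := by
          rw [← sq_le_one_iff_abs_le_one]; linarith
        have := cosh_le4 q hq1
        have h5 : q^4 = q^2*q^2 := by ring
        nlinarith [sq_nonneg q]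
      have c1 := b1 _ a1
      have c2 := b1 _ a2
      have e1 : (qv d h b z j x)^2 + (qv d h b z j (x - latE d j))^2 = h^2*(2*(h * x j - z j)^2 + h^2/2)/(16*b^2) := by
        have := qv_shift d h b z j (x - latE d j)
        rw [sub_add_cancel] at this
        have e2 : qv d h b z j (x - latE d j) = qv d h b z j x - h^2/(4*b) := by linarith
        rw [e2]; unfold qv; field_simp; ring
      have e3 : h^2 * ((3/32) * (h * x j - z j)^2/b^2 + h^2/(32*b^2)) = 3/4*(h^2*(2*(h * x j - z j)^2 + h^2/2)/(16*b^2)) + h^2 * (h^2/b^2)*(1/128) := by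
        field_simp; ring
      have : 0 ≤ h^2 * (h^2/b^2)*(1/128) := by positivity
      have c3 : Real.cosh (qv d h b z j x) + Real.cosh (qv d h b z j (x - latE d j)) - 2 ≤ h^2 * ((3/32) * (h * x j - z j)^2/b^2 + h^2/(32*b^2)) := by
        rw [e3, ← e1]; linarith
      have := mul_le_mul_of_nonneg_right c3 (sq_nonneg (F x))
      linarith
    linarith
  rw [e]
  have h3 : (∑ j, ∑ x ∈ B, sOp d (qv d h b z) F j x * F x) / h^2 ≤ ∑ x ∈ B, ((3/32) * Y2 d h z x/b^2 + d * h^2/(32*b^2)) * F x^2 := by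
    rw [div_le_iff₀ (by positivity)]
    refine (Finset.sum_le_sum fun j _ => hj j).trans (le_of_eq ?_)
    rw [Finset.sum_comm, Finset.sum_mul]
    refine Finset.sum_congr rfl fun x _ => ?_
    rw [← Finset.sum_mul, ← Finset.mul_sum, Finset.sum_add_distrib, ← Finset.sum_div, ← Finset.mul_sum]
    simp only [Finset.sum_const, Finset.card_univ, Fintype.card_fin, nsmul_eq_mul, Y2]
    ring
  refine (add_le_add_left h3 _).trans ?_
  rw [← Finset.sum_add_distrib]
  refine Finset.sum_le_sum fun x _ => ?_
  have h4 : d * h^2/(32*b^2) ≤ α/b := by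
    rw [div_le_div_iff₀ (by positivity) hb]
    nlinarith
  have h5 : 0 ≤ α * (1/(4*ℓ)) := by positivity
  have h6 : ((3/32) * Y2 d h z x/b^2 + d * h^2/(32*b^2)) + Ftv d h b ℓ α z x ≤ - Y2 d h z x/(32*b^2) + 2*α/b := by
    unfold Ftv
    have : (3/32) * Y2 d h z x/b^2 + - Y2 d h z x / (8 * b^2) = - Y2 d h z x/(32*b^2) := by field_simp; ring
    have : α * (1/b - 1/(4*ℓ)) = α/b - α * (1/(4*ℓ)) := by ring
    have : 2*α/b = α/b+α/b := by ring
    linarith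
  have := mul_le_mul_of_nonneg_right h6 (sq_nonneg (F x))
  linarith

lemma mEn_cont {d : ℕ} {h : ℝ} {B : Finset (Fin d → ℤ)} {u : ℝ → (Fin d → ℤ) → ℝ}
    (hu : ∀ x, Continuous (fun t => u t x)) : Continuous (fun t => mEn d h B (u t)) := by
  unfold mEn
  refine continuous_finsetSum _ fun x _ => ?_
  refine ((hu x).pow 2).add (continuous_finsetSum _ fun j _ => ?_)
  exact ((((hu _).sub (hu _)).pow 2).div_const _).add ((((hu _).sub (hu _)).pow 2).div_const _)

theorem carl_int {d : ℕ} {h ℓ b α c v0 W R : ℝ} (z : Fin d → ℝ) {χ Vx : (Fin d → ℤ) → ℝ}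
    {u : ℝ → (Fin d → ℤ) → ℝ} {B : Finset (Fin d → ℤ)} (hh : 0 < h) (hℓ : 0 < ℓ) (hb : 0 < b) (hbℓ : b ≤ ℓ)
    (hα : 256 ≤ α) (hαv : 64 * ℓ^2 * v0^2 ≤ α) (hV : ∀ x, |Vx x| ≤ v0)
    (hp : (h^2/(4*b))^2 ≤ (b/(8*ℓ))/40)
    (hsm : ∀ j x, χ x ≠ 0 ∨ χ (x + latE d j) ≠ 0 → (qv d h b z j x)^2 ≤ (b/(8*ℓ))/40)
    (hχ0 : ∀ x, 0 ≤ χ x ∧ χ x ≤ 1)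
    (hχ1 : ∀ x j, |χ (x + latE d j) - χ x| ≤ c * h)
    (hχ2 : ∀ x j, |χ (x + latE d j) + χ (x - latE d j) - 2 * χ x| ≤ c * h^2)
    (hχR : ∀ x j, χ (x + latE d j) ≠ χ x ∨ χ (x - latE d j) ≠ χ x → R ≤ Y2 d h z x)
    (hB : NearB d χ B)
    (hu : ∀ t x, HasDerivAt (fun t => u t x) (lapR d h (u t) x - Vx x * u t x) t)
    (hW1 : ∀ t x, 0 ≤ t → t ≤ ℓ/2 → Real.exp (Phi d h ℓ b α z t x)^2 ≤ W)
    (hW2 : ∀ t x, 0 ≤ t → t ≤ ℓ → R ≤ Y2 d h z x → Real.exp (Phi d h ℓ b α z t x)^2 ≤ W) :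
    -((4/ℓ + 12*ℓ*d*(d+1)*c^2) * W * ∫ t in (0:ℝ)..ℓ, mEn d h B (u t)) ≤
      (b + b^2/(8*ℓ)) * ∑ x ∈ B, Stot d h b ℓ α z (Fv d h ℓ b α z χ u ℓ) x * Fv d h ℓ b α z χ u ℓ x := by
  have hc : Continuous (fun t => mEn d h B (u t)) :=
    mEn_cont fun x => continuous_iff_continuousAt.2 fun t => (hu t x).continuousAt
  set D := fun t => ((ℓ+b-t) + (ℓ+b-t)^2/(8*ℓ)) *
        ∑ x ∈ B, Stot d h (ℓ+b-t) ℓ α z (Fv d h ℓ b α z χ u t) x * Fv d h ℓ b α z χ u t x with hD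
  set K := (4/ℓ + 12*ℓ*d*(d+1)*c^2) * W with hK
  have hstep := dyn_step z hh hℓ hb hbℓ hα hαv hV hp hsm hχ0 hχ1 hχ2 hχR hB hu hW1 hW2
  choose! D' h1 h2 using hstep
  have hI : ∀ t, HasDerivAt (fun t => ∫ s in (0:ℝ)..t, mEn d h B (u s)) (mEn d h B (u t)) t := fun t =>
    intervalIntegral.integral_hasDerivAt_right (hc.intervalIntegrable _ _)
      (hc.stronglyMeasurableAtFilter _ _) hc.continuousAt
  have hG : ∀ t, 0 ≤ t → t ≤ ℓ → HasDerivAt (fun t => D t + K * ∫ s in (0:ℝ)..t, mEn d h B (u s)) (D' t + K * mEn d h B (u t)) t :=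
    fun t a b => (h1 t a b).add ((hI t).const_mul K)
  have hm : MonotoneOn (fun t => D t + K * ∫ s in (0:ℝ)..t, mEn d h B (u s)) (Set.Icc 0 ℓ) := by
    refine monotoneOn_of_deriv_nonneg (convex_Icc 0 ℓ) ?_ ?_ ?_
    · exact fun t ht => (hG t ht.1 ht.2).continuousAt.continuousWithinAt
    · rw [interior_Icc]
      exact fun t ht => (hG t ht.1.le ht.2.le).differentiableAt.differentiableWithinAt
    · rw [interior_Icc]
      intro t ht
      rw [(hG t ht.1.le ht.2.le).deriv]
      linarith [h2 t ht.1.le ht.2.le]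
  have h3 := hm (Set.left_mem_Icc.2 hℓ.le) (Set.right_mem_Icc.2 hℓ.le) hℓ.le
  have hD0 : D 0 = 0 := by
    simp [hD, Fv]
  have hDℓ : D ℓ = (b + b^2/(8*ℓ)) * ∑ x ∈ B, Stot d h b ℓ α z (Fv d h ℓ b α z χ u ℓ) x * Fv d h ℓ b α z χ u ℓ x := by
    simp only [hD, add_sub_cancel_left]
  simp only [hD0, intervalIntegral.integral_same] at h3
  rw [← hDℓ]; linarith

end

section

lemma mEn_nonneg {d : ℕ} {h : ℝ} {B : Finset (Fin d → ℤ)} {u : (Fin d → ℤ) → ℝ} : 0 ≤ mEn d h B u :=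
  Finset.sum_nonneg fun x _ => add_nonneg (sq_nonneg _) (Finset.sum_nonneg fun j _ => by positivity)

lemma Y2_nonneg {d : ℕ} {h : ℝ} {z : Fin d → ℝ} {x : Fin d → ℤ} : 0 ≤ Y2 d h z x :=
  Finset.sum_nonneg fun _ _ => sq_nonneg _

set_option maxHeartbeats 2000000 in
theorem local_carl {d : ℕ} {h ℓ b κ r P0 G c v0 R : ℝ} (z : Fin d → ℝ) {χ Vx : (Fin d → ℤ) → ℝ}
    {u : ℝ → (Fin d → ℤ) → ℝ} {B : Finset (Fin d → ℤ)} (hh : 0 < h) (hℓ : 0 < ℓ) (hκ : 0 < κ) (hκ1 : κ ≤ 1)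
    (hb : b = κ * ℓ) (hr : 0 < r)
    (hα : 256 ≤ r^2/(128*b)) (hαv : 64 * ℓ^2 * v0^2 ≤ r^2/(128*b)) (hV : ∀ x, |Vx x| ≤ v0)
    (hp : (h^2/(4*b))^2 ≤ (b/(8*ℓ))/40)
    (hsm : ∀ j x, χ x ≠ 0 ∨ χ (x + latE d j) ≠ 0 → (qv d h b z j x)^2 ≤ (b/(8*ℓ))/40)
    (hχ0 : ∀ x, 0 ≤ χ x ∧ χ x ≤ 1)
    (hχ1 : ∀ x j, |χ (x + latE d j) - χ x| ≤ c * h)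
    (hχ2 : ∀ x j, |χ (x + latE d j) + χ (x - latE d j) - 2 * χ x| ≤ c * h^2)
    (hχR : ∀ x j, χ (x + latE d j) ≠ χ x ∨ χ (x - latE d j) ≠ χ x → R ≤ Y2 d h z x)
    (hB : NearB d χ B)
    (hu : ∀ t x, HasDerivAt (fun t => u t x) (lapR d h (u t) x - Vx x * u t x) t)
    (hd : (d:ℝ) * h^2 ≤ r^2/4)
    (hlog : 1/2 + 64*(P0/4+G)/r^2 ≤ Real.log (1/(2*κ)))
    (hR : r^2/128 + P0/4 + G ≤ R * κ/8) {A : Finset (Fin d → ℤ)}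
    (hA : ∀ x ∈ A, x ∈ B ∧ χ x = 1 ∧ Y2 d h z x ≤ P0) :
    ∑ x ∈ A, u ℓ x^2 ≤ Real.exp (P0/(4*b)) * (2 * ∑ x ∈ B with Y2 d h z x < r^2, u ℓ x^2)
      + (64*b/r^2) * (4/ℓ + 12*ℓ*d*(d+1)*c^2) * Real.exp (-G/b) * ∫ t in (0:ℝ)..ℓ, mEn d h B (u t) := by
  have hb0 : 0 < b := by rw [hb]; positivity
  have hbℓ : b ≤ ℓ := by rw [hb]; nlinarith
  set α := r^2/(128*b) with hαd
  have hα0 : 0 < α := by positivity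
  obtain ⟨e0, he0⟩ : ∃ e0, e0 = -2*α*(Real.log b - b/(4*ℓ)) := ⟨_, rfl⟩
  obtain ⟨w, hw⟩ : ∃ w, w = -(P0/4+G)/b := ⟨_, rfl⟩
  have he0' : -2*α*Real.log b ≤ e0 := by
    have : 0 ≤ 2*α*(b/(4*ℓ)) := by positivity
    rw [he0]; linarith
  have hlogb : ∀ σ, b ≤ σ → Real.log b ≤ Real.log σ := fun σ hσ => Real.log_le_log hb0 hσ
  have hW1 : ∀ t x, 0 ≤ t → t ≤ ℓ/2 → Real.exp (Phi d h ℓ b α z t x)^2 ≤ Real.exp (e0 + w) := by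
    intro t x ht0 ht
    rw [← Real.exp_nat_mul]
    apply Real.exp_le_exp.2
    refine le_trans ?_ (add_le_add_left he0' _)
    have hσ : ℓ/2 ≤ ℓ + b - t := by linarith
    have hσ0 : 0 < ℓ + b - t := by linarith
    have l1 : Real.log (ℓ/2) ≤ Real.log (ℓ+b-t) := Real.log_le_log (by positivity) hσ
    have l2 : Real.log (1/(2*κ)) = Real.log (ℓ/2) - Real.log b := by
      rw [← Real.log_div (by positivity) hb0.ne', hb]
      congr 1; field_simp
    have l3 : (ℓ+b-t)/(4*ℓ) ≤ 1/2 := by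
      rw [div_le_div_iff₀ (by positivity) (by norm_num)]; linarith
    have l4 : 0 ≤ Y2 d h z x/(8*(ℓ+b-t)) := div_nonneg Y2_nonneg (by positivity)
    have l5 : α * (1/2 + 64*(P0/4+G)/r^2) ≤ α * (Real.log (ℓ/2) - Real.log b) := by
      rw [← l2]; gcongr
    have l6 : α * (64*(P0/4+G)/r^2) = - w/2 := by
      rw [hw, hαd]; field_simp; ring
    have l7 : α * (Real.log (ℓ/2) - 1/2) ≤ α*(Real.log (ℓ+b-t) - (ℓ+b-t)/(4*ℓ)) := by gcongr
    unfold Phi; push_cast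
    rw [mul_add, l6] at l5
    rw [neg_div]
    linarith
  have hW2 : ∀ t x, 0 ≤ t → t ≤ ℓ → R ≤ Y2 d h z x → Real.exp (Phi d h ℓ b α z t x)^2 ≤ Real.exp (e0 + w) := by
    intro t x ht0 ht hRY
    rw [← Real.exp_nat_mul]
    apply Real.exp_le_exp.2
    refine le_trans ?_ (add_le_add_left he0' _)
    have hσ : b ≤ ℓ + b - t := by linarith
    have hσ0 : 0 < ℓ + b - t := by linarith
    have l1 := hlogb _ hσ
    have l3 : (ℓ+b-t)/(4*ℓ) ≤ 1/2 := by
      rw [div_le_div_iff₀ (by positivity) (by norm_num)]; linarith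
    have l4 : Y2 d h z x/(8*(2*ℓ)) ≤ Y2 d h z x/(8*(ℓ+b-t)) := by
      apply div_le_div_of_nonneg_left Y2_nonneg (by positivity); linarith
    have l5 : R/(8*(2*ℓ)) ≤ Y2 d h z x/(8*(2*ℓ)) := by gcongr
    have l7 : α * (Real.log b - 1/2) ≤ α*(Real.log (ℓ+b-t) - (ℓ+b-t)/(4*ℓ)) := by gcongr
    have l8 : (r^2/128 + P0/4 + G)/b ≤ (R * κ/8)/b := by gcongr
    have l9 : (R * κ/8)/b = 2*(R/(8*(2*ℓ))) := by rw [hb]; field_simp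
    have l10 : (r^2/128 + P0/4 + G)/b = α - w := by rw [hw, hαd]; field_simp; ring
    unfold Phi; push_cast
    rw [neg_div]
    linarith
  have hmain := carl_int z hh hℓ hb0 hbℓ hα hαv hV hp hsm hχ0 hχ1 hχ2 hχR hB hu hW1 hW2
  set F := Fv d h ℓ b α z χ u ℓ with hF
  have hF0 : ∀ x, χ x = 0 → F x = 0 := fun x hx => by simp [hF, Fv, hx]
  have hFB : NearB d F B := fun x v hx hv => hB x v (fun h0 => hx (hF0 x h0)) hv
  have hD := final_D (α := α) z hFB hh hb0 hℓ hbℓ hα0.le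
    (fun j x hx => hsm j x (hx.imp (fun a b => a (hF0 _ b)) (fun a b => a (hF0 _ b))))
    (by refine hd.trans (le_of_eq ?_); rw [hαd]; field_simp; norm_num)
  have hFsq : ∀ x, F x^2 = Real.exp e0 * (χ x^2 * Real.exp (-Y2 d h z x/(4*b)) * u ℓ x^2) := by
    intro x
    have : (Real.exp (Phi d h ℓ b α z ℓ x))^2 = Real.exp e0 * Real.exp (-Y2 d h z x/(4*b)) := by
      rw [← Real.exp_nat_mul, ← Real.exp_add]
      congr 1
      unfold Phi; rw [he0, add_sub_cancel_left]; push_cast; field_simp; ring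
    simp only [hF, Fv, mul_pow, this]
    rw [div_self hℓ.ne']; ring
  set I := ∫ t in (0:ℝ)..ℓ, mEn d h B (u t) with hI
  have hI0 : 0 ≤ I := intervalIntegral.integral_nonneg hℓ.le fun t _ => mEn_nonneg
  set K := (4/ℓ + 12*ℓ*d*(d+1)*c^2) with hK
  have hK0 : 0 ≤ K := by positivity
  set D := ∑ x ∈ B, Stot d h b ℓ α z F x * F x with hDd
  have hDb : -(K * Real.exp (e0+w) * I) ≤ b * D := by
    rcases le_total 0 D with h0 | h0
    · have : 0 ≤ K * Real.exp (e0+w) * I := by positivity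
      have := mul_nonneg hb0.le h0
      linarith
    · have : b^2/(8*ℓ) * D ≤ 0 := mul_nonpos_of_nonneg_of_nonpos (by positivity) h0
      linarith
  -- split
  have hsplit : ∑ x ∈ B, F x^2 ≤ 2 * ∑ x ∈ B with Y2 d h z x < r^2, F x^2 + (64*b^2/r^2) * (-D) := by
    have h1 : (64*b^2/r^2) * D ≤ ∑ x ∈ B, (64*b^2/r^2) * ((- Y2 d h z x/(32*b^2) + 2*α/b) * F x^2) := by
      rw [← Finset.mul_sum]; gcongr
    have h2 : ∑ x ∈ B, (64*b^2/r^2) * ((- Y2 d h z x/(32*b^2) + 2*α/b) * F x^2) ≤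
      ∑ x ∈ B, (2 * (if Y2 d h z x < r^2 then F x^2 else 0) - F x^2) := by
      refine Finset.sum_le_sum fun x _ => ?_
      have e : (64*b^2/r^2) * ((- Y2 d h z x/(32*b^2) + 2*α/b) * F x^2) = (1 - 2 * (Y2 d h z x/r^2)) * F x^2 := by
        rw [hαd]; field_simp; ring
      rw [e]
      have y0 : 0 ≤ Y2 d h z x/r^2 := div_nonneg Y2_nonneg (by positivity)
      split_ifs with hy
      · have := mul_nonneg y0 (sq_nonneg (F x))
        linarith
      · have y1 : 1 ≤ Y2 d h z x/r^2 := by rw [le_div_iff₀ (by positivity)]; linarith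
        have := mul_nonneg (sub_nonneg.2 y1) (sq_nonneg (F x))
        linarith
    have h3 := h1.trans h2
    rw [Finset.sum_sub_distrib, ← Finset.mul_sum, ← Finset.sum_filter] at h3
    linarith
  have hA1 : ∑ x ∈ A, u ℓ x^2 ≤ Real.exp (P0/(4*b)) * Real.exp (-e0) * ∑ x ∈ B, F x^2 := by
    calc ∑ x ∈ A, u ℓ x^2 ≤ ∑ x ∈ A, Real.exp (P0/(4*b)) * Real.exp (-e0) * F x^2 := by
          refine Finset.sum_le_sum fun x hx => ?_
          obtain ⟨-, h2, h3⟩ := hA x hx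
          rw [hFsq, h2]
          have : Real.exp (P0/(4*b)) * Real.exp (-e0) * (Real.exp e0 * (1^2 * Real.exp (-Y2 d h z x/(4*b)) * u ℓ x^2)) = Real.exp (P0/(4*b) -Y2 d h z x/(4*b)) * u ℓ x^2 := by
            rw [sub_eq_add_neg, Real.exp_add, Real.exp_neg, ← neg_div]
            field_simp
          rw [this]
          have : 1 ≤ Real.exp (P0/(4*b) -Y2 d h z x/(4*b)) := by
            apply Real.one_le_exp
            have : Y2 d h z x/(4*b) ≤ P0/(4*b) := by gcongr
            linarith
          exact le_mul_of_one_le_left (sq_nonneg _) this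
      _ = Real.exp (P0/(4*b)) * Real.exp (-e0) * ∑ x ∈ A, F x^2 := by rw [Finset.mul_sum]
      _ ≤ _ := by
          gcongr
          exact fun x hx => (hA x hx).1
  have hS1 : ∑ x ∈ B with Y2 d h z x < r^2, F x^2 ≤ Real.exp e0 * ∑ x ∈ B with Y2 d h z x < r^2, u ℓ x^2 := by
    rw [Finset.mul_sum]
    refine Finset.sum_le_sum fun x _ => ?_
    rw [hFsq]
    have h1 : Real.exp (-Y2 d h z x/(4*b)) ≤ 1 := by
      apply Real.exp_le_one_iff.2
      rw [neg_div]
      have := div_nonneg (Y2_nonneg (d:=d) (h:=h) (z:=z) (x:=x)) (by positivity : 0 ≤ 4*b)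
      linarith
    have h2 : χ x^2 ≤ 1 := pow_le_one₀ (hχ0 x).1 (hχ0 x).2
    have : χ x^2 * Real.exp (-Y2 d h z x/(4*b)) ≤ 1 := mul_le_one₀ h2 (Real.exp_pos _).le h1
    gcongr
    exact mul_le_of_le_one_left (sq_nonneg _) this
  have hDD : (64*b^2/r^2) * (-D) ≤ (64*b/r^2) * (K * Real.exp (e0+w) * I) := by
    have : (64*b^2/r^2) * (-D) = (64*b/r^2) * (-(b*D)) := by ring
    rw [this]; gcongr; linarith
  calc _ ≤ Real.exp (P0/(4*b)) * Real.exp (-e0) * ∑ x ∈ B, F x^2 := hA1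
    _ ≤ Real.exp (P0/(4*b)) * Real.exp (-e0) * (2 * (Real.exp e0 * ∑ x ∈ B with Y2 d h z x < r^2, u ℓ x^2) + (64*b/r^2) * (K * Real.exp (e0+w) * I)) := by
        gcongr; linarith
    _ = _ := by
        have a1 : Real.exp (-e0) * Real.exp e0 = 1 := by rw [← Real.exp_add]; simp
        have a2 : Real.exp (P0/(4*b)) * Real.exp (-e0) * Real.exp (e0+w) = Real.exp (-G/b) := by
          rw [← Real.exp_add, ← Real.exp_add]; congr 1; rw [hw]; field_simp; ring
        rw [← a2]
        linear_combination (Real.exp (P0/(4*b)) * 2 * ∑ x ∈ B with Y2 d h z x < r^2, u ℓ x^2) * a1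

end

section

def cm (s : ℝ) : ℝ := if s ≤ 0 then 0 else s^2
def cp (s : ℝ) : ℝ := (1/2) * (cm s - 2 * cm (s-1) + cm (s-2))
def cx (a s : ℝ) : ℝ := cp (a - s) + cp (a + s) - 1

lemma cm_sd (s h : ℝ) (_hh : 0 < h) : 0 ≤ cm (s+h) + cm (s-h) - 2 * cm s ∧ cm (s+h) + cm (s-h) - 2 * cm s ≤ 2*h^2 := by
  unfold cm
  split_ifs <;> constructor <;> nlinarith
lemma cp_sd (s h : ℝ) (hh : 0 < h) : |cp (s+h) + cp (s-h) - 2 * cp s| ≤ 2*h^2 := by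
  have h1 := cm_sd s h hh
  have h2 := cm_sd (s-1) h hh
  have h3 := cm_sd (s-2) h hh
  unfold cp
  rw [show s + h - 1 = s - 1 + h by ring, show s + h - 2 = s - 2 + h by ring,
    show s - h - 1 = s - 1 - h by ring, show s - h - 2 = s - 2 - h by ring]
  rw [abs_le]; constructor <;> linarith
lemma cp_zero {s : ℝ} (hs : s ≤ 0) : cp s = 0 := by
  unfold cp cm; simp [hs, show s ≤ 1 by linarith, show s ≤ 2 by linarith]
lemma cp_one {s : ℝ} (hs : 2 ≤ s) : cp s = 1 := by
  unfold cp cm; split_ifs <;> nlinarith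
lemma cp_mem (s : ℝ) : 0 ≤ cp s ∧ cp s ≤ 1 := by
  unfold cp cm; split_ifs <;> constructor <;> nlinarith
set_option maxHeartbeats 2000000 in
lemma cm_inc (s h : ℝ) (hh : 0 < h) : 0 ≤ cm (s+h) - cm s - (cm (s-1+h) - cm (s-1)) ∧
    cm (s+h) - cm s - (cm (s-1+h) - cm (s-1)) ≤ 2*h := by
  unfold cm; split_ifs <;> constructor <;> nlinarith
lemma cp_lip (s h : ℝ) (hh : 0 < h) : |cp (s+h) - cp s| ≤ h := by
  have h1 := cm_inc s h hh
  have h2 := cm_inc (s-1) h hh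
  unfold cp
  rw [show s + h - 1 = s - 1 + h by ring, show s + h - 2 = s - 1 - 1 + h by ring, show s - 2 = s - 1 - 1 by ring]
  rw [abs_le]; constructor <;> linarith
lemma cx_lip (a s h : ℝ) (hh : 0 < h) : |cx a (s+h) - cx a s| ≤ 2 * h := by
  have h1 := cp_lip (a + s) h hh
  have h2 := cp_lip (a - s - h) h hh
  unfold cx
  rw [abs_le] at *
  rw [show a - (s+h) = a - s - h by ring, show a + (s + h) = a + s + h by ring]
  rw [sub_add_cancel] at h2
  constructor <;> linarith
lemma cx_sd (a s h : ℝ) (hh : 0 < h) : |cx a (s+h) + cx a (s-h) - 2 * cx a s| ≤ 4 * h^2 := by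
  have h1 := cp_sd (a + s) h hh
  have h2 := cp_sd (a - s) h hh
  unfold cx
  rw [abs_le] at *
  rw [show a - (s+h) = a - s - h by ring, show a + (s + h) = a + s + h by ring,
    show a - (s-h) = a - s + h by ring, show a + (s - h) = a + s - h by ring]
  constructor <;> linarith
lemma cx_one {a s : ℝ} (hs : |s| ≤ a - 2) : cx a s = 1 := by
  rw [abs_le] at hs
  unfold cx; rw [cp_one (by linarith), cp_one (by linarith)]; norm_num
lemma cx_zero {a s : ℝ} (ha : 2 ≤ a) (hs : a ≤ |s|) : cx a s = 0 := by
  unfold cx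
  rcases le_abs.1 hs with h | h
  · rw [cp_zero (by linarith), cp_one (by linarith)]; norm_num
  · rw [cp_one (by linarith), cp_zero (by linarith)]; norm_num
lemma cx_mem {a : ℝ} (ha : 2 ≤ a) (s : ℝ) : 0 ≤ cx a s ∧ cx a s ≤ 1 := by
  have h1 := cp_mem (a - s)
  have h2 := cp_mem (a + s)
  unfold cx
  rcases le_total 0 s with h | h
  · rw [cp_one (show 2 ≤ a + s by linarith)]; constructor <;> linarith
  · rw [cp_one (show 2 ≤ a - s by linarith)]; constructor <;> linarith

def chi (d : ℕ) (h a : ℝ) (z : Fin d → ℝ) (x : Fin d → ℤ) : ℝ := ∏ j, cx a (h * x j - z j)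

lemma chi_fac {d : ℕ} {h a : ℝ} (ha : 2 ≤ a) (z : Fin d → ℝ) (j : Fin d) (x : Fin d → ℤ) :
    ∃ p : ℝ, 0 ≤ p ∧ p ≤ 1 ∧ chi d h a z x = p * cx a (h * x j - z j) ∧
      chi d h a z (x + latE d j) = p * cx a (h * x j - z j + h) ∧
      chi d h a z (x - latE d j) = p * cx a (h * x j - z j - h) := by
  refine ⟨∏ i ∈ Finset.univ.erase j, cx a (h * x i - z i), Finset.prod_nonneg fun i _ => (cx_mem ha _).1,
    Finset.prod_le_one (fun i _ => (cx_mem ha _).1) (fun i _ => (cx_mem ha _).2), ?_, ?_, ?_⟩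
  · unfold chi
    rw [← Finset.prod_erase_mul _ _ (Finset.mem_univ j)]
  · unfold chi
    rw [← Finset.prod_erase_mul _ _ (Finset.mem_univ j)]
    congr 1
    · refine Finset.prod_congr rfl fun i hi => ?_
      simp [latE_ne d (Finset.ne_of_mem_erase hi)]
    · congr 1
      simp only [Pi.add_apply, latE_self]; push_cast; ring
  · unfold chi
    rw [← Finset.prod_erase_mul _ _ (Finset.mem_univ j)]
    congr 1
    · refine Finset.prod_congr rfl fun i hi => ?_
      simp [latE_ne d (Finset.ne_of_mem_erase hi)]
    · congr 1
      simp only [Pi.sub_apply, latE_self]; push_cast; ring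

lemma chi_ne {d : ℕ} {h a : ℝ} (ha : 2 ≤ a) {z : Fin d → ℝ} {x : Fin d → ℤ} (hx : chi d h a z x ≠ 0) (j : Fin d) :
    |h * x j - z j| ≤ a := by
  by_contra hc
  push Not at hc
  exact hx (Finset.prod_eq_zero (Finset.mem_univ j) (cx_zero ha hc.le))

set_option maxHeartbeats 1000000 in
theorem local_chi {d : ℕ} {h ℓ κ r P0 G a v0 : ℝ} (z : Fin d → ℝ) {Vx : (Fin d → ℤ) → ℝ}
    {u : ℝ → (Fin d → ℤ) → ℝ} {B : Finset (Fin d → ℤ)} (hh : 0 < h) (hℓ : 0 < ℓ) (hκ : 0 < κ) (hκ1 : κ ≤ 1)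
    (hr : 0 < r) (hh1 : h ≤ 1) (ha : 3 ≤ a)
    (hα : 256 ≤ r^2/(128*(κ*ℓ))) (hαv : 64 * ℓ^2 * v0^2 ≤ r^2/(128*(κ*ℓ))) (hV : ∀ x, |Vx x| ≤ v0)
    (hsm : (h*(a+1)/(4*(κ*ℓ)))^2 ≤ κ/320)
    (hB : ∀ x, x ∈ B ↔ ∀ j, |h * x j - z j| ≤ a + 3)
    (hu : ∀ t x, HasDerivAt (fun t => u t x) (lapR d h (u t) x - Vx x * u t x) t)
    (hd : (d:ℝ) * h^2 ≤ r^2/4)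
    (hlog : 1/2 + 64*(P0/4+G)/r^2 ≤ Real.log (1/(2*κ)))
    (hR : r^2/128 + P0/4 + G ≤ (a-3)^2 * κ/8) {A : Finset (Fin d → ℤ)}
    (hA : ∀ x ∈ A, (∀ j, |h * x j - z j| ≤ a - 2) ∧ Y2 d h z x ≤ P0) :
    ∑ x ∈ A, u ℓ x^2 ≤ Real.exp (P0/(4*(κ*ℓ))) * (2 * ∑ x ∈ B with Y2 d h z x < r^2, u ℓ x^2)
      + (64*(κ*ℓ)/r^2) * (4/ℓ + 12*ℓ*d*(d+1)*4^2) * Real.exp (-G/(κ*ℓ)) * ∫ t in (0:ℝ)..ℓ, mEn d h B (u t) := by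
  have ha2 : 2 ≤ a := by linarith
  have hκℓ : κ*ℓ/(8*ℓ)/40 = κ/320 := by field_simp; norm_num
  refine local_carl (χ := chi d h a z) (b := κ*ℓ) (R := (a-3)^2) z hh hℓ hκ hκ1 rfl hr hα hαv hV ?_ ?_ ?_ ?_ ?_ ?_ ?_ hu hd hlog hR ?_
  · rw [hκℓ]
    refine le_trans ?_ hsm
    gcongr
    nlinarith
  · intro j x hx
    rw [hκℓ]
    refine le_trans ?_ hsm
    rw [← sq_abs]
    have hbd : |h * x j + h/2 - z j| ≤ a + 1 := by
      rcases hx with hx | hx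
      · have := abs_le.1 (chi_ne ha2 hx j)
        rw [abs_le]; constructor <;> linarith
      · have := abs_le.1 (chi_ne ha2 hx j)
        simp only [Pi.add_apply, latE_self] at this; push_cast at this
        rw [abs_le]; constructor <;> linarith
    have e : |qv d h (κ*ℓ) z j x| = h * |h * x j + h/2 - z j| / (4*(κ*ℓ)) := by
      unfold qv
      rw [abs_div, abs_mul, abs_of_pos hh, abs_of_pos (show 0 < 4*(κ*ℓ) by positivity)]
    rw [e]
    gcongr
  · intro x
    exact ⟨Finset.prod_nonneg fun i _ => (cx_mem ha2 _).1, 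
      Finset.prod_le_one (fun i _ => (cx_mem ha2 _).1) (fun i _ => (cx_mem ha2 _).2)⟩
  · intro x j
    obtain ⟨p, p0, p1, e1, e2, e3⟩ := chi_fac (h := h) ha2 z j x
    rw [e1, e2, ← mul_sub, abs_mul, abs_of_nonneg p0]
    have := cx_lip a (h * x j - z j) h hh
    exact (mul_le_of_le_one_left (abs_nonneg _) p1).trans (by linarith)
  · intro x j
    obtain ⟨p, p0, p1, e1, e2, e3⟩ := chi_fac (h := h) ha2 z j x
    rw [e1, e2, e3, show p * cx a (h * x j - z j + h) + p * cx a (h * x j - z j - h) - 2 * (p * cx a (h * x j - z j)) = p * (cx a (h * x j - z j + h) + cx a (h * x j - z j - h) - 2 * cx a (h * x j - z j)) by ring, abs_mul, abs_of_nonneg p0]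
    have := cx_sd a (h * x j - z j) h hh
    exact (mul_le_of_le_one_left (abs_nonneg _) p1).trans (by linarith [sq_nonneg h])
  · intro x j hx
    obtain ⟨p, p0, p1, e1, e2, e3⟩ := chi_fac (h := h) ha2 z j x
    rw [e1, e2, e3] at hx
    have hs : a - 3 ≤ |h * x j - z j| := by
      by_contra hc
      push Not at hc
      have hc' := abs_lt.1 hc
      have c0 : cx a (h * x j - z j) = 1 := cx_one (by rw [abs_le]; constructor <;> linarith)
      have c1 : cx a (h * x j - z j + h) = 1 := cx_one (by rw [abs_le]; constructor <;> linarith)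
      have c2 : cx a (h * x j - z j - h) = 1 := cx_one (by rw [abs_le]; constructor <;> linarith)
      rw [c0, c1, c2] at hx
      simp at hx
    calc (a-3)^2 ≤ |h * x j - z j|^2   := by gcongr
      _ = (h * x j - z j)^2 := sq_abs _
      _ ≤ Y2 d h z x := Finset.single_le_sum (f := fun j => (h * x j - z j)^2) (fun i _ => sq_nonneg _) (Finset.mem_univ j)
  · intro x v hx hv
    rw [hB]
    intro j
    have h1 := abs_le.1 (chi_ne ha2 hx j)
    have h2 : |(v j : ℝ)| ≤ 3 := by exact_mod_cast hv j
    rw [abs_le] at h2 ⊢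
    simp only [Pi.add_apply]; push_cast
    have k1 := mul_le_mul_of_nonneg_left h2.1 hh.le
    have k2 := mul_le_mul_of_nonneg_left h2.2 hh.le
    constructor <;> linarith
  · intro x hx
    obtain ⟨h1, h2⟩ := hA x hx
    refine ⟨(hB x).2 fun j => (h1 j).trans (by linarith), ?_, h2⟩
    exact Finset.prod_eq_one fun j _ => cx_one (h1 j)

end

section

set_option maxHeartbeats 4000000 in
theorem local_param (d : ℕ) (L γ v0 : ℝ) (hL : 0 < L) (hγ : 0 < γ) :
    ∃ a > (0:ℝ), ∃ ac > (0:ℝ), ∃ Cc > (0:ℝ), ∃ c1 > (0:ℝ), ∃ ℓ0 > (0:ℝ), ℓ0 ≤ 1 ∧ c1 ≤ 1 ∧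
      ∀ h ℓ : ℝ, 0 < h → 0 < ℓ → ℓ ≤ ℓ0 → h ≤ c1 * ℓ → ∀ (z : Fin d → ℝ) (Vx : (Fin d → ℤ) → ℝ)
        (u : ℝ → (Fin d → ℤ) → ℝ) (B A : Finset (Fin d → ℤ)), (∀ x, |Vx x| ≤ v0) →
        (∀ t x, HasDerivAt (fun t => u t x) (lapR d h (u t) x - Vx x * u t x) t) →
        (∀ x, x ∈ B ↔ ∀ j, |h * x j - z j| ≤ ac) →
        (∀ x ∈ A, ∀ j, |h * x j - z j| ≤ L) →
        ∑ x ∈ A, u ℓ x^2 ≤ 2 * Real.exp (a/ℓ) * ∑ x ∈ B with (∀ j, |h * x j - z j| ≤ γ * L/2), u ℓ x^2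
          + Cc * Real.exp (-10*a/ℓ) * ∫ t in (0:ℝ)..ℓ, mEn d h B (u t) := by
  obtain ⟨r, hr⟩ : ∃ r, r = γ*L/2 := ⟨_, rfl⟩
  have hr0 : 0 < r := by rw [hr]; positivity
  obtain ⟨P0, hP0⟩ : ∃ P0 : ℝ, P0 = d * L^2 := ⟨_, rfl⟩
  have hP00 : 0 ≤ P0 := by rw [hP0]; positivity
  obtain ⟨G, hG⟩ : ∃ G, G = 10*(P0/4+1) := ⟨_, rfl⟩
  have hG0 : 0 < G := by rw [hG]; positivity
  obtain ⟨m, hm⟩ : ∃ m, m = 1/2 + 64*(P0/4+G)/r^2 := ⟨_, rfl⟩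
  have hm0 : 0 < m := by rw [hm]; positivity
  obtain ⟨κ, hκ⟩ : ∃ κ, κ = Real.exp (-m)/2 := ⟨_, rfl⟩
  have hκ0 : 0 < κ := by rw [hκ]; positivity
  have hκ1 : κ ≤ 1 := by
    have : Real.exp (-m) ≤ 1 := Real.exp_le_one_iff.2 (by linarith)
    rw [hκ]; linarith
  obtain ⟨Q, hQ⟩ : ∃ Q, Q = r^2/128 + P0/4 + G := ⟨_, rfl⟩
  have hQ0 : 0 < Q := by rw [hQ]; positivity
  obtain ⟨ac, hac⟩ : ∃ ac, ac = L + 9 + 8*Q/κ := ⟨_, rfl⟩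
  have hQκ : 0 < 8*Q/κ := by positivity
  have hac0 : 9 < ac := by linarith
  obtain ⟨c1, hc1⟩ : ∃ c1, c1 = 4*κ^2/(320*(ac+1)) := ⟨_, rfl⟩
  have hc10 : 0 < c1 := by rw [hc1]; positivity
  have hc11 : c1 ≤ 1 := by
    rw [hc1, div_le_one (by positivity)]
    have : κ^2 ≤ 1 := pow_le_one₀ hκ0.le hκ1
    linarith
  obtain ⟨ℓ0, hℓ0⟩ : ∃ ℓ0, ℓ0 = min 1 (r^2/(32768*(v0^2+1)*(d+1))) := ⟨_, rfl⟩
  have hℓ00 : 0 < ℓ0 := by rw [hℓ0]; positivity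
  have hℓ01 : ℓ0 ≤ 1 := by rw [hℓ0]; exact min_le_left _ _
  refine ⟨(P0/4+1)/κ, by positivity, ac + 3, by linarith, 64/r^2*(4+12*d*(d+1)*4^2), by positivity, c1, hc10, ℓ0, hℓ00, hℓ01, hc11, ?_⟩
  intro h ℓ hh hℓ hℓℓ hhℓ z Vx u B A hV hu hB hA
  have hℓ1 : ℓ ≤ 1 := hℓℓ.trans hℓ01
  have hh1 : h ≤ ℓ := hhℓ.trans (mul_le_of_le_one_left hℓ.le hc11)
  have hℓr : ℓ * (32768*(v0^2+1)*(d+1)) ≤ r^2 := by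
    rw [← le_div_iff₀ (by positivity)]
    exact hℓℓ.trans (by rw [hℓ0]; exact min_le_right _ _)
  have hd0 : (0:ℝ) ≤ d := by positivity
  have hv2 : 0 ≤ v0^2 := sq_nonneg _
  have hdv : 0 ≤ v0^2 * d := by positivity
  have hexp : ℓ * (32768*(v0^2+1)*(d+1)) = 32768*(ℓ*(v0^2*d)) + 32768*(ℓ*v0^2) + 32768*(ℓ*d) + 32768*ℓ := by ring
  have p1 : 0 ≤ ℓ*(v0^2*d) := by positivity
  have p2 : 0 ≤ ℓ*v0^2 := by positivity
  have p3 : 0 ≤ ℓ*d := by positivity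
  have hℓ2 : ℓ^2 ≤ 1 := pow_le_one₀ hℓ.le hℓ1
  have hκℓ : κ*ℓ ≤ ℓ := mul_le_of_le_one_left hℓ.le hκ1
  have hκℓ0 : 0 < κ*ℓ := by positivity
  have key := local_chi (P0 := P0) (G := G) (a := ac) (v0 := v0) (r := r) (κ := κ) (ℓ := ℓ) (u := u) (B := B) (A := A) (Vx := Vx) z hh hℓ hκ0 hκ1 hr0 (hh1.trans hℓ1) (by linarith)
    (by rw [le_div_iff₀ (by positivity)]; linarith)
    (by rw [le_div_iff₀ (by positivity)]
        calc 64*ℓ^2*v0^2*(128*(κ*ℓ)) ≤ 64*1*v0^2*(128*ℓ) := by gcongr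
          _ = 8192*(ℓ*v0^2) := by ring
          _ ≤ r^2 := by linarith)
    hV
    (by
      have : h*(ac+1)/(4*(κ*ℓ)) ≤ κ/320 := by
        rw [div_le_iff₀ (by positivity)]
        calc h*(ac+1) ≤ c1*ℓ*(ac+1) := by gcongr
          _ = _ := by rw [hc1]; field_simp
      calc (h*(ac+1)/(4*(κ*ℓ)))^2 ≤ (κ/320)^2 := by gcongr
        _ ≤ κ/320 := pow_le_of_le_one (by positivity) (by linarith) two_ne_zero)
    (by simpa using hB) hu
    (by
      have : h^2 ≤ ℓ := by rw [sq]; exact (mul_le_of_le_one_left hh.le (hh1.trans hℓ1)).trans hh1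
      calc (d:ℝ)*h^2 ≤ d*ℓ := by gcongr
        _ ≤ r^2/4 := by linarith)
    (by rw [← hm, hκ]
        rw [show 1/(2*(Real.exp (-m)/2)) = Real.exp m by rw [Real.exp_neg]; field_simp, Real.log_exp])
    (by rw [← hQ]
        have y1 : 8*Q/κ ≤ ac - 3 := by linarith
        have y2 : 1 ≤ ac - 3 := by linarith
        have y3 : 8*Q/κ ≤ (ac-3)^2 := y1.trans (by rw [sq]; exact le_mul_of_one_le_left (by linarith) y2)
        rw [div_le_iff₀ hκ0] at y3
        linarith)
    (by
      intro x hx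
      refine ⟨fun j => (hA x hx j).trans (by linarith), ?_⟩
      rw [hP0]; unfold Y2
      calc ∑ j, (h * x j - z j)^2 ≤ ∑ j : Fin d, L^2 := by
            refine Finset.sum_le_sum fun j _ => ?_
            rw [← sq_abs]; gcongr; exact hA x hx j
        _ = _ := by simp)
  refine key.trans ?_
  have hI0 : 0 ≤ ∫ t in (0:ℝ)..ℓ, mEn d h B (u t) := intervalIntegral.integral_nonneg hℓ.le fun t _ => mEn_nonneg
  have e1 : -10*((P0/4+1)/κ)/ℓ = -G/(κ*ℓ) := by rw [hG]; field_simp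
  have e2 : P0/(4*(κ*ℓ)) ≤ (P0/4+1)/κ/ℓ := by
    rw [div_div, div_le_div_iff₀ (by positivity) (by positivity)]
    linarith
  have e3 : (64*(κ*ℓ)/r^2) * (4/ℓ + 12*ℓ*d*(d+1)*4^2) ≤ 64/r^2*(4+12*d*(d+1)*4^2) := by
    calc (64*(κ*ℓ)/r^2) * (4/ℓ + 12*ℓ*d*(d+1)*4^2) ≤ (64*ℓ/r^2) * (4/ℓ + 12*ℓ*d*(d+1)*4^2) := by gcongr
      _ = 64/r^2*(4+12*(ℓ^2)*d*(d+1)*4^2) := by field_simp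
      _ ≤ 64/r^2*(4+12*1*d*(d+1)*4^2) := by gcongr
      _ = _ := by ring
  have e4 : ∑ x ∈ B with Y2 d h z x < r^2, u ℓ x^2 ≤ ∑ x ∈ B with (∀ j, |h * x j - z j| ≤ γ * L/2), u ℓ x^2 := by
    refine Finset.sum_le_sum_of_subset_of_nonneg ?_ (fun _ _ _ => sq_nonneg _)
    intro x hx
    rw [Finset.mem_filter] at hx ⊢
    refine ⟨hx.1, fun j => ?_⟩
    rw [← hr]
    have : (h * x j - z j)^2 ≤ Y2 d h z x := Finset.single_le_sum (f := fun j => (h * x j - z j)^2) (fun i _ => sq_nonneg _) (Finset.mem_univ j)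
    exact abs_le_of_sq_le_sq (this.trans hx.2.le) hr0.le
  rw [e1]
  have h5 : 0 ≤ ∑ x ∈ B with Y2 d h z x < r^2, u ℓ x^2 := Finset.sum_nonneg fun _ _ => sq_nonneg _
  have f1 : Real.exp (P0/(4*(κ*ℓ))) * (2 * ∑ x ∈ B with Y2 d h z x < r^2, u ℓ x^2) ≤ 2 * Real.exp ((P0/4+1)/κ/ℓ) * ∑ x ∈ B with (∀ j, |h * x j - z j| ≤ γ * L/2), u ℓ x^2 := by
    calc _ = 2 * Real.exp (P0/(4*(κ*ℓ))) * ∑ x ∈ B with Y2 d h z x < r^2, u ℓ x^2 := by ring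
      _ ≤ _ := by gcongr
  have f2 : 64 * (κ * ℓ) / r ^ 2 * (4 / ℓ + 12 * ℓ * d * (d + 1) * 4 ^ 2) * Real.exp (-G / (κ * ℓ)) * (∫ t in (0:ℝ)..ℓ, mEn d h B (u t)) ≤ 64/r^2*(4+12*d*(d+1)*4^2) * Real.exp (-G / (κ * ℓ)) * (∫ t in (0:ℝ)..ℓ, mEn d h B (u t)) := by
    gcongr
  linarith

end

section

open scoped ComplexConjugate InnerProductSpace

lemma hs_norm {d : ℕ} (v : Hsp d) : HasSum (fun x => ‖v x‖^2) (‖v‖^2) := by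
  have h1 := lp.hasSum_inner (𝕜 := ℂ) v v
  have h2 := Complex.hasSum_re h1
  rw [inner_self_eq_norm_sq_to_K] at h2
  convert h2 using 1
  · funext x
    rw [inner_self_eq_norm_sq_to_K]; norm_cast
  · norm_cast

lemma hs_C {d : ℕ} (v : (Fin d → ℤ) → ℂ) {A : ℝ} (hA : HasSum (fun x => ‖v x‖^2) A) (e : Fin d → ℤ) : ∃ C : ℂ, HasSum (fun x => conj (v (x + e)) * v x) C ∧
    HasSum (fun x => conj (v (x - e)) * v x) (conj C) ∧ HasSum (fun x => ‖v (x + e) - v x‖^2) (2*A - 2 * C.re) ∧ 2*A-2*C.re ≤ 4 * A := by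
  have hA' : HasSum (fun x => ‖v (x + e)‖^2) A :=
    (Equiv.addRight e).hasSum_iff (f := fun x => ‖v x‖^2) |>.2 hA
  have hs : Summable (fun x => conj (v (x + e)) * v x) := by
    refine Summable.of_norm_bounded (hA'.summable.add hA.summable) fun x => ?_
    rw [norm_mul, RCLike.norm_conj]
    nlinarith [sq_nonneg (‖v (x+e)‖ - ‖v x‖), sq_nonneg ‖v (x+e)‖, sq_nonneg ‖v x‖]
  obtain ⟨C, hC⟩ := hs
  have h3 : HasSum (fun x => ‖v (x + e) - v x‖^2) (2*A - 2 * C.re) := by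
    have h2 := (hA'.add hA).sub ((Complex.hasSum_re hC).mul_left 2)
    have e1 : (fun x => ‖v (x + e) - v x‖^2) = (fun b => ‖v (b + e)‖ ^ 2 + ‖v b‖ ^ 2 - 2 * ((starRingEnd ℂ) (v (b + e)) * v b).re) := by
      funext x
      simp only [← Complex.normSq_eq_norm_sq, Complex.normSq_apply, Complex.sub_re, Complex.sub_im, Complex.mul_re, Complex.conj_re, Complex.conj_im]
      ring
    rw [e1, two_mul A]
    exact h2
  refine ⟨C, hC, ?_, h3, ?_⟩
  · have h1 : HasSum (fun x => conj (conj (v (x + e)) * v x)) (conj C) := Complex.hasSum_conj'.2 (by simpa using hC)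
    rw [← (Equiv.addRight e).hasSum_iff]
    convert h1 using 1
    funext x
    simp [mul_comm]
  · have h5 := hasSum_le (fun x => ?_) h3 ((hA'.add hA).mul_left 2)
    · linarith
    · have := norm_sub_le (v (x + e)) (v x)
      nlinarith [sq_nonneg (‖v (x + e)‖ - ‖v x‖), norm_nonneg (v (x + e) - v x)]

lemma inner_P0 {d : ℕ} {h : ℝ} {V : (Fin d → ℝ) → ℝ} {v0 : ℝ}
    (hV : ∀ x, |V x| ≤ v0) (v : (Fin d → ℤ) → ℂ) {A : ℝ} (hA : HasSum (fun x => ‖v x‖^2) A) :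
    ∃ (N : Fin d → ℝ) (w : ℝ), |w| ≤ v0 * A ∧
      (∀ j, HasSum (fun x => ‖v (x + latE d j) - v x‖^2) (N j)) ∧ (∀ j, N j ≤ 4 * A) ∧
      HasSum (fun x => v x * conj (-discLap d h v x + (V (pt d h x) : ℂ) * v x)) (((∑ j, N j)/h^2 + w : ℝ) : ℂ) := by
  have hv0 : 0 ≤ v0 := (abs_nonneg _).trans (hV 0)
  choose C hC1 hC2 hC3 hC4 using fun j => hs_C v hA (latE d j)
  have hw : Summable (fun x => V (pt d h x) * ‖v x‖^2) := by
    refine Summable.of_norm_bounded (hA.summable.mul_left v0) fun x => ?_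
    rw [Real.norm_eq_abs, abs_mul, abs_of_nonneg (sq_nonneg ‖v x‖)]
    exact mul_le_mul_of_nonneg_right (hV _) (sq_nonneg _)
  obtain ⟨w, hw⟩ := hw
  refine ⟨fun j => 2*A - 2*(C j).re, w, ?_, hC3, hC4, ?_⟩
  · rw [abs_le]
    constructor
    · rw [← neg_mul]
      refine hasSum_le (fun x => ?_) (hA.mul_left (-v0)) hw
      exact mul_le_mul_of_nonneg_right (abs_le.1 (hV _)).1 (sq_nonneg _)
    · refine hasSum_le (fun x => ?_) hw (hA.mul_left v0)
      exact mul_le_mul_of_nonneg_right (abs_le.1 (hV _)).2 (sq_nonneg _)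
  · have hAc : HasSum (fun x => conj (v x) * v x) (A : ℂ) := by
      have := Complex.hasSum_ofReal.2 hA
      convert this using 1
      funext x
      rw [Complex.conj_mul']; norm_cast
    have h2 : HasSum (fun x => ∑ j, (-(conj (v (x + latE d j)) * v x) - conj (v (x - latE d j)) * v x + 2 * (conj (v x) * v x))/(h:ℂ)^2
        + ((V (pt d h x) * ‖v x‖^2 : ℝ) : ℂ)) (∑ j, (-(C j) - conj (C j) + 2 * (A : ℂ))/(h:ℂ)^2 + (w:ℂ)) := by
      refine HasSum.add (hasSum_sum fun j _ => ?_) (Complex.hasSum_ofReal.2 hw)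
      exact (((hC1 j).neg.sub (hC2 j)).add (hAc.mul_left 2)).div_const _
    convert h2 using 1
    · funext x
      simp only [discLap, map_add, map_neg, map_sum, map_div₀, map_mul, map_pow, Complex.conj_ofReal, map_sub, map_ofNat]
      rw [mul_add, mul_neg, Finset.mul_sum, ← Finset.sum_neg_distrib]
      congr 1
      · refine Finset.sum_congr rfl fun j _ => ?_
        ring
      · push_cast; rw [← Complex.conj_mul']; ring
    · push_cast
      congr 1
      rw [Finset.sum_div]
      refine Finset.sum_congr rfl fun j _ => ?_
      congr 1
      have : C j + conj (C j) = 2 * ((C j).re : ℂ) := by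
        rw [Complex.add_conj]; push_cast; rfl
      linear_combination this

lemma inner_P {d : ℕ} {h : ℝ} {V : (Fin d → ℝ) → ℝ} {P : Hsp d →L[ℂ] Hsp d} {v0 : ℝ} (hP : RealizesPh d h V P)
    (hV : ∀ x, |V x| ≤ v0) (v : Hsp d) : ∃ (N : Fin d → ℝ) (w : ℝ), |w| ≤ v0 * ‖v‖^2 ∧
      (∀ j, HasSum (fun x => ‖v (x + latE d j) - v x‖^2) (N j)) ∧ (∀ j, N j ≤ 4 * ‖v‖^2) ∧
      ⟪P v, v⟫_ℂ = (((∑ j, N j)/h^2 + w : ℝ) : ℂ) := by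
  obtain ⟨N, w, h1, h2, h3, h4⟩ := inner_P0 (h := h) hV (fun x => v x) (hs_norm v)
  refine ⟨N, w, h1, h2, h3, ?_⟩
  have h5 := lp.hasSum_inner (𝕜 := ℂ) (P v) v
  have h6 : (fun i => ⟪(P v) i, v i⟫_ℂ) = (fun x => v x * conj (-discLap d h (fun x => v x) x + (V (pt d h x) : ℂ) * v x)) := by
    funext x
    rw [hP v x]
    rfl
  rw [h6] at h5
  exact h5.unique h4

lemma P_sa {d : ℕ} {h : ℝ} {V : (Fin d → ℝ) → ℝ} {P : Hsp d →L[ℂ] Hsp d} {v0 : ℝ} (hP : RealizesPh d h V P)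
    (hV : ∀ x, |V x| ≤ v0) : IsSelfAdjoint P := by
  rw [ContinuousLinearMap.isSelfAdjoint_iff_isSymmetric, LinearMap.isSymmetric_iff_inner_map_self_real]
  intro v
  obtain ⟨N, w, -, -, -, h4⟩ := inner_P hP hV v
  simp only [ContinuousLinearMap.coe_coe]
  rw [h4, Complex.conj_ofReal]

lemma P_low {d : ℕ} {h : ℝ} {V : (Fin d → ℝ) → ℝ} {P : Hsp d →L[ℂ] Hsp d} {v0 : ℝ} (hP : RealizesPh d h V P)
    (hV : ∀ x, |V x| ≤ v0) (v : Hsp d) (Y : Finset (Fin d → ℤ)) (hh : 0 < h) :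
    ∑ x ∈ Y, ∑ j, ‖v (x + latE d j) - v x‖^2/h^2 ≤ (⟪P v, v⟫_ℂ).re + v0 * ‖v‖^2 := by
  obtain ⟨N, w, h1, h2, -, h4⟩ := inner_P hP hV v
  rw [h4, Complex.ofReal_re, Finset.sum_comm]
  have : ∑ j, ∑ x ∈ Y, ‖v (x + latE d j) - v x‖^2/h^2 ≤ (∑ j, N j)/h^2 := by
    rw [Finset.sum_div]
    refine Finset.sum_le_sum fun j _ => ?_
    rw [← Finset.sum_div]
    gcongr
    exact sum_le_hasSum Y (fun x _ => sq_nonneg _) (h2 j)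
  linarith [(abs_le.1 h1).1]

lemma P_norm {d : ℕ} {h : ℝ} {V : (Fin d → ℝ) → ℝ} {P : Hsp d →L[ℂ] Hsp d} {v0 : ℝ} (hP : RealizesPh d h V P)
    (hV : ∀ x, |V x| ≤ v0) (hh : 0 < h) : ‖P‖ ≤ 4*d/h^2 + v0 := by
  have hv0 : 0 ≤ v0 := (abs_nonneg _).trans (hV 0)
  have hsa := (P_sa hP hV).isSymmetric
  rw [P.norm_eq_iSup_rayleighQuotient hsa]
  refine ciSup_le fun v => ?_
  obtain ⟨N, w, h1, h2, h3, h4⟩ := inner_P hP hV v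
  have hN0 : ∀ j, 0 ≤ N j := fun j => (h2 j).nonneg fun x => sq_nonneg _
  have hN : ∑ j, N j ≤ d * (4*‖v‖^2) := (Finset.sum_le_sum fun j _ => h3 j).trans (by simp)
  have hN' : 0 ≤ ∑ j, N j := Finset.sum_nonneg fun j _ => hN0 j
  rw [ContinuousLinearMap.rayleighQuotient, ContinuousLinearMap.reApplyInnerSelf_apply, h4]
  rw [abs_div, abs_of_nonneg (sq_nonneg ‖v‖)]
  apply div_le_of_le_mul₀ (sq_nonneg _) (by positivity)
  have : RCLike.re (((∑ j, N j)/h^2 + w : ℝ) : ℂ) = (∑ j, N j)/h^2 + w := Complex.ofReal_re _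
  rw [this]
  have h6 : (∑ j, N j)/h^2 ≤ (d * (4*‖v‖^2))/h^2 := by gcongr
  have h7 : 0 ≤ (∑ j, N j)/h^2 := by positivity
  have h8 : (d * (4*‖v‖^2))/h^2 = 4*d/h^2 * ‖v‖^2 := by ring
  rw [abs_le] at *
  have h9 : 0 ≤ 4*d/h^2 * ‖v‖^2 := by positivity
  constructor <;> linarith

end

section

open scoped ComplexConjugate InnerProductSpace

variable {H : Type*} [NormedAddCommGroup H] [InnerProductSpace ℂ H] [CompleteSpace H]

def Sg (P : H →L[ℂ] H) (t : ℝ) : H →L[ℂ] H := NormedSpace.exp ((-(t:ℂ)) • P)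

lemma Sg_eq (P : H →L[ℂ] H) (t : ℝ) : Sg P t = NormedSpace.exp (t • (-P)) := by
  unfold Sg
  congr 1
  ext v
  simp

lemma Sg_zero (P : H →L[ℂ] H) : Sg P 0 = 1 := by simp [Sg]

lemma Sg_zero_apply (P : H →L[ℂ] H) (v : H) : Sg P 0 v = v := by rw [Sg_zero]; rfl

lemma Sg_add (P : H →L[ℂ] H) (s t : ℝ) : Sg P (s + t) = Sg P s * Sg P t := by
  rw [Sg_eq, Sg_eq, Sg_eq, add_smul]
  letI : NormedAlgebra ℚ (H →L[ℂ] H) := NormedAlgebra.restrictScalars ℚ ℂ _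
  exact NormedSpace.exp_add_of_commute (((Commute.refl (-P)).smul_left s).smul_right t)

lemma Sg_add_apply (P : H →L[ℂ] H) (s t : ℝ) (v : H) : Sg P (s + t) v = Sg P s (Sg P t v) := by
  rw [Sg_add]; rfl

lemma Sg_pow (P : H →L[ℂ] H) (t : ℝ) (n : ℕ) : (Sg P t)^n = Sg P (n * t) := by
  induction n with
  | zero => simp [Sg_zero]
  | succ n ih => rw [pow_succ, ih, ← Sg_add]; push_cast; congr 1; ring

lemma Sg_sa {P : H →L[ℂ] H} (hP : IsSelfAdjoint P) (t : ℝ) : IsSelfAdjoint (Sg P t) := by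
  rw [Sg_eq]
  exact ((IsSelfAdjoint.all t).smul hP.neg).exp

lemma Sg_hasDeriv (P : H →L[ℂ] H) (t : ℝ) : HasDerivAt (fun t => Sg P t) (-P * Sg P t) t := by
  have := hasDerivAt_exp_smul_const' (𝕂 := ℝ) (-P) t
  simp only [Sg_eq]
  exact this

lemma Sg_hasDeriv_apply (P : H →L[ℂ] H) (t : ℝ) (v : H) : HasDerivAt (fun t => Sg P t v) (-P (Sg P t v)) t := by
  have := ((ContinuousLinearMap.apply ℂ H v).restrictScalars ℝ).hasFDerivAt.comp_hasDerivAt t (Sg_hasDeriv P t)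
  exact this.congr_deriv (by simp)

lemma Sg_cont (P : H →L[ℂ] H) : Continuous (fun t => Sg P t) :=
  continuous_iff_continuousAt.2 fun t => (Sg_hasDeriv P t).continuousAt

lemma Sg_cont_apply (P : H →L[ℂ] H) (v : H) : Continuous (fun t => Sg P t v) :=
  continuous_iff_continuousAt.2 fun t => (Sg_hasDeriv_apply P t v).continuousAt

lemma Sg_sym {P : H →L[ℂ] H} (hP : IsSelfAdjoint P) (t : ℝ) (v w : H) : ⟪Sg P t v, w⟫_ℂ = ⟪v, Sg P t w⟫_ℂ :=
  (Sg_sa hP t).isSymmetric v w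

lemma Sg_normsq_deriv (P : H →L[ℂ] H) (v : H) (t : ℝ) :
    HasDerivAt (fun t => ‖Sg P t v‖^2) (-2 * (⟪P (Sg P t v), Sg P t v⟫_ℂ).re) t := by
  letI : InnerProductSpace ℝ H := InnerProductSpace.rclikeToReal ℂ H
  have := (Sg_hasDeriv_apply P t v).norm_sq
  refine this.congr_deriv ?_
  rw [real_inner_comm]
  have e : ∀ x y : H, ⟪x, y⟫_ℝ = (⟪x, y⟫_ℂ).re := fun x y => rfl
  rw [e, inner_neg_left, Complex.neg_re]; ring

lemma Sg_bound {P : H →L[ℂ] H} {v0 : ℝ} (hlow : ∀ v, -(v0 * ‖v‖^2) ≤ (⟪P v, v⟫_ℂ).re) (v : H) {t : ℝ} (ht : 0 ≤ t) :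
    ‖Sg P t v‖^2 ≤ Real.exp (2*v0*t) * ‖v‖^2 := by
  have hd : ∀ s, HasDerivAt (fun s => Real.exp (-(2*v0*s)) * ‖Sg P s v‖^2)
     (Real.exp (-(2*v0*s)) * (-(2*v0)) * ‖Sg P s v‖^2 + Real.exp (-(2*v0*s)) * (-2 * (⟪P (Sg P s v), Sg P s v⟫_ℂ).re)) s := by
    intro s
    have h1 : HasDerivAt (fun s => -(2*v0*s)) (-(2*v0)) s := by
      exact (((hasDerivAt_id s).const_mul (2*v0)).neg).congr_deriv (by simp)
    exact h1.exp.mul (Sg_normsq_deriv P v s)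
  have hanti : Antitone (fun s => Real.exp (-(2*v0*s)) * ‖Sg P s v‖^2) := by
    refine antitone_of_deriv_nonpos (fun s => (hd s).differentiableAt) fun s => ?_
    rw [(hd s).deriv]
    have := hlow (Sg P s v)
    have h2 := Real.exp_pos (-(2*v0*s))
    have e : Real.exp (-(2*v0*s)) * (-(2*v0)) * ‖Sg P s v‖^2 + Real.exp (-(2*v0*s)) * (-2 * (⟪P (Sg P s v), Sg P s v⟫_ℂ).re) = 
      Real.exp (-(2*v0*s)) * (2 * (-(v0*‖Sg P s v‖^2) - (⟪P (Sg P s v), Sg P s v⟫_ℂ).re)) := by ring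
    rw [e]
    exact mul_nonpos_of_nonneg_of_nonpos h2.le (by linarith)
  have h3 := hanti ht
  simp only [Sg_zero_apply, mul_zero, neg_zero, Real.exp_zero, one_mul] at h3
  rw [Real.exp_neg, inv_mul_le_iff₀ (Real.exp_pos _)] at h3
  exact h3

lemma Sg_energy {P : H →L[ℂ] H} (v : H) (l : ℝ) :
    ∫ t in (0:ℝ)..l, 2 * (⟪P (Sg P t v), Sg P t v⟫_ℂ).re = ‖v‖^2 - ‖Sg P l v‖^2 := by
  have hc : Continuous (fun t => -2 * (⟪P (Sg P t v), Sg P t v⟫_ℂ).re) := by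
    have := Sg_cont_apply P v
    fun_prop
  have := intervalIntegral.integral_eq_sub_of_hasDerivAt (a := 0) (b := l) (fun t _ => Sg_normsq_deriv P v t) (hc.intervalIntegrable _ _)
  simp only [Sg_zero_apply] at this
  rw [← neg_inj, ← intervalIntegral.integral_neg]
  simp only [← neg_mul]
  rw [this]; ring

lemma Sg_logconv {P : H →L[ℂ] H} (hP : IsSelfAdjoint P) (v : H) (t : ℝ) :
    ‖Sg P t v‖^2 ≤ ‖v‖ * ‖Sg P (2*t) v‖ := by
  have h1 : ⟪Sg P t v, Sg P t v⟫_ℂ = ⟪v, Sg P (2*t) v⟫_ℂ := by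
    rw [Sg_sym hP, ← Sg_add_apply, two_mul]
  have h2 := norm_inner_le_norm (𝕜 := ℂ) v (Sg P (2*t) v)
  rw [← h1, inner_self_eq_norm_sq_to_K] at h2
  simpa using h2

end

section

open scoped ComplexConjugate InnerProductSpace

lemma coordC {d : ℕ} {h : ℝ} {V : (Fin d → ℝ) → ℝ} {P : Hsp d →L[ℂ] Hsp d} (hP : RealizesPh d h V P) (w : Hsp d) (t : ℝ)
    (x : Fin d → ℤ) : HasDerivAt (fun t => (Sg P t w) x) (discLap d h (fun y => (Sg P t w) y) x - (V (pt d h x) : ℂ) * (Sg P t w) x) t := by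
  have h1 := ((lp.evalCLM ℂ (fun _ : (Fin d → ℤ) => ℂ) 2 x).restrictScalars ℝ).hasFDerivAt.comp_hasDerivAt t (Sg_hasDeriv_apply P t w)
  refine HasDerivAt.congr_deriv (f' := (-(P (Sg P t w))) x) h1 ?_
  rw [lp.coeFn_neg, Pi.neg_apply, hP]
  ring

lemma coordRe {d : ℕ} {h : ℝ} {V : (Fin d → ℝ) → ℝ} {P : Hsp d →L[ℂ] Hsp d} (hP : RealizesPh d h V P) (w : Hsp d) (t : ℝ)
    (x : Fin d → ℤ) : HasDerivAt (fun t => ((Sg P t w) x).re) (lapR d h (fun y => ((Sg P t w) y).re) x - V (pt d h x) * ((Sg P t w) x).re) t := by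
  have h1 := Complex.reCLM.hasFDerivAt.comp_hasDerivAt t (coordC hP w t x)
  refine HasDerivAt.congr_deriv h1 ?_
  simp only [Complex.reCLM_apply, discLap, lapR, Complex.sub_re, Complex.re_sum, ← Complex.ofReal_pow, Complex.div_ofReal_re, Complex.re_ofReal_mul, Complex.add_re]
  simp

lemma coordIm {d : ℕ} {h : ℝ} {V : (Fin d → ℝ) → ℝ} {P : Hsp d →L[ℂ] Hsp d} (hP : RealizesPh d h V P) (w : Hsp d) (t : ℝ)
    (x : Fin d → ℤ) : HasDerivAt (fun t => ((Sg P t w) x).im) (lapR d h (fun y => ((Sg P t w) y).im) x - V (pt d h x) * ((Sg P t w) x).im) t := by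
  have h1 := Complex.imCLM.hasFDerivAt.comp_hasDerivAt t (coordC hP w t x)
  refine HasDerivAt.congr_deriv h1 ?_
  simp only [Complex.imCLM_apply, discLap, lapR, Complex.sub_im, Complex.im_sum, ← Complex.ofReal_pow, Complex.div_ofReal_im, Complex.im_ofReal_mul, Complex.add_im]
  simp

def mEnC (d : ℕ) (h : ℝ) (B : Finset (Fin d → ℤ)) (u : (Fin d → ℤ) → ℂ) : ℝ :=
  ∑ x ∈ B, (‖u x‖ ^ 2 + ∑ j, (‖u (x + latE d j) - u x‖^2/h^2 + ‖u (x - latE d j) - u x‖^2/h^2))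

lemma nsq (z : ℂ) : ‖z‖^2 = z.re^2 + z.im^2 := by
  rw [← Complex.normSq_eq_norm_sq, Complex.normSq_apply]; ring

lemma mEnC_eq (d : ℕ) (h : ℝ) (B : Finset (Fin d → ℤ)) (u : (Fin d → ℤ) → ℂ) :
    mEnC d h B u = mEn d h B (fun x => (u x).re) + mEn d h B (fun x => (u x).im) := by
  unfold mEnC mEn
  rw [← Finset.sum_add_distrib]
  refine Finset.sum_congr rfl fun x _ => ?_
  have : ∀ a b c e : ℝ, a + b + (c + e) = (a + c) + (b + e) := fun _ _ _ _ => by ring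
  rw [this, ← Finset.sum_add_distrib, nsq]
  congr 1
  refine Finset.sum_congr rfl fun j _ => ?_
  rw [nsq, nsq]
  simp only [Complex.sub_re, Complex.sub_im]
  ring

lemma mEnC_le {d : ℕ} {h : ℝ} {V : (Fin d → ℝ) → ℝ} {P : Hsp d →L[ℂ] Hsp d} {v0 : ℝ} (hP : RealizesPh d h V P)
    (hV : ∀ x, |V x| ≤ v0) (v : Hsp d) (Y : Finset (Fin d → ℤ)) (hh : 0 < h) :
    mEnC d h Y (fun x => v x) ≤ (1 + 2*v0) * ‖v‖^2 + 2 * (⟪P v, v⟫_ℂ).re := by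
  unfold mEnC
  simp only [Finset.sum_add_distrib]
  have h1 : ∑ x ∈ Y, ‖v x‖^2 ≤ ‖v‖^2 := sum_le_hasSum Y (fun x _ => sq_nonneg _) (hs_norm v)
  have h2 := P_low hP hV v Y hh
  have h3 : ∑ x ∈ Y, ∑ j, ‖v (x - latE d j) - v x‖^2/h^2 ≤ (⟪P v, v⟫_ℂ).re + v0 * ‖v‖^2 := by
    obtain ⟨N, w, g1, g2, -, g4⟩ := inner_P hP hV v
    rw [g4, Complex.ofReal_re, Finset.sum_comm]
    have : ∑ j, ∑ x ∈ Y, ‖v (x - latE d j) - v x‖^2/h^2 ≤ (∑ j, N j)/h^2 := by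
      rw [Finset.sum_div]
      refine Finset.sum_le_sum fun j _ => ?_
      rw [← Finset.sum_div]
      gcongr
      have g5 : HasSum (fun x => ‖v (x - latE d j) - v x‖^2) (N j) := by
        have := (Equiv.subRight (latE d j)).hasSum_iff (f := fun x => ‖v (x + latE d j) - v x‖^2) |>.2 (g2 j)
        have e : (fun x => ‖v (x - latE d j) - v x‖^2) = ((fun x => ‖v (x + latE d j) - v x‖^2) ∘ (Equiv.subRight (latE d j))) := by
          funext x
          simp only [Function.comp, Equiv.subRight_apply, sub_add_cancel]
          rw [norm_sub_rev]
        rw [e]; exact this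
      exact sum_le_hasSum Y (fun x _ => sq_nonneg _) g5
    linarith [(abs_le.1 g1).1]
  linarith

lemma overlap {d : ℕ} {L R h : ℝ} (hL : 0 < L) (N : ℕ) (hN : 2*R/L ≤ N) (Ks : Finset (Fin d → ℤ))
    (B : (Fin d → ℤ) → Finset (Fin d → ℤ)) (hB : ∀ k, ∀ x ∈ B k, ∀ j, |L * k j - h * x j| ≤ R)
    (f : (Fin d → ℤ) → ℝ) (hf : ∀ x, 0 ≤ f x) :
    ∑ k ∈ Ks, ∑ x ∈ B k, f x ≤ ((N:ℝ)+1)^d * ∑ x ∈ Ks.biUnion B, f x := by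
  classical
  have h1 : ∑ k ∈ Ks, ∑ x ∈ B k, f x = ∑ x ∈ Ks.biUnion B, ∑ k ∈ Ks with x ∈ B k, f x := by
    apply Finset.sum_comm'
    intro k x
    simp only [Finset.mem_biUnion, Finset.mem_filter]
    constructor
    · rintro ⟨a, b⟩; exact ⟨⟨a, b⟩, k, a, b⟩
    · rintro ⟨⟨a, b⟩, -⟩; exact ⟨a, b⟩
  rw [h1, Finset.mul_sum]
  refine Finset.sum_le_sum fun x _ => ?_
  rw [Finset.sum_const, nsmul_eq_mul]
  refine mul_le_mul_of_nonneg_right ?_ (hf x)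
  have hsub : (Ks.filter fun k => x ∈ B k) ⊆ Fintype.piFinset fun j => Finset.Icc ⌈(h * x j - R)/L⌉ ⌊(h * x j + R)/L⌋ := by
    intro k hk
    simp only [Finset.mem_filter] at hk
    simp only [Fintype.mem_piFinset, Finset.mem_Icc, Int.ceil_le, Int.le_floor]
    intro j
    have := abs_le.1 (hB k x hk.2 j)
    rw [div_le_iff₀ hL, le_div_iff₀ hL]
    constructor <;> linarith
  have h2 := Finset.card_le_card hsub
  rw [Fintype.card_piFinset] at h2
  have h3 : ∏ j, (Finset.Icc ⌈(h * x j - R)/L⌉ ⌊(h * x j + R)/L⌋).card ≤ (N+1)^d := by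
    have := Finset.prod_le_pow_card (Finset.univ : Finset (Fin d)) (fun j => (Finset.Icc ⌈(h * x j - R)/L⌉ ⌊(h * x j + R)/L⌋).card) (N+1) ?_
    · simpa using this
    · intro j _
      rw [Int.card_Icc]
      have g1 : ((⌊(h * x j + R)/L⌋ : ℤ) : ℝ) ≤ (h * x j + R)/L := Int.floor_le _
      have g2 : (h * x j - R)/L ≤ ((⌈(h * x j - R)/L⌉ : ℤ) : ℝ) := Int.le_ceil _
      have g3 : (h * x j + R)/L - (h * x j - R)/L = 2*R/L := by ring
      have g4 : ((⌊(h * x j + R)/L⌋ - ⌈(h * x j - R)/L⌉ : ℤ) : ℝ) ≤ ((N:ℤ):ℝ) := by push_cast; linarith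
      have g5 := Int.cast_le.1 g4
      omega
  have := h2.trans h3
  exact_mod_cast this

lemma local_C (d : ℕ) (L γ v0 : ℝ) (hL : 0 < L) (hγ : 0 < γ) :
    ∃ a > (0:ℝ), ∃ ac > (0:ℝ), ∃ Cc > (0:ℝ), ∃ c1 > (0:ℝ), ∃ ℓ0 > (0:ℝ), ℓ0 ≤ 1 ∧ c1 ≤ 1 ∧
      ∀ h ℓ : ℝ, 0 < h → 0 < ℓ → ℓ ≤ ℓ0 → h ≤ c1 * ℓ → ∀ (z : Fin d → ℝ) (V : (Fin d → ℝ) → ℝ) (P : Hsp d →L[ℂ] Hsp d)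
        (w : Hsp d) (B A : Finset (Fin d → ℤ)), RealizesPh d h V P → (∀ x, |V x| ≤ v0) →
        (∀ x, x ∈ B ↔ ∀ j, |h * x j - z j| ≤ ac) →
        (∀ x ∈ A, ∀ j, |h * x j - z j| ≤ L) →
        ∑ x ∈ A, ‖(Sg P ℓ w) x‖^2 ≤ 2 * Real.exp (a/ℓ) * ∑ x ∈ B with (∀ j, |h * x j - z j| ≤ γ * L/2), ‖(Sg P ℓ w) x‖^2
          + Cc * Real.exp (-10*a/ℓ) * ∫ t in (0:ℝ)..ℓ, mEnC d h B (fun x => (Sg P t w) x) := by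
  obtain ⟨a, ha, ac, hac, Cc, hCc, c1, hc1, ℓ0, hℓ0, hℓ1, hc11, H⟩ := local_param d L γ v0 hL hγ
  refine ⟨a, ha, ac, hac, Cc, hCc, c1, hc1, ℓ0, hℓ0, hℓ1, hc11, ?_⟩
  intro h ℓ hh hℓ hℓl hhl z V P w B A hP hV hB hA
  have h1 := H h ℓ hh hℓ hℓl hhl z (fun x => V (pt d h x)) (fun t x => ((Sg P t w) x).re) B A (fun x => hV _) (fun t x => coordRe hP w t x) hB hA
  have h2 := H h ℓ hh hℓ hℓl hhl z (fun x => V (pt d h x)) (fun t x => ((Sg P t w) x).im) B A (fun x => hV _) (fun t x => coordIm hP w t x) hB hA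
  have c1 : Continuous fun t => mEn d h B (fun x => ((Sg P t w) x).re) :=
    mEn_cont (u := fun t x => ((Sg P t w) x).re) fun x => continuous_iff_continuousAt.2 fun t => (coordRe hP w t x).continuousAt
  have c2 : Continuous fun t => mEn d h B (fun x => ((Sg P t w) x).im) :=
    mEn_cont (u := fun t x => ((Sg P t w) x).im) fun x => continuous_iff_continuousAt.2 fun t => (coordIm hP w t x).continuousAt
  simp only [mEnC_eq, nsq, Finset.sum_add_distrib]
  rw [intervalIntegral.integral_add (c1.intervalIntegrable _ _) (c2.intervalIntegrable _ _)]
  linarith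

end

section

open scoped ComplexConjugate InnerProductSpace

lemma exists_Q (d : ℕ) (S : Set (Fin d → ℤ)) : ∃ Q : Hsp d →L[ℂ] Hsp d, (∀ v x, (Q v) x = S.indicator (fun x => v x) x) ∧
    (∀ v w, ⟪Q v, w⟫_ℂ = ⟪v, Q w⟫_ℂ) ∧ (∀ v, Q (Q v) = Q v) := by
  classical
  have hm : ∀ v : Hsp d, Memℓp (fun x => S.indicator (fun x => v x) x) 2 := by
    intro v
    refine memℓp_gen ?_
    have h1 := (hs_norm v).summable
    refine Summable.of_nonneg_of_le (fun x => by positivity) (fun x => ?_) h1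
    simp only [ENNReal.toReal_ofNat, Real.rpow_ofNat]
    exact pow_le_pow_left₀ (norm_nonneg _) (norm_indicator_le_norm_self _ _) 2
  let Ql : Hsp d →ₗ[ℂ] Hsp d :=
    { toFun := fun v => ⟨fun x => S.indicator (fun x => v x) x, hm v⟩
      map_add' := fun v w => by
        ext x
        simp only [lp.coeFn_add, Pi.add_apply]
        exact congrFun (Set.indicator_add S (fun x => v x) (fun x => w x)) x
      map_smul' := fun c v => by
        ext x
        simp only [lp.coeFn_smul, Pi.smul_apply]
        exact congrFun (Set.indicator_const_smul S c (fun x => v x)) x }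
  have hQl : ∀ v x, (Ql v) x = S.indicator (fun x => v x) x := fun v x => rfl
  let Q : Hsp d →L[ℂ] Hsp d := Ql.mkContinuous 1 (fun v => by
    rw [one_mul]
    have h1 := hasSum_le (fun x => ?_) (hs_norm (Ql v)) (hs_norm v)
    · exact le_of_sq_le_sq h1 (norm_nonneg _)
    · rw [hQl]
      exact pow_le_pow_left₀ (norm_nonneg _) (norm_indicator_le_norm_self _ _) 2)
  have hQ : ∀ v x, (Q v) x = S.indicator (fun x => v x) x := fun v x => rfl
  refine ⟨Q, hQ, ?_, ?_⟩
  · intro v w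
    have h1 := lp.hasSum_inner (𝕜 := ℂ) (Q v) w
    have h2 := lp.hasSum_inner (𝕜 := ℂ) v (Q w)
    have e : (fun i => ⟪(Q v) i, w i⟫_ℂ) = fun i => ⟪v i, (Q w) i⟫_ℂ := by
      funext i
      rw [hQ, hQ]
      by_cases hi : i ∈ S <;> simp [hi]
    rw [e] at h1
    exact h1.unique h2
  · intro v
    ext x
    rw [hQ, hQ]
    by_cases hi : x ∈ S
    · simp only [hi, Set.indicator_of_mem]; rw [hQ]; simp [hi]
    · simp [hi]

lemma round_near {L : ℝ} (hL : 0 < L) (y : ℝ) : |y - L * (round (y/L) : ℝ)| ≤ L/2 := by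
  have h1 := abs_sub_round (y/L)
  have h2 : y - L * (round (y/L) : ℝ) = L * (y/L - round (y/L)) := by field_simp
  rw [h2, abs_mul, abs_of_pos hL]
  nlinarith

theorem interp (d : ℕ) (L γ v0 : ℝ) (ω : Set (Fin d → ℝ)) (hv0 : 0 ≤ v0) (hω : Equidistributed d L γ ω) :
    ∃ a > (0:ℝ), ∃ c1 > (0:ℝ), ∃ ℓ0 > (0:ℝ), ℓ0 ≤ 1 ∧ c1 ≤ 1 ∧
      ∀ h ℓ : ℝ, 0 < h → 0 < ℓ → ℓ ≤ ℓ0 → h ≤ c1 * ℓ → ∀ (V : (Fin d → ℝ) → ℝ) (P Q : Hsp d →L[ℂ] Hsp d)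
        (w : Hsp d), RealizesPh d h V P → (∀ x, |V x| ≤ v0) →
        (∀ v x, (Q v) x = {x | pt d h x ∈ ω}.indicator (fun x => v x) x) →
        ‖Sg P ℓ w‖^2 ≤ Real.exp (2*a/ℓ) * ‖Q (Sg P ℓ w)‖^2 + Real.exp (-9*a/ℓ) * ‖w‖^2 := by
  classical
  obtain ⟨hL, hγ, hγ1, z, hz⟩ := hω
  obtain ⟨a, ha, ac, hac, Cc, hCc, c1, hc1, ℓ0, hℓ0, hℓ1, hc11, H⟩ := local_C d L γ v0 hL hγ
  obtain ⟨N, hN⟩ := exists_nat_ge (2*(ac + L/2)/L)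
  obtain ⟨M, hM⟩ : ∃ M : ℝ, M = ((N:ℝ)+1)^d := ⟨_, rfl⟩
  have hM0 : 0 < M := by rw [hM]; positivity
  obtain ⟨C', hC'⟩ : ∃ C' : ℝ, C' = (1+2*v0) * Real.exp (2*v0) + 1 := ⟨_, rfl⟩
  have hC'0 : 0 < C' := by rw [hC']; positivity
  obtain ⟨D, hD⟩ : ∃ D : ℝ, D = 2*M + Cc * M * C' := ⟨_, rfl⟩
  have hD0 : 0 < D := by rw [hD]; positivity
  refine ⟨a, ha, c1, hc1, min ℓ0 (a/D), by positivity, (min_le_left _ _).trans hℓ1, hc11, ?_⟩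
  intro h ℓ hh hℓ hℓl hhl V P Q w hP hV hQ
  have hl1 := hℓl.trans (min_le_left _ _)
  have hl2 := hℓl.trans (min_le_right _ _)
  have hzk : ∀ k j, |z k j - L * k j| ≤ L/2 := by
    intro k j
    have : z k ∈ {x : Fin d → ℝ | ∀ i, |x i - z k i| ≤ γ * L / 2} := by
      simp only [Set.mem_setOf_eq, sub_self, abs_zero]; intro i; positivity
    exact (hz k this).2 j
  let kk : (Fin d → ℤ) → (Fin d → ℤ) := fun x j => round (h * x j / L)
  let B : (Fin d → ℤ) → Finset (Fin d → ℤ) := fun k => Fintype.piFinset fun j => Finset.Icc ⌈(z k j - ac)/h⌉ ⌊(z k j + ac)/h⌋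
  have hB : ∀ k x, x ∈ B k ↔ ∀ j, |h * x j - z k j| ≤ ac := by
    intro k x
    simp only [B, Fintype.mem_piFinset, Finset.mem_Icc, Int.ceil_le, Int.le_floor]
    refine forall_congr' fun j => ?_
    rw [div_le_iff₀ hh, le_div_iff₀ hh, abs_le]
    constructor
    · rintro ⟨h1, h2⟩; constructor <;> linarith
    · rintro ⟨h1, h2⟩; constructor <;> linarith
  have hBo : ∀ k, ∀ x ∈ B k, ∀ j, |L * k j - h * x j| ≤ ac + L/2 := by
    intro k x hx j
    have h1 := abs_le.1 ((hB k x).1 hx j)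
    have h2 := abs_le.1 (hzk k j)
    rw [abs_le]; constructor <;> linarith
  have hexp : D ≤ Real.exp (a/ℓ) := by
    have h1 : D ≤ a/ℓ := by
      rw [le_div_iff₀ hℓ]
      rw [le_div_iff₀ hD0] at hl2; linarith
    linarith [Real.add_one_le_exp (a/ℓ)]
  have hlow : ∀ v, -(v0 * ‖v‖^2) ≤ (⟪P v, v⟫_ℂ).re := fun v => by
    have := P_low hP hV v ∅ hh
    simp only [Finset.sum_empty] at this; linarith
  have hcu := Sg_cont_apply P w
  have hcm : ∀ Y, Continuous fun t => mEnC d h Y (fun x => (Sg P t w) x) := by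
    intro Y
    simp only [mEnC_eq]
    exact (mEn_cont (u := fun t x => ((Sg P t w) x).re) fun x => continuous_iff_continuousAt.2 fun t => (coordRe hP w t x).continuousAt).add 
      (mEn_cont (u := fun t x => ((Sg P t w) x).im) fun x => continuous_iff_continuousAt.2 fun t => (coordIm hP w t x).continuousAt)
  have hcP : Continuous fun t => (⟪P (Sg P t w), Sg P t w⟫_ℂ).re := by fun_prop
  have key : ∀ X : Finset (Fin d → ℤ), ∑ x ∈ X, ‖(Sg P ℓ w) x‖^2 ≤
      2 * Real.exp (a/ℓ) * (M * ‖Q (Sg P ℓ w)‖^2) + Cc * Real.exp (-10*a/ℓ) * (M * (C' * ‖w‖^2)) := by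
    intro X
    have h1 : ∑ x ∈ X, ‖(Sg P ℓ w) x‖^2 = ∑ k ∈ X.image kk, ∑ x ∈ X with kk x = k, ‖(Sg P ℓ w) x‖^2 :=
      (Finset.sum_fiberwise_of_maps_to (fun x hx => Finset.mem_image_of_mem kk hx) _).symm
    have h2 : ∀ k ∈ X.image kk, ∑ x ∈ X with kk x = k, ‖(Sg P ℓ w) x‖^2 ≤ 
        2 * Real.exp (a/ℓ) * ∑ x ∈ B k with (∀ j, |h * x j - z k j| ≤ γ * L/2), ‖(Sg P ℓ w) x‖^2
          + Cc * Real.exp (-10*a/ℓ) * ∫ t in (0:ℝ)..ℓ, mEnC d h (B k) (fun x => (Sg P t w) x) := by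
      intro k _
      refine H h ℓ hh hℓ hl1 hhl (z k) V P w (B k) _ hP hV (hB k) ?_
      intro x hx j
      simp only [Finset.mem_filter] at hx
      have g1 := round_near hL (h * x j)
      have g2 : (round (h * x j / L) : ℤ) = k j := by rw [← hx.2]
      rw [g2] at g1
      have g1 := abs_le.1 g1
      have g3 := abs_le.1 (hzk k j)
      rw [abs_le]; constructor <;> linarith
    rw [h1]
    refine (Finset.sum_le_sum h2).trans ?_
    rw [Finset.sum_add_distrib, ← Finset.mul_sum, ← Finset.mul_sum]
    have h3 : ∑ k ∈ X.image kk, ∑ x ∈ B k with (∀ j, |h * x j - z k j| ≤ γ * L/2), ‖(Sg P ℓ w) x‖^2 ≤ M * ‖Q (Sg P ℓ w)‖^2 := by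
      rw [hM]
      refine (overlap (h := h) hL N hN (X.image kk) (fun k => (B k).filter fun x => ∀ j, |h * x j - z k j| ≤ γ * L/2) ?_ (fun x => ‖(Sg P ℓ w) x‖^2) (fun x => sq_nonneg _)).trans ?_
      · intro k x hx
        exact hBo k x (Finset.mem_filter.1 hx).1
      · refine mul_le_mul_of_nonneg_left ?_ (by positivity)
        refine le_trans (Finset.sum_le_sum fun x hx => ?_) (sum_le_hasSum _ (fun x _ => sq_nonneg _) (hs_norm (Q (Sg P ℓ w))))
        simp only [Finset.mem_biUnion, Finset.mem_filter] at hx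
        obtain ⟨k, -, -, hx⟩ := hx
        rw [hQ, Set.indicator_of_mem]
        exact (hz k (by simpa [pt] using hx)).1
    have h4 : ∑ k ∈ X.image kk, ∫ t in (0:ℝ)..ℓ, mEnC d h (B k) (fun x => (Sg P t w) x) ≤ M * (C' * ‖w‖^2) := by
      rw [← intervalIntegral.integral_finsetSum (fun k _ => (hcm (B k)).intervalIntegrable _ _)]
      have g1 : ∀ t ∈ Set.Icc (0:ℝ) ℓ, ∑ k ∈ X.image kk, mEnC d h (B k) (fun x => (Sg P t w) x) ≤ 
          M * ((1+2*v0) * (Real.exp (2*v0) * ‖w‖^2) + 2 * (⟪P (Sg P t w), Sg P t w⟫_ℂ).re) := by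
        intro t ht
        have := overlap (h := h) hL N hN (X.image kk) B hBo (fun x => ‖(Sg P t w) x‖ ^ 2 + ∑ j, (‖(Sg P t w) (x + latE d j) - (Sg P t w) x‖^2/h^2 + ‖(Sg P t w) (x - latE d j) - (Sg P t w) x‖^2/h^2)) (fun x => by positivity)
        refine this.trans ?_
        rw [hM]
        refine mul_le_mul_of_nonneg_left ?_ (by positivity)
        refine (mEnC_le hP hV (Sg P t w) _ hh).trans ?_
        have g2 := Sg_bound hlow w ht.1
        have g3 : Real.exp (2*v0*t) ≤ Real.exp (2*v0) := Real.exp_le_exp.2 (mul_le_of_le_one_right (by linarith) (ht.2.trans (hl1.trans hℓ1)))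
        have g4 : ‖Sg P t w‖^2 ≤ Real.exp (2*v0) * ‖w‖^2 := g2.trans (mul_le_mul_of_nonneg_right g3 (sq_nonneg _))
        have g5 := mul_le_mul_of_nonneg_left g4 (by linarith : 0 ≤ 1+2*v0)
        linarith
      refine (intervalIntegral.integral_mono_on hℓ.le (Continuous.intervalIntegrable (continuous_finsetSum _ fun k _ => hcm (B k)) _ _) (Continuous.intervalIntegrable (by fun_prop) _ _) g1).trans ?_
      rw [intervalIntegral.integral_const_mul, intervalIntegral.integral_add (Continuous.intervalIntegrable (by fun_prop) _ _) (Continuous.intervalIntegrable (by fun_prop) _ _), Sg_energy]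
      refine mul_le_mul_of_nonneg_left ?_ hM0.le
      rw [intervalIntegral.integral_const, sub_zero, smul_eq_mul, hC']
      have g6 : ℓ * ((1+2*v0) * (Real.exp (2*v0) * ‖w‖^2)) ≤ 1 * ((1+2*v0) * (Real.exp (2*v0) * ‖w‖^2)) :=
        mul_le_mul_of_nonneg_right (hl1.trans hℓ1) (by positivity)
      linarith [sq_nonneg ‖Sg P ℓ w‖]
    exact add_le_add (mul_le_mul_of_nonneg_left h3 (by positivity)) (mul_le_mul_of_nonneg_left h4 (by positivity))
  have h5 := hasSum_le_of_sum_le (hs_norm (Sg P ℓ w)) key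
  refine h5.trans (add_le_add ?_ ?_)
  · have : Real.exp (2*a/ℓ) = Real.exp (a/ℓ) * Real.exp (a/ℓ) := by rw [← Real.exp_add]; congr 1; ring
    rw [this]
    have h6 : 2 * M ≤ Real.exp (a/ℓ) := le_trans (by rw [hD]; linarith [mul_pos (mul_pos hCc hM0) hC'0]) hexp
    have h7 := mul_le_mul_of_nonneg_right h6 (by positivity : 0 ≤ Real.exp (a/ℓ) * ‖Q (Sg P ℓ w)‖^2)
    linarith
  · have : Real.exp (-9*a/ℓ) = Real.exp (a/ℓ) * Real.exp (-10*a/ℓ) := by rw [← Real.exp_add]; congr 1; ring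
    rw [this]
    have h6 : Cc * M * C' ≤ Real.exp (a/ℓ) := le_trans (by rw [hD]; linarith) hexp
    have h7 := mul_le_mul_of_nonneg_right h6 (by positivity : 0 ≤ Real.exp (-10*a/ℓ) * ‖w‖^2)
    linarith

end

section

open scoped ComplexConjugate InnerProductSpace

variable {H : Type*} [NormedAddCommGroup H] [InnerProductSpace ℂ H] [CompleteSpace H]

lemma Sg_bound2 {P : H →L[ℂ] H} {v0 : ℝ} (hlow : ∀ v, -(v0 * ‖v‖^2) ≤ (⟪P v, v⟫_ℂ).re) (v : H) {s t : ℝ} (hst : s ≤ t) :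
    ‖Sg P t v‖^2 ≤ Real.exp (2*v0*(t-s)) * ‖Sg P s v‖^2 := by
  have := Sg_bound hlow (Sg P s v) (sub_nonneg.2 hst)
  rwa [← Sg_add_apply, sub_add_cancel] at this

lemma avg_step {P Q : H →L[ℂ] H} {v0 a ℓ : ℝ} (hv0 : 0 ≤ v0) (hlow : ∀ v, -(v0 * ‖v‖^2) ≤ (⟪P v, v⟫_ℂ).re)
    (ha : 0 < a) (hℓ : 0 < ℓ) (hℓ1 : ℓ ≤ 1) (hℓ2 : ℓ ≤ a^2/8) (hℓ3 : 4*v0*ℓ ≤ a)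
    (hI : ∀ w, ‖Sg P ℓ w‖^2 ≤ Real.exp (2*a/ℓ) * ‖Q (Sg P ℓ w)‖^2 + Real.exp (-9*a/ℓ) * ‖w‖^2) (t0 : ℝ) (v : H) :
    ‖Sg P (t0+2*ℓ) v‖^2 ≤ Real.exp (3*a/ℓ) * (∫ τ in t0..(t0+2*ℓ), ‖Q (Sg P τ v)‖^2) + Real.exp (-8*a/ℓ) * ‖Sg P t0 v‖^2 := by
  have hcu := Sg_cont_apply P v
  have hq : Continuous fun τ => ‖Q (Sg P τ v)‖^2 := (Q.continuous.comp hcu).norm.pow 2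
  have h1 : ∀ τ ∈ Set.Icc (t0+ℓ) (t0+2*ℓ), ‖Sg P (t0+2*ℓ) v‖^2 ≤
      Real.exp (2*v0*ℓ) * Real.exp (2*a/ℓ) * ‖Q (Sg P τ v)‖^2 + Real.exp (4*v0*ℓ) * Real.exp (-9*a/ℓ) * ‖Sg P t0 v‖^2 := by
    intro τ hτ
    have g1 := hI (Sg P (τ-ℓ) v)
    rw [← Sg_add_apply, show ℓ + (τ - ℓ) = τ by ring] at g1
    have g2 := Sg_bound2 hlow v hτ.2
    have g3 := Sg_bound2 hlow v (by linarith [hτ.1] : t0 ≤ τ - ℓ)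
    have g4 : Real.exp (2*v0*(t0+2*ℓ-τ)) ≤ Real.exp (2*v0*ℓ) := Real.exp_le_exp.2 (by nlinarith [hτ.1])
    have g5 : Real.exp (2*v0*(τ-ℓ-t0)) ≤ Real.exp (2*v0*ℓ) := Real.exp_le_exp.2 (by nlinarith [hτ.2])
    have e : Real.exp (4*v0*ℓ) = Real.exp (2*v0*ℓ) * Real.exp (2*v0*ℓ) := by rw [← Real.exp_add]; congr 1; ring
    rw [e]
    calc _ ≤ Real.exp (2*v0*ℓ) * ‖Sg P τ v‖^2 := g2.trans (by gcongr)
      _ ≤ Real.exp (2*v0*ℓ) * (Real.exp (2*a/ℓ) * ‖Q (Sg P τ v)‖^2 + Real.exp (-9*a/ℓ) * (Real.exp (2*v0*ℓ) * ‖Sg P t0 v‖^2)) := by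
          gcongr
          refine g1.trans ?_
          gcongr
          exact g3.trans (by gcongr)
      _ = _ := by ring
  have h2 := intervalIntegral.integral_mono_on (μ := volume) (by linarith : t0+ℓ ≤ t0+2*ℓ) (Continuous.intervalIntegrable (by fun_prop) _ _) (Continuous.intervalIntegrable (by fun_prop) _ _) h1
  rw [intervalIntegral.integral_add (Continuous.intervalIntegrable (by fun_prop) _ _) (Continuous.intervalIntegrable (by fun_prop) _ _),
    intervalIntegral.integral_const_mul, intervalIntegral.integral_const, intervalIntegral.integral_const, smul_eq_mul, smul_eq_mul] at h2
  have h3 : (∫ τ in (t0+ℓ)..(t0+2*ℓ), ‖Q (Sg P τ v)‖^2) ≤ ∫ τ in t0..(t0+2*ℓ), ‖Q (Sg P τ v)‖^2 :=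
    intervalIntegral.integral_mono_interval (by linarith) (by linarith) le_rfl (Filter.Eventually.of_forall fun τ => sq_nonneg _) (hq.intervalIntegrable _ _)
  set I := ∫ τ in t0..(t0+2*ℓ), ‖Q (Sg P τ v)‖^2 with hIdef
  have hI0 : 0 ≤ I := intervalIntegral.integral_nonneg (by linarith) fun _ _ => sq_nonneg _
  have e1 : t0 + 2*ℓ - (t0+ℓ) = ℓ := by ring
  rw [e1] at h2
  have x1 : 1 / ℓ ≤ Real.exp (a/(2*ℓ)) := by
    have := Real.quadratic_le_exp_of_nonneg (by positivity : 0 ≤ a/(2*ℓ))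
    have h5 : 1/ℓ ≤ (a/(2*ℓ))^2/2 := by
      rw [div_pow, div_div, div_le_div_iff₀ hℓ (by positivity)]; nlinarith
    have : 0 ≤ a/(2*ℓ) := by positivity
    linarith
  have x2 : 4*v0*ℓ ≤ a/ℓ := by
    rw [le_div_iff₀ hℓ]
    have := mul_le_mul_of_nonneg_left hℓ1 (by positivity : 0 ≤ 4*v0*ℓ)
    linarith
  have y1 : Real.exp (2*v0*ℓ) * Real.exp (2*a/ℓ) / ℓ ≤ Real.exp (3*a/ℓ) := by
    have : Real.exp (3*a/ℓ) = Real.exp (a/(2*ℓ)) * Real.exp (2*a/ℓ) * Real.exp (a/(2*ℓ)) := by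
      rw [← Real.exp_add, ← Real.exp_add]; congr 1; field_simp; ring
    rw [this, div_eq_mul_one_div]
    have : Real.exp (2*v0*ℓ) ≤ Real.exp (a/(2*ℓ)) := Real.exp_le_exp.2 (by
      have : a/(2*ℓ) = a/ℓ/2 := by field_simp
      linarith)
    gcongr
  have y2 : Real.exp (4*v0*ℓ) * Real.exp (-9*a/ℓ) ≤ Real.exp (-8*a/ℓ) := by
    rw [← Real.exp_add]
    refine Real.exp_le_exp.2 ?_
    have : -8*a/ℓ = a/ℓ + -9*a/ℓ := by ring
    linarith
  have h4 : ‖Sg P (t0+2*ℓ) v‖^2 ≤ Real.exp (2*v0*ℓ) * Real.exp (2*a/ℓ) / ℓ * I + Real.exp (4*v0*ℓ) * Real.exp (-9*a/ℓ) * ‖Sg P t0 v‖^2 := by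
    have h5 : ℓ * ‖Sg P (t0+2*ℓ) v‖^2 ≤ ℓ * (Real.exp (2*v0*ℓ) * Real.exp (2*a/ℓ) / ℓ * I + Real.exp (4*v0*ℓ) * Real.exp (-9*a/ℓ) * ‖Sg P t0 v‖^2) := by
      have : ℓ * (Real.exp (2*v0*ℓ) * Real.exp (2*a/ℓ) / ℓ * I + Real.exp (4*v0*ℓ) * Real.exp (-9*a/ℓ) * ‖Sg P t0 v‖^2) 
        = Real.exp (2*v0*ℓ) * Real.exp (2*a/ℓ) * I + ℓ * (Real.exp (4*v0*ℓ) * Real.exp (-9*a/ℓ) * ‖Sg P t0 v‖^2) := by field_simp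
      rw [this]
      refine h2.trans ?_
      gcongr
    exact le_of_mul_le_mul_left h5 hℓ
  refine h4.trans ?_
  gcongr

set_option maxHeartbeats 1000000 in
lemma regA {y q : ℝ → ℝ} (hq : Continuous q) (hq0 : ∀ t, 0 ≤ q t) (hy0 : ∀ t, 0 ≤ y t) {a κ ℓ1 T : ℝ} (ha : 0 < a) (hκ : 0 < κ) (hℓa : ℓ1 ≤ a)
    (hT0 : 0 < T) (hT : 8*κ ≤ T) (hTl : T ≤ ℓ1)
    (hII : ∀ ℓ, κ ≤ ℓ → ℓ ≤ ℓ1 → ∀ t0, y (t0+2*ℓ) ≤ Real.exp (3*a/ℓ) * (∫ τ in t0..(t0+2*ℓ), q τ) + Real.exp (-8*a/ℓ) * y t0)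
    (hlip : ∀ t ≤ T, 0 ≤ t → y T ≤ 4 * y t) :
    y T ≤ Real.exp (35*a/T) * (∫ τ in (0:ℝ)..T, q τ) + 4 * Real.exp (-(a*T/(2*κ^2))) * y 0 := by
  obtain ⟨J, hJ1, hJ2⟩ := exists_nat_pow_near (x := T/(8*κ)) (y := 2) (by rw [le_div_iff₀ (by positivity)]; linarith) (by norm_num)
  obtain ⟨l, hl⟩ : ∃ l, l = T/2^J/8 := ⟨_, rfl⟩
  have hJ0 : (0:ℝ) < 2^J := by positivity
  have hl0 : 0 < l := by rw [hl]; positivity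
  have hlT : 2^J * l = T/8 := by rw [hl]; field_simp
  have hl1 : κ ≤ l := by
    rw [hl, div_div, le_div_iff₀ (by positivity)]
    rw [le_div_iff₀ (by positivity)] at hJ1; linarith
  have hl2 : l ≤ 2*κ := by
    rw [hl, div_div, div_le_iff₀ (by positivity)]
    rw [div_lt_iff₀ (by positivity), pow_succ] at hJ2; linarith
  set O := ∫ τ in (0:ℝ)..T, q τ with hO
  have hO0 : 0 ≤ O := intervalIntegral.integral_nonneg hT0.le fun _ _ => hq0 _
  have hsub : ∀ s t, 0 ≤ s → s ≤ t → t ≤ T → ∫ τ in s..t, q τ ≤ O := fun s t h1 h2 h3 =>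
    intervalIntegral.integral_mono_interval h1 h2 h3 (Filter.Eventually.of_forall fun τ => hq0 _) (hq.intervalIntegrable _ _)
  have hexp2 : ∀ ℓ, 0 < ℓ → ℓ ≤ ℓ1 → 2 ≤ Real.exp (a/ℓ) := by
    intro ℓ h1 h2
    have : 1 ≤ a/ℓ := by rw [le_div_iff₀ h1]; linarith
    linarith [Real.add_one_le_exp (a/ℓ)]
  have hpow1 : (1:ℝ) ≤ 2^J := one_le_pow₀ (by norm_num)
  have hll1 : l ≤ ℓ1 := by nlinarith
  -- phase 1
  have ph1 : ∀ n : ℕ, 2*l*n ≤ T → y (2*l*n) ≤ 2 * Real.exp (3*a/l) * O + Real.exp (-8*a/l)^n * y 0 := by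
    intro n
    induction n with
    | zero => intro _; simp; positivity
    | succ n ih =>
      intro hn
      push_cast at hn
      have ih := ih (by nlinarith)
      have h1 := hII l hl1 hll1 (2*l*n)
      have e1 : 2*l*n + 2*l = 2*l*((n+1:ℕ):ℝ) := by push_cast; ring
      rw [e1] at h1
      have h2 := hsub (2*l*n) (2*l*((n+1:ℕ):ℝ)) (by positivity) (by push_cast; nlinarith) (by push_cast; linarith)
      have h3 : Real.exp (-8*a/l) * 2 ≤ 1 := by
        have := hexp2 l hl0 hll1
        have h4 : Real.exp (-8*a/l) ≤ Real.exp (-(a/l)) := Real.exp_le_exp.2 (by 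
          have : 0 < a/l := by positivity
          have : -8*a/l = -8 * (a/l) := by ring
          linarith)
        rw [Real.exp_neg] at h4
        have : (Real.exp (a/l))⁻¹ ≤ 2⁻¹ := by gcongr
        linarith
      calc _ ≤ Real.exp (3*a/l) * O + Real.exp (-8*a/l) * (2 * Real.exp (3*a/l) * O + Real.exp (-8*a/l)^n * y 0) := h1.trans (by gcongr)
        _ = Real.exp (3*a/l) * O + (Real.exp (-8*a/l) * 2) * (Real.exp (3*a/l) * O) + Real.exp (-8*a/l)^(n+1) * y 0 := by ring
        _ ≤ Real.exp (3*a/l) * O + 1 * (Real.exp (3*a/l) * O) + Real.exp (-8*a/l)^(n+1) * y 0 := by gcongr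
        _ = _ := by ring
  have ph1' : y (T/2) ≤ 2 * Real.exp (3*a/l) * O + Real.exp (-(a*T/(2*κ^2))) * y 0 := by
    have e1 : 2*l*((2^(J+1):ℕ):ℝ) = T/2 := by push_cast; rw [pow_succ]; linarith
    have h1 := ph1 (2^(J+1)) (by rw [e1]; linarith)
    rw [e1] at h1
    refine h1.trans ?_
    have h2 : Real.exp (-8*a/l)^(2^(J+1)) ≤ Real.exp (-(a*T/(2*κ^2))) := by
      rw [← Real.exp_nat_mul]
      refine Real.exp_le_exp.2 ?_
      push_cast
      have e2 : (2:ℝ)^(J+1) = T/(4*l) := by rw [eq_div_iff (by positivity), pow_succ]; linarith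
      rw [e2]
      have e3 : T/(4*l) * (-8*a/l) = -(2*a*T/l^2) := by field_simp; ring
      rw [e3, neg_le_neg_iff, div_le_div_iff₀ (by positivity) (by positivity)]
      have : l^2 ≤ 4*κ^2 := by nlinarith
      nlinarith [mul_pos ha hT0]
    have := hy0 0
    gcongr
  set ρ := Real.exp (-(a*T/(2*κ^2))) with hρ
  have hρ0 : 0 < ρ := Real.exp_pos _
  have ph2 : ∀ j : ℕ, j ≤ J → y (T/2 + 4*l*(2^j-1)) ≤ 2 * Real.exp (4*a/(2^j*l)) * O + ρ * y 0 := by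
    intro j
    induction j with
    | zero => 
      intro _
      simp only [pow_zero, sub_self, mul_zero, add_zero, one_mul]
      refine ph1'.trans ?_
      gcongr
      norm_num
    | succ j ih =>
      intro hj
      have ih := ih (by omega)
      obtain ⟨r, hr⟩ : ∃ r, r = 2^(j+1)*l := ⟨_, rfl⟩
      have hp : (2:ℝ)^(j+1) ≤ 2^J := pow_le_pow_right₀ (by norm_num) hj
      have hp1 : (1:ℝ) ≤ 2^(j+1) := one_le_pow₀ (by norm_num)
      have hp2 : (1:ℝ) ≤ 2^j := one_le_pow₀ (by norm_num)
      have hr0 : 0 < r := by rw [hr]; positivity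
      have hrT : r ≤ T/8 := by rw [hr, ← hlT]; gcongr
      have hrl : r ≤ ℓ1 := by linarith
      have hrk : κ ≤ r := by rw [hr]; nlinarith
      have h1 := hII r hrk hrl (T/2 + 4*l*(2^j-1))
      have e1 : T/2 + 4*l*(2^j-1) + 2*r = T/2 + 4*l*(2^(j+1)-1) := by rw [hr, pow_succ]; ring
      rw [e1] at h1
      have h2 := hsub (T/2 + 4*l*(2^j-1)) (T/2 + 4*l*(2^(j+1)-1)) (by nlinarith) (by rw [← e1]; linarith) (by nlinarith)
      have e2 : 4*a/(2^j*l) = 8*(a/r) := by rw [hr, pow_succ]; field_simp; norm_num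
      rw [e2] at ih
      have e3 : 4*a/(2^(j+1)*l) = 4*(a/r) := by rw [hr]; ring
      rw [e3]
      have e4 : 3*a/r = 3*(a/r) := by ring
      have e5 : -8*a/r = -(8*(a/r)) := by ring
      rw [e4, e5] at h1
      have hE := hexp2 r hr0 hrl
      have e6 : Real.exp (-(8*(a/r))) * Real.exp (8*(a/r)) = 1 := by rw [← Real.exp_add]; simp
      have e7 : Real.exp (-(8*(a/r))) ≤ 1 := Real.exp_le_one_iff.2 (by have : 0 < a/r := by positivity
                                                                       linarith)
      have e8 : Real.exp (3*(a/r)) + 2 ≤ 2 * Real.exp (4*(a/r)) := by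
        have g1 : Real.exp (3*(a/r)) = Real.exp (a/r)^3 := by rw [← Real.exp_nat_mul]; norm_num
        have g2 : Real.exp (4*(a/r)) = Real.exp (a/r)^4 := by rw [← Real.exp_nat_mul]; norm_num
        rw [g1, g2]
        have : 2^3 ≤ Real.exp (a/r)^3 := pow_le_pow_left₀ (by norm_num) hE 3
        have e48 : Real.exp (a/r)^4 = Real.exp (a/r)^3 * Real.exp (a/r) := by ring
        rw [e48]
        have := mul_le_mul_of_nonneg_left hE (by positivity : 0 ≤ Real.exp (a/r)^3)
        linarith
      calc _ ≤ Real.exp (3*(a/r)) * O + Real.exp (-(8*(a/r))) * (2 * Real.exp (8*(a/r)) * O + ρ * y 0) := h1.trans (by gcongr)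
        _ = Real.exp (3*(a/r)) * O + 2 * (Real.exp (-(8*(a/r))) * Real.exp (8*(a/r))) * O + Real.exp (-(8*(a/r))) * (ρ * y 0) := by ring
        _ ≤ Real.exp (3*(a/r)) * O + 2 * 1 * O + 1 * (ρ * y 0) := by
            rw [e6]; have := hy0 0; gcongr
        _ = (Real.exp (3*(a/r)) + 2) * O + ρ * y 0 := by ring
        _ ≤ _ := by gcongr
  have h5 := ph2 J le_rfl
  have h6 := hlip (T/2 + 4*l*(2^J-1)) (by nlinarith) (by nlinarith)
  rw [hlT] at h5
  have e9 : 4*a/(T/8) = 32*a/T := by field_simp; norm_num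
  rw [e9] at h5
  have e10 : 8 * Real.exp (32*a/T) ≤ Real.exp (35*a/T) := by
    have g1 : Real.exp (35*a/T) = Real.exp (a/T)^3 * Real.exp (32*a/T) := by 
      rw [← Real.exp_nat_mul, ← Real.exp_add]; congr 1; push_cast; ring
    rw [g1]
    have := hexp2 T hT0 hTl
    have : 2^3 ≤ Real.exp (a/T)^3 := pow_le_pow_left₀ (by norm_num) this 3
    gcongr
    linarith
  calc y T ≤ 4 * (2 * Real.exp (32*a/T) * O + ρ * y 0) := h6.trans (by gcongr)
    _ = 8 * Real.exp (32*a/T) * O + 4 * ρ * y 0 := by ring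
    _ ≤ _ := by gcongr

end

section

open scoped ComplexConjugate InnerProductSpace

variable {H : Type*} [NormedAddCommGroup H] [InnerProductSpace ℂ H] [CompleteSpace H]

lemma trunc {A Q : H →L[ℂ] H} {x m : ℝ} {N M : ℕ} {w : H} (hm : 0 ≤ m) (hx : 0 ≤ x) (hQ : ∀ v, ‖Q v‖ ≤ ‖v‖)
    (hA : ∀ v, ‖v - A v‖ ≤ x * ‖v‖) (hk : ∀ k < N, ‖Q ((A^k) w)‖ ≤ m) :
    ‖Q ((A^M) w)‖ ≤ 3^M * m + Real.exp (3*x*M - N) * ‖w‖ := by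
  obtain ⟨E, hE⟩ : ∃ E : H →L[ℂ] H, E = A - 1 := ⟨_, rfl⟩
  have hEv : ∀ v, E v = A v - v := fun v => by rw [hE]; rfl
  have h1 : ∀ n j, n + j < N → ‖Q ((E^n) ((A^j) w))‖ ≤ 2^n * m := by
    intro n
    induction n with
    | zero => intro j hj; simpa using hk j (by omega)
    | succ n ih =>
      intro j hj
      have e : (E^(n+1)) ((A^j) w) = (E^n) ((A^(j+1)) w) - (E^n) ((A^j) w) := by
        rw [pow_succ, pow_succ']
        change (E^n) (E ((A^j) w)) = (E^n) (A ((A^j) w)) - (E^n) ((A^j) w)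
        rw [hEv, map_sub]
      rw [e, map_sub]
      refine (norm_sub_le _ _).trans ?_
      have := ih (j+1) (by omega)
      have := ih j (by omega)
      have e2 : (2:ℝ)^(n+1) * m = 2^n * m + 2^n * m := by ring
      rw [e2]; linarith
  have h2 : ∀ n v, ‖(E^n) v‖ ≤ x^n * ‖v‖ := by
    intro n
    induction n with
    | zero => intro v; simp
    | succ n ih =>
      intro v
      rw [pow_succ]
      change ‖(E^n) (E v)‖ ≤ _
      refine (ih _).trans ?_
      rw [pow_succ, mul_assoc]
      refine mul_le_mul_of_nonneg_left ?_ (by positivity)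
      rw [hEv, norm_sub_rev]; exact hA v
  have h3 : ∀ n, ‖Q ((E^n) w)‖ ≤ 2^n * m + Real.exp (-N) * ((3*x)^n * ‖w‖) := by
    intro n
    by_cases hn : n < N
    · have := h1 n 0 (by omega)
      simp only [pow_zero] at this
      have h4 : 0 ≤ Real.exp (-(N:ℝ)) * ((3*x)^n * ‖w‖) := by positivity
      have e : (1 : H →L[ℂ] H) w = w := rfl
      rw [e] at this
      linarith
    · push Not at hn
      refine ((hQ _).trans (h2 n w)).trans ?_
      have h4 : 1 ≤ Real.exp (-(N:ℝ)) * 3^n := by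
        have h5 : Real.exp (N:ℝ) ≤ 3^n := by
          have : Real.exp 1 ≤ 3 := by linarith [Real.exp_one_lt_d9]
          calc Real.exp (N:ℝ) = Real.exp 1^N := by rw [← Real.exp_nat_mul]; simp
            _ ≤ 3^N := by gcongr
            _ ≤ 3^n := pow_le_pow_right₀ (by norm_num) hn
        rw [Real.exp_neg, inv_mul_eq_div, le_div_iff₀ (Real.exp_pos _)]; linarith
      have h6 : 0 ≤ 2^n * m := by positivity
      calc x^n * ‖w‖ ≤ (Real.exp (-(N:ℝ)) * 3^n) * (x^n * ‖w‖) := le_mul_of_one_le_left (by positivity) h4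
        _ = Real.exp (-N) * ((3*x)^n * ‖w‖) := by rw [mul_pow]; ring
        _ ≤ _ := by linarith
  have h4 : (A^M) w = ∑ n ∈ Finset.range (M+1), (M.choose n) • (E^n) w := by
    have e : A = E + 1 := by rw [hE]; abel
    rw [e, (Commute.one_right E).add_pow]
    simp only [one_pow, mul_one, ContinuousLinearMap.sum_apply]
    refine Finset.sum_congr rfl fun n _ => ?_
    rw [← nsmul_eq_mul']
    rfl
  rw [h4, map_sum]
  refine (norm_sum_le _ _).trans ?_
  have h5 : ∀ n ∈ Finset.range (M+1), ‖Q ((M.choose n) • (E^n) w)‖ ≤ (2^n * 1^(M-n) * (M.choose n)) * m + Real.exp (-N) * ((3*x)^n * 1^(M-n) * (M.choose n)) * ‖w‖ := by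
    intro n _
    rw [map_nsmul]
    refine (norm_nsmul_le).trans ?_
    have := mul_le_mul_of_nonneg_left (h3 n) (Nat.cast_nonneg (M.choose n) : (0:ℝ) ≤ _)
    simp only [one_pow, mul_one]
    linarith
  refine (Finset.sum_le_sum h5).trans ?_
  rw [Finset.sum_add_distrib, ← Finset.sum_mul, ← Finset.sum_mul, ← Finset.mul_sum, ← add_pow, ← add_pow]
  have h6 : (3*x+1)^M ≤ Real.exp (3*x*M) := by
    rw [mul_comm (3*x) (M:ℝ), Real.exp_nat_mul]
    exact pow_le_pow_left₀ (by positivity) (Real.add_one_le_exp _) M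
  have h7 : Real.exp (3*x*M - N) = Real.exp (-N) * Real.exp (3*x*M) := by rw [← Real.exp_add]; congr 1; ring
  rw [h7]
  norm_num
  gcongr

lemma logit {P : H →L[ℂ] H} (hP : IsSelfAdjoint P) (v : H) (s : ℝ) (m : ℕ) : ∀ T, ‖Sg P (2^m*T) v‖^2 ≤ Real.exp (-s) * ‖v‖^2 →
    ‖Sg P T v‖^2 ≤ Real.exp (-(s/2^m)) * ‖v‖^2 := by
  induction m with
  | zero => intro T h; simpa using h
  | succ m ih =>
    intro T h
    have h1 := ih (2*T) (by rw [← mul_assoc, ← pow_succ]; exact h)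
    have h2 := Sg_logconv hP v T
    have h3 : (‖Sg P T v‖^2)^2 ≤ (Real.exp (-(s/2^(m+1))) * ‖v‖^2)^2 := by
      have e : Real.exp (-(s/2^m)) = Real.exp (-(s/2^(m+1)))^2 := by
        rw [← Real.exp_nat_mul]; congr 1; rw [pow_succ]; field_simp; norm_num
      rw [e] at h1
      calc (‖Sg P T v‖^2)^2 ≤ (‖v‖ * ‖Sg P (2*T) v‖)^2 := by gcongr
        _ = ‖v‖^2 * ‖Sg P (2*T) v‖^2 := by ring
        _ ≤ ‖v‖^2 * (Real.exp (-(s/2^(m+1)))^2 * ‖v‖^2) := by gcongr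
        _ = _ := by ring
    exact le_of_sq_le_sq h3 (by positivity)

lemma Sg_diff {P : H →L[ℂ] H} {v0 Λ : ℝ} (hlow : ∀ v, -(v0 * ‖v‖^2) ≤ (⟪P v, v⟫_ℂ).re) (hv0 : 0 ≤ v0) (hΛ : ‖P‖ ≤ Λ) {δ : ℝ} (hδ : 0 ≤ δ)
    (hδ1 : v0 * δ ≤ 1/2) (v : H) : ‖v - Sg P δ v‖ ≤ 2 * Λ * δ * ‖v‖ := by
  have hb : ∀ t ∈ Set.Ico (0:ℝ) δ, ‖-P (Sg P t v)‖ ≤ 2*Λ*‖v‖ := by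
    intro t ht
    rw [norm_neg]
    have h1 := Sg_bound hlow v ht.1
    have h2 : Real.exp (2*v0*t) ≤ 2^2 := by
      have : Real.exp (2*v0*t) ≤ Real.exp 1 := Real.exp_le_exp.2 (by nlinarith [ht.2])
      linarith [Real.exp_one_lt_d9]
    have h3 : ‖Sg P t v‖ ≤ 2*‖v‖ := by
      refine le_of_sq_le_sq ?_ (by positivity)
      rw [mul_pow]; exact h1.trans (by gcongr)
    calc _ ≤ ‖P‖ * ‖Sg P t v‖ := P.le_opNorm _
      _ ≤ Λ * (2*‖v‖) := mul_le_mul hΛ h3 (norm_nonneg _) ((norm_nonneg _).trans hΛ)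
      _ = _ := by ring
  have := norm_image_sub_le_of_norm_deriv_le_segment' (fun t _ => (Sg_hasDeriv_apply P t v).hasDerivWithinAt) hb δ ⟨hδ, le_rfl⟩
  rw [Sg_zero_apply, norm_sub_rev] at this
  linarith

end

section

open scoped ComplexConjugate InnerProductSpace

variable {H : Type*} [NormedAddCommGroup H] [InnerProductSpace ℂ H] [CompleteSpace H]

lemma sq2 (x y : ℝ) : (x+y)^2 ≤ 2*x^2 + 2*y^2 := by linarith [sq_nonneg (x-y)]

set_option maxHeartbeats 1600000 in
lemma regB1 {P Q : H →L[ℂ] H} {v0 a K Λ0 h T ℓ1 b : ℝ} (hv0 : 0 ≤ v0) (hlow : ∀ v, -(v0 * ‖v‖^2) ≤ (⟪P v, v⟫_ℂ).re)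
    (ha : 0 < a) (hK : 1 ≤ K) (hΛ0 : 0 < Λ0) (hh : 0 < h) (hh1 : h ≤ 1) (hT : 0 < T)
    (hΛ : ‖P‖ ≤ Λ0/h^2) (hQ : ∀ v, ‖Q v‖ ≤ ‖v‖) 
    (hI : ∀ ℓ, K*h ≤ ℓ → ℓ ≤ ℓ1 → ∀ w, ‖Sg P ℓ w‖^2 ≤ Real.exp (2*a/ℓ) * ‖Q (Sg P ℓ w)‖^2 + Real.exp (-9*a/ℓ) * ‖w‖^2)
    (hb : b = 48*Λ0*K + a/K) (h1 : 8*K*h ≤ ℓ1) (h2 : v0*(16*K*h) ≤ 1/2) (h3 : h ≤ a/(96*K)) (m : ℕ)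
    (hD1 : 8*K*h ≤ 2^m*T) (hD2 : 2^m*T < 16*K*h) (v : H) :
    ‖Sg P (2^m*T) v‖^2 ≤ Real.exp ((16+4*a+48*K*(b+1))/T) * (∫ τ in (0:ℝ)..T, ‖Q (Sg P τ v)‖^2) + Real.exp (-(a/(2*K*h))) * ‖v‖^2 := by
  have hK0 : 0 < K := by linarith
  have hb0 : 0 < b := by rw [hb]; positivity
  have h2m : (1:ℝ) ≤ 2^m := one_le_pow₀ (by norm_num)
  obtain ⟨D, hD⟩ : ∃ D, D = 2^m*T := ⟨_, rfl⟩
  rw [← hD] at hD1 hD2 ⊢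
  have hTD : T ≤ D := by rw [hD]; exact le_mul_of_one_le_left hT.le h2m
  obtain ⟨ℓ, hℓ⟩ : ∃ ℓ, ℓ = D/2 := ⟨_, rfl⟩
  have hℓ0 : 0 < ℓ := by linarith
  have hℓK : 4*K*h ≤ ℓ := by linarith
  have hKh : 0 < K*h := by positivity
  have hℓ8 : ℓ < 8*K*h := by linarith
  obtain ⟨N, hN⟩ : ∃ N, N = ⌈b/h⌉₊ := ⟨_, rfl⟩
  have hN1 : b/h ≤ N := by rw [hN]; exact Nat.le_ceil _
  have hbh : 0 < b/h := by positivity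
  have hN0 : (0:ℝ) < N := by linarith
  have hN2 : (N:ℝ) ≤ (b+1)/h := by
    have := (Nat.ceil_lt_add_one hbh.le).le
    rw [← hN] at this
    have h5 : 1 ≤ 1/h := by rw [le_div_iff₀ hh]; linarith
    rw [add_div]; linarith
  obtain ⟨δ, hδ⟩ : ∃ δ, δ = T/(2*N) := ⟨_, rfl⟩
  have hδ0 : 0 < δ := by rw [hδ]; positivity
  have hδN : N * δ = T/2 := by rw [hδ]; field_simp
  have hδT : δ ≤ T := by
    have hN1 : (1:ℝ) ≤ N := by
      have : 0 < N := by exact_mod_cast hN0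
      exact_mod_cast this
    have := le_mul_of_one_le_left hδ0.le hN1
    linarith
  obtain ⟨M, hM⟩ : ∃ M : ℕ, M = 2^m*N := ⟨_, rfl⟩
  have hMδ : (M:ℝ) * δ = ℓ := by
    rw [hM]; push_cast; rw [mul_assoc, hδN, hℓ, hD]; ring
  have hNM : N ≤ M := by rw [hM]; exact Nat.le_mul_of_pos_left _ (by positivity)
  have hMT : (M:ℝ) ≤ 16*K*(b+1)/T := by
    rw [hM, le_div_iff₀ hT]; push_cast
    calc (2:ℝ)^m * N * T = D * N := by rw [hD]; ring
      _ ≤ (16*K*h) * ((b+1)/h) := by gcongr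
      _ = _ := by field_simp
  obtain ⟨r, hr⟩ : ∃ r, r = Real.exp (-(a/(K*h))) := ⟨_, rfl⟩
  have hr0 : 0 < r := by rw [hr]; positivity
  have hR : Real.exp (3*(2*(Λ0/h^2)*δ)*M - N) ≤ r := by
    rw [hr]
    refine Real.exp_le_exp.2 ?_
    have e1 : 3*(2*(Λ0/h^2)*δ)*M = 6*(Λ0/h^2)*ℓ := by rw [← hMδ]; ring
    rw [e1]
    have e2 : 6*(Λ0/h^2)*ℓ ≤ 6*(Λ0/h^2)*(8*K*h) := by gcongr
    have e3 : 6*(Λ0/h^2)*(8*K*h) = 48*Λ0*K/h := by field_simp; ring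
    have e4 : b/h = 48*Λ0*K/h + a/(K*h) := by rw [hb]; field_simp
    linarith
  have hex4 : ∀ s t, s ≤ t → t - s ≤ D → ‖Sg P t v‖^2 ≤ 4 * ‖Sg P s v‖^2 := by
    intro s t hst hts
    refine (Sg_bound2 hlow v hst).trans ?_
    have : Real.exp (2*v0*(t-s)) ≤ Real.exp 1 := Real.exp_le_exp.2 (by
      have := mul_le_mul_of_nonneg_left (hts.trans hD2.le) hv0
      linarith)
    gcongr
    linarith [Real.exp_one_lt_d9]
  have hcu := Sg_cont_apply P v
  have hq : Continuous fun τ => ‖Q (Sg P τ v)‖^2 := (Q.continuous.comp hcu).norm.pow 2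
  obtain ⟨W, hW⟩ : ∃ W, W = 8*Real.exp (2*a/ℓ)*9^M := ⟨_, rfl⟩
  have hW0 : 0 < W := by rw [hW]; positivity
  have hpt : ∀ τ ∈ Set.Icc (0:ℝ) (T/2), ‖Sg P D v‖^2 ≤ W * (∑ k ∈ Finset.range N, ‖Q (Sg P (k*δ+τ) v)‖^2) + Real.exp (-(a/(2*K*h))) * ‖v‖^2 := by
    intro τ hτ
    obtain ⟨s, hs⟩ : ∃ s, s = ∑ k ∈ Finset.range N, ‖Q (Sg P (k*δ+τ) v)‖^2 := ⟨_, rfl⟩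
    have hs0 : 0 ≤ s := by rw [hs]; positivity
    rw [← hs]
    have g1 := hex4 (ℓ+τ) D (by linarith [hτ.2]) (by linarith [hτ.1])
    have g2 := hI ℓ (by linarith) (by linarith) (Sg P τ v)
    rw [← Sg_add_apply] at g2
    have g3 := hex4 0 τ hτ.1 (by linarith [hτ.2])
    rw [Sg_zero_apply] at g3
    have g4 := trunc (A := Sg P δ) (Q := Q) (x := 2*(Λ0/h^2)*δ) (m := √s) (N := N) (M := M) (w := Sg P τ v) (Real.sqrt_nonneg _)
      (by positivity) hQ (fun w => Sg_diff hlow hv0 hΛ hδ0.le (by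
        have := mul_le_mul_of_nonneg_left (hδT.trans (hTD.trans hD2.le)) hv0
        linarith) w) (by
        intro k hk
        rw [Sg_pow, ← Sg_add_apply]
        refine Real.le_sqrt_of_sq_le ?_
        rw [hs]
        exact Finset.single_le_sum (f := fun k : ℕ => ‖Q (Sg P (k*δ+τ) v)‖^2) (fun i _ => sq_nonneg _) (Finset.mem_range.2 hk))
    rw [Sg_pow, hMδ, ← Sg_add_apply] at g4
    have g5 : ‖Q (Sg P (ℓ+τ) v)‖ ≤ 3^M * √s + r * ‖Sg P τ v‖ := g4.trans (by gcongr)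
    have g6 : ‖Q (Sg P (ℓ+τ) v)‖^2 ≤ 2 * (9^M * s) + 2 * r^2 * ‖Sg P τ v‖^2 := by
      calc _ ≤ (3^M * √s + r * ‖Sg P τ v‖)^2 := by gcongr
        _ ≤ 2 * (3^M * √s)^2 + 2 * (r * ‖Sg P τ v‖)^2 := sq2 _ _
        _ = _ := by
          rw [mul_pow, mul_pow, Real.sq_sqrt hs0, ← pow_mul, mul_comm M 2, pow_mul]; norm_num; ring
    have k1 : Real.exp (2*a/ℓ) * r^2 ≤ r := by
      rw [hr, ← Real.exp_nat_mul, ← Real.exp_add]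
      refine Real.exp_le_exp.2 ?_
      have : 2*a/ℓ ≤ a/(K*h) := by
        rw [div_le_div_iff₀ hℓ0 hKh]; linarith [mul_le_mul_of_nonneg_left hℓK ha.le, mul_pos ha hKh]
      push_cast; linarith
    have k2 : Real.exp (-9*a/ℓ) ≤ r := by
      rw [hr]
      refine Real.exp_le_exp.2 ?_
      have : a/(K*h) ≤ 9*a/ℓ := by
        rw [div_le_div_iff₀ hKh hℓ0]; linarith [mul_le_mul_of_nonneg_left hℓ8.le ha.le, mul_pos ha hKh]
      have e : -9*a/ℓ = -(9*a/ℓ) := by ring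
      rw [e]; linarith
    have k3 : 48 * r ≤ Real.exp (-(a/(2*K*h))) := by
      have e : r = Real.exp (-(a/(2*K*h))) * Real.exp (-(a/(2*K*h))) := by rw [hr, ← Real.exp_add]; congr 1; field_simp; ring
      have e2 : 48 ≤ Real.exp (a/(2*K*h)) := by
        have : 48 ≤ a/(2*K*h) := by
          rw [le_div_iff₀ (by positivity)]; rw [le_div_iff₀ (by positivity)] at h3; linarith
        linarith [Real.add_one_le_exp (a/(2*K*h))]
      have e3 : 48 * Real.exp (-(a/(2*K*h))) ≤ 1 := by
        rw [Real.exp_neg, ← div_eq_mul_inv, div_le_one (Real.exp_pos _)]; exact e2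
      rw [e, ← mul_assoc]
      exact mul_le_of_le_one_left (Real.exp_pos _).le e3
    have hY0 : 0 ≤ ‖Sg P τ v‖^2 := sq_nonneg _
    have g7 : ‖Sg P (ℓ+τ) v‖^2 ≤ Real.exp (2*a/ℓ) * (2 * (9^M * s)) + 3 * r * ‖Sg P τ v‖^2 := by
      calc _ ≤ Real.exp (2*a/ℓ) * (2 * (9^M * s) + 2 * r^2 * ‖Sg P τ v‖^2) + r * ‖Sg P τ v‖^2 := g2.trans (by gcongr)
        _ = Real.exp (2*a/ℓ) * (2 * (9^M * s)) + (2 * (Real.exp (2*a/ℓ) * r^2) + r) * ‖Sg P τ v‖^2 := by ring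
        _ ≤ Real.exp (2*a/ℓ) * (2 * (9^M * s)) + (2 * r + r) * ‖Sg P τ v‖^2 := by gcongr
        _ = _ := by ring
    calc _ ≤ 4 * (Real.exp (2*a/ℓ) * (2 * (9^M * s)) + 3 * r * (4 * ‖v‖^2)) := g1.trans (by gcongr; exact g7.trans (by gcongr))
      _ = W * s + 48 * r * ‖v‖^2 := by rw [hW]; ring
      _ ≤ _ := by gcongr
  set O := ∫ τ in (0:ℝ)..T, ‖Q (Sg P τ v)‖^2 with hO
  have hO0 : 0 ≤ O := intervalIntegral.integral_nonneg hT.le fun _ _ => sq_nonneg _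
  have hk : ∀ k ∈ Finset.range N, ∫ τ in (0:ℝ)..(T/2), ‖Q (Sg P (k*δ+τ) v)‖^2 ≤ O := by
    intro k hk
    rw [intervalIntegral.integral_comp_add_left (fun τ => ‖Q (Sg P τ v)‖^2)]
    have : (k:ℝ) ≤ N := by exact_mod_cast (Finset.mem_range.1 hk).le
    have : k * δ ≤ N*δ := by gcongr
    exact intervalIntegral.integral_mono_interval (by positivity) (by linarith) (by linarith) (Filter.Eventually.of_forall fun τ => sq_nonneg _) (hq.intervalIntegrable _ _)
  have hqk : ∀ k : ℕ, Continuous fun τ => ‖Q (Sg P (k*δ+τ) v)‖^2 := fun k => hq.comp (continuous_const.add continuous_id)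
  have hqs : Continuous fun τ => W * (∑ k ∈ Finset.range N, ‖Q (Sg P (k*δ+τ) v)‖^2) := continuous_const.mul (continuous_finsetSum _ fun k _ => hqk k)
  have hqs2 : Continuous fun τ => W * (∑ k ∈ Finset.range N, ‖Q (Sg P (k*δ+τ) v)‖^2) + Real.exp (-(a/(2*K*h))) * ‖v‖^2 := hqs.add continuous_const
  have h5 := intervalIntegral.integral_mono_on (μ := volume) (by linarith : (0:ℝ) ≤ T/2) (continuous_const.intervalIntegrable _ _) (hqs2.intervalIntegrable _ _) hpt
  rw [intervalIntegral.integral_add (hqs.intervalIntegrable _ _) (continuous_const.intervalIntegrable _ _),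
    intervalIntegral.integral_const_mul, intervalIntegral.integral_const, intervalIntegral.integral_const, smul_eq_mul, smul_eq_mul,
    intervalIntegral.integral_finsetSum (fun k _ => (hqk k).intervalIntegrable _ _)] at h5
  have h6 := Finset.sum_le_sum hk
  rw [Finset.sum_const, Finset.card_range, nsmul_eq_mul] at h6
  rw [sub_zero] at h5
  have h7 : T/2 * ‖Sg P D v‖^2 ≤ T/2 * (2/T * W * N * O + Real.exp (-(a/(2*K*h))) * ‖v‖^2) := by
    have e : T/2 * (2/T * W * N * O + Real.exp (-(a/(2*K*h))) * ‖v‖^2) = W * (N * O) + T/2 * (Real.exp (-(a/(2*K*h))) * ‖v‖^2) := by field_simp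
    rw [e]
    exact h5.trans (by gcongr)
  have h8 := le_of_mul_le_mul_left h7 (by positivity)
  refine h8.trans ?_
  gcongr
  have x1 : 16/T ≤ Real.exp (16/T) := by linarith [Real.add_one_le_exp (16/T)]
  have x2 : Real.exp (2*a/ℓ) ≤ Real.exp (4*a/T) := Real.exp_le_exp.2 (by
    rw [div_le_div_iff₀ hℓ0 hT]; linarith [mul_le_mul_of_nonneg_left (show T ≤ 2*ℓ by linarith) ha.le])
  have x3 : (9:ℝ)^M * N ≤ Real.exp (48*K*(b+1)/T) := by
    have g1 : (N:ℝ) ≤ 2^M := by exact_mod_cast hNM.trans (Nat.lt_two_pow_self).le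
    have g2 : (18:ℝ) ≤ Real.exp 3 := by
      have : (2.7182818283:ℝ)^3 ≤ Real.exp 1^3 := pow_le_pow_left₀ (by norm_num) Real.exp_one_gt_d9.le 3
      rw [← Real.exp_nat_mul] at this
      norm_num at this ⊢
      linarith
    calc (9:ℝ)^M * N ≤ 9^M * 2^M := by gcongr
      _ = 18^M := by rw [← mul_pow]; norm_num
      _ ≤ Real.exp 3^M := by gcongr
      _ = Real.exp (M*3) := by rw [Real.exp_nat_mul]
      _ ≤ _ := Real.exp_le_exp.2 (by
        have e : 48*K*(b+1)/T = 16*K*(b+1)/T*3 := by ring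
        rw [e]; gcongr)
  have e : Real.exp ((16+4*a+48*K*(b+1))/T) = Real.exp (16/T) * Real.exp (4*a/T) * Real.exp (48*K*(b+1)/T) := by
    rw [← Real.exp_add, ← Real.exp_add]; congr 1; ring
  rw [e]
  calc 2/T*W*N = 16/T * Real.exp (2*a/ℓ) * (9^M * N) := by rw [hW]; ring
    _ ≤ _ := by gcongr

lemma regB {P Q : H →L[ℂ] H} {v0 a K Λ0 h T ℓ1 b : ℝ} (hv0 : 0 ≤ v0) (hP : IsSelfAdjoint P) (hlow : ∀ v, -(v0 * ‖v‖^2) ≤ (⟪P v, v⟫_ℂ).re)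
    (ha : 0 < a) (hK : 1 ≤ K) (hΛ0 : 0 < Λ0) (hh : 0 < h) (hh1 : h ≤ 1) (hT : 0 < T) (hT1 : T ≤ 1)
    (hΛ : ‖P‖ ≤ Λ0/h^2) (hQ : ∀ v, ‖Q v‖ ≤ ‖v‖) 
    (hI : ∀ ℓ, K*h ≤ ℓ → ℓ ≤ ℓ1 → ∀ w, ‖Sg P ℓ w‖^2 ≤ Real.exp (2*a/ℓ) * ‖Q (Sg P ℓ w)‖^2 + Real.exp (-9*a/ℓ) * ‖w‖^2)
    (hb : b = 48*Λ0*K + a/K) (h1 : 8*K*h ≤ ℓ1) (h2 : v0*(16*K*h) ≤ 1/2) (h3 : h ≤ a/(96*K)) 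
    (hTh : T < 8*K*h) (v : H) :
    ‖Sg P T v‖^2 ≤ Real.exp ((18+8*a+48*K*(b+1))/T) * (∫ τ in (0:ℝ)..T, ‖Q (Sg P τ v)‖^2) + Real.exp (-(a/(64*K^2) * T/h^2)) * ‖v‖^2 := by
  have hK0 : 0 < K := by linarith
  have hKh : 0 < K*h := by positivity
  obtain ⟨m, hm1, hm2⟩ := exists_nat_pow_near (x := 16*K*h/T) (y := 2) (by rw [le_div_iff₀ (by positivity)]; linarith) (by norm_num)
  rw [le_div_iff₀ hT] at hm1
  rw [div_lt_iff₀ hT, pow_succ] at hm2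
  obtain ⟨m', hm'1, hm'2⟩ : ∃ m' : ℕ, 8*K*h ≤ 2^m'*T ∧ 2^m'*T < 16*K*h := by
    rcases hm1.lt_or_eq with h' | h'
    · exact ⟨m, by linarith, h'⟩
    · rcases m with _ | m
      · simp at h'; linarith
      · rw [pow_succ] at h'
        exact ⟨m, by linarith, by linarith⟩
  have hmain := regB1 hv0 hlow ha hK hΛ0 hh hh1 hT hΛ hQ hI hb h1 h2 h3 m' hm'1 hm'2 v
  set O := ∫ τ in (0:ℝ)..T, ‖Q (Sg P τ v)‖^2 with hO
  have hO0 : 0 ≤ O := intervalIntegral.integral_nonneg hT.le fun _ _ => sq_nonneg _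
  by_cases hc : Real.exp (-(a/(2*K*h))) * ‖v‖^2 ≤ Real.exp ((16+4*a+48*K*(b+1))/T) * O
  · have g1 := Sg_bound hlow v hT.le
    have g2 : Real.exp (2*v0*T) ≤ Real.exp 2 := Real.exp_le_exp.2 (by nlinarith)
    have g3 : Real.exp 2 ≤ Real.exp (2/T) := Real.exp_le_exp.2 (by rw [le_div_iff₀ hT]; linarith)
    have g4 : ‖v‖^2 ≤ Real.exp (a/(2*K*h)) * (Real.exp ((16+4*a+48*K*(b+1))/T) * O) := by
      rwa [Real.exp_neg, inv_mul_le_iff₀ (Real.exp_pos _)] at hc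
    have g5 : Real.exp (a/(2*K*h)) ≤ Real.exp (4*a/T) := Real.exp_le_exp.2 (by
      rw [div_le_div_iff₀ (by positivity) hT]; nlinarith)
    have e : Real.exp ((18+8*a+48*K*(b+1))/T) = Real.exp (2/T) * (Real.exp (4*a/T) * Real.exp ((16+4*a+48*K*(b+1))/T)) := by
      rw [← Real.exp_add, ← Real.exp_add]; congr 1; ring
    rw [e]
    calc _ ≤ Real.exp (2/T) * (Real.exp (4*a/T) * (Real.exp ((16+4*a+48*K*(b+1))/T) * O)) := by
            refine g1.trans (mul_le_mul (g2.trans g3) (g4.trans ?_) (by positivity) (by positivity))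
            gcongr
      _ = Real.exp (2/T) * (Real.exp (4*a/T) * Real.exp ((16+4*a+48*K*(b+1))/T)) * O + 0 := by ring
      _ ≤ _ := by gcongr; positivity
  · push Not at hc
    have g1 : ‖Sg P (2^m'*T) v‖^2 ≤ Real.exp (-(a/(4*K*h))) * ‖v‖^2 := by
      have e : Real.exp (-(a/(2*K*h))) = Real.exp (-(a/(4*K*h))) * Real.exp (-(a/(4*K*h))) := by rw [← Real.exp_add]; congr 1; field_simp; ring
      have e2 : 2 ≤ Real.exp (a/(4*K*h)) := by
        have : 2 ≤ a/(4*K*h) := by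
          rw [le_div_iff₀ (by positivity)]; rw [le_div_iff₀ (by positivity)] at h3; nlinarith
        linarith [Real.add_one_le_exp (a/(4*K*h))]
      have e3 : 2 * Real.exp (-(a/(4*K*h))) ≤ 1 := by
        rw [Real.exp_neg, ← div_eq_mul_inv, div_le_one (Real.exp_pos _)]; exact e2
      calc _ ≤ 2 * (Real.exp (-(a/(2*K*h))) * ‖v‖^2) := by linarith
        _ = (2 * Real.exp (-(a/(4*K*h)))) * (Real.exp (-(a/(4*K*h))) * ‖v‖^2) := by rw [e]; ring
        _ ≤ _ := mul_le_of_le_one_left (by positivity) e3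
    have g2 := logit hP v (a/(4*K*h)) m' T g1
    have g3 : Real.exp (-(a/(4*K*h)/2^m')) ≤ Real.exp (-(a/(64*K^2) * T/h^2)) := by
      refine Real.exp_le_exp.2 (neg_le_neg ?_)
      have e : a/(64*K^2) * T/h^2 = a/(4*K*h) * (T/(16*K*h)) := by field_simp; norm_num
      rw [e, div_eq_mul_one_div (a/(4*K*h)) (2^m')]
      have : T/(16*K*h) ≤ 1/2^m' := by
        rw [div_le_div_iff₀ (by positivity) (by positivity)]; linarith
      gcongr
    have g4 : 0 ≤ Real.exp ((18+8*a+48*K*(b+1))/T) * O := by positivity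
    have g5 := mul_le_mul_of_nonneg_right g3 (sq_nonneg ‖v‖)
    linarith

end

section

open scoped ComplexConjugate InnerProductSpace

theorem obs (d : ℕ) (L γ v0 : ℝ) (ω : Set (Fin d → ℝ)) (hv0 : 0 ≤ v0) (hω : Equidistributed d L γ ω) :
    ∃ C1 > (0:ℝ), ∃ c2 > (0:ℝ), ∃ T0 > (0:ℝ), ∃ h0 > (0:ℝ),
      ∀ h T : ℝ, 0 < h → h ≤ h0 → 0 < T → T ≤ T0 → ∀ (V : (Fin d → ℝ) → ℝ) (P Q : Hsp d →L[ℂ] Hsp d), 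
        RealizesPh d h V P → (∀ x, |V x| ≤ v0) →
        (∀ v x, (Q v) x = {x | pt d h x ∈ ω}.indicator (fun x => v x) x) → (∀ v, ‖Q v‖ ≤ ‖v‖) → ∀ v,
        ‖Sg P T v‖^2 ≤ Real.exp (C1/T) * (∫ τ in (0:ℝ)..T, ‖Q (Sg P τ v)‖^2) + 8 * Real.exp (-(c2*T/h^2)) * ‖v‖^2 := by
  obtain ⟨a, ha, c1, hc1, ℓ0, hℓ0, hℓ01, hc11, hint⟩ := interp d L γ v0 ω hv0 hω
  obtain ⟨K, hK⟩ : ∃ K, K = 1/c1 := ⟨_, rfl⟩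
  have hK1 : 1 ≤ K := by rw [hK, le_div_iff₀ hc1]; linarith
  have hK0 : 0 < K := by linarith
  obtain ⟨ℓ1, hℓ1⟩ : ∃ ℓ1, ℓ1 = min (min ℓ0 (a^2/8)) (min a (min (a/(4*v0+1)) (1/(2*v0+1)))) := ⟨_, rfl⟩
  have q0 : 0 < ℓ1 := by rw [hℓ1]; positivity
  have q1 : ℓ1 ≤ ℓ0 := by rw [hℓ1]; exact (min_le_left _ _).trans (min_le_left _ _)
  have q2 : ℓ1 ≤ a^2/8 := by rw [hℓ1]; exact (min_le_left _ _).trans (min_le_right _ _)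
  have q3 : ℓ1 ≤ a := by rw [hℓ1]; exact (min_le_right _ _).trans (min_le_left _ _)
  have q4 : ℓ1 ≤ a/(4*v0+1) := by rw [hℓ1]; exact (min_le_right _ _).trans ((min_le_right _ _).trans (min_le_left _ _))
  have q5 : ℓ1 ≤ 1/(2*v0+1) := by rw [hℓ1]; exact (min_le_right _ _).trans ((min_le_right _ _).trans (min_le_right _ _))
  rw [le_div_iff₀ (by positivity)] at q4 q5
  obtain ⟨Λ0, hΛ0⟩ : ∃ Λ0 : ℝ, Λ0 = 4*d + v0 + 1 := ⟨_, rfl⟩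
  have hΛ00 : 0 < Λ0 := by rw [hΛ0]; positivity
  obtain ⟨b, hb⟩ : ∃ b, b = 48*Λ0*K + a/K := ⟨_, rfl⟩
  have hb0 : 0 < b := by rw [hb]; positivity
  obtain ⟨h0, hh0⟩ : ∃ h0, h0 = min (min 1 (ℓ1/(8*K))) (min (1/(32*K*(v0+1))) (a/(96*K))) := ⟨_, rfl⟩
  have p0 : 0 < h0 := by rw [hh0]; positivity
  have p1 : h0 ≤ 1 := by rw [hh0]; exact (min_le_left _ _).trans (min_le_left _ _)
  have p2 : h0 ≤ ℓ1/(8*K) := by rw [hh0]; exact (min_le_left _ _).trans (min_le_right _ _)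
  have p3 : h0 ≤ 1/(32*K*(v0+1)) := by rw [hh0]; exact (min_le_right _ _).trans (min_le_left _ _)
  have p4 : h0 ≤ a/(96*K) := by rw [hh0]; exact (min_le_right _ _).trans (min_le_right _ _)
  rw [le_div_iff₀ (by positivity)] at p2 p3
  refine ⟨max (35*a) (18+8*a+48*K*(b+1)), by positivity, a/(64*K^2), by positivity, ℓ1, q0, h0, p0, ?_⟩
  intro h T hh hhl hT hTl V P Q hP hV hQ hQ1 v
  have hsa := P_sa hP hV
  have hlow : ∀ v, -(v0 * ‖v‖^2) ≤ (⟪P v, v⟫_ℂ).re := fun v => by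
    have := P_low hP hV v ∅ hh
    simp only [Finset.sum_empty] at this; linarith
  have hI : ∀ ℓ, K*h ≤ ℓ → ℓ ≤ ℓ1 → ∀ w, ‖Sg P ℓ w‖^2 ≤ Real.exp (2*a/ℓ) * ‖Q (Sg P ℓ w)‖^2 + Real.exp (-9*a/ℓ) * ‖w‖^2 := by
    intro ℓ h1 h2 w
    refine hint h ℓ hh (lt_of_lt_of_le (by positivity) h1) (h2.trans q1) ?_ V P Q w hP hV hQ
    rw [hK, one_div, inv_mul_le_iff₀ hc1] at h1; exact h1
  set O := ∫ τ in (0:ℝ)..T, ‖Q (Sg P τ v)‖^2 with hO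
  have hO0 : 0 ≤ O := intervalIntegral.integral_nonneg hT.le fun _ _ => sq_nonneg _
  have hKh : 0 < K*h := by positivity
  have hvl : 2*v0*ℓ1 ≤ 1 := by linarith
  by_cases hc : 8*(K*h) ≤ T
  · have hcu := Sg_cont_apply P v
    have := regA (y := fun t => ‖Sg P t v‖^2) (q := fun t => ‖Q (Sg P t v)‖^2) ((Q.continuous.comp hcu).norm.pow 2) (fun _ => sq_nonneg _) (fun _ => sq_nonneg _) ha hKh q3 hT hc hTl
      (fun ℓ h1 h2 t0 => avg_step hv0 hlow ha (lt_of_lt_of_le (by positivity) h1) (by linarith) (by linarith) (by linarith [mul_le_mul_of_nonneg_left h2 hv0]) (hI ℓ h1 h2) t0 v)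
      (fun t h1 h2 => by
        refine (Sg_bound2 hlow v h1).trans ?_
        have : Real.exp (2*v0*(T-t)) ≤ Real.exp 1 := Real.exp_le_exp.2 (by linarith [mul_le_mul_of_nonneg_left (show T - t ≤ ℓ1 by linarith) hv0])
        gcongr
        linarith [Real.exp_one_lt_d9])
    simp only [Sg_zero_apply] at this
    refine this.trans ?_
    have e1 : 35*a/T ≤ max (35*a) (18+8*a+48*K*(b+1)) / T := by gcongr; exact le_max_left _ _
    have e2 : a/(64*K^2) * T/h^2 ≤ a*T/(2*(K*h)^2) := by
      have : a/(64*K^2) * T/h^2 = a*T/(64*(K*h)^2) := by field_simp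
      rw [this]; gcongr; norm_num
    exact add_le_add (mul_le_mul_of_nonneg_right (Real.exp_le_exp.2 e1) hO0) (mul_le_mul_of_nonneg_right (mul_le_mul (by norm_num) (Real.exp_le_exp.2 (neg_le_neg e2)) (Real.exp_pos _).le (by norm_num)) (sq_nonneg _))
  · push Not at hc
    have hΛ : ‖P‖ ≤ Λ0/h^2 := by
      refine (P_norm hP hV hh).trans ?_
      have : v0 ≤ (v0+1)/h^2 := by
        rw [le_div_iff₀ (by positivity)]
        exact (mul_le_of_le_one_right hv0 (pow_le_one₀ hh.le (hhl.trans p1))).trans (by linarith)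
      have e : Λ0/h^2 = 4*d/h^2 + (v0+1)/h^2 := by rw [hΛ0]; ring
      rw [e]; linarith
    have hvKh : h * (32*K*(v0+1)) ≤ h0 * (32*K*(v0+1)) := by gcongr
    have := regB hv0 hsa hlow ha hK1 hΛ00 hh (hhl.trans p1) hT (by linarith) hΛ hQ1 hI hb (by linarith [mul_le_mul_of_nonneg_right hhl hK0.le]) (by linarith) (hhl.trans p4) (by linarith) v
    refine this.trans ?_
    have e1 : (18+8*a+48*K*(b+1))/T ≤ max (35*a) (18+8*a+48*K*(b+1)) / T := by gcongr; exact le_max_right _ _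
    have e3 : Real.exp (-(a/(64*K^2) * T/h^2)) ≤ 8 * Real.exp (-(a/(64*K^2) * T/h^2)) := by linarith [Real.exp_pos (-(a/(64*K^2) * T/h^2))]
    exact add_le_add (mul_le_mul_of_nonneg_right (Real.exp_le_exp.2 e1) hO0) (mul_le_mul_of_nonneg_right e3 (sq_nonneg _))

end

section

open scoped ComplexConjugate InnerProductSpace

variable {H : Type*} [NormedAddCommGroup H] [InnerProductSpace ℂ H] [CompleteSpace H]

lemma hum {P Q : H →L[ℂ] H} (hP : IsSelfAdjoint P) (hQs : ∀ v w, ⟪Q v, w⟫_ℂ = ⟪v, Q w⟫_ℂ) (hQi : ∀ v, Q (Q v) = Q v)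
    {T A2 δ : ℝ} (hT : 0 < T) (hA2 : 0 < A2) (hδ : 0 < δ)
    (hobs : ∀ v, ‖Sg P T v‖^2 ≤ A2 * (∫ τ in (0:ℝ)..T, ‖Q (Sg P τ v)‖^2) + δ^2 * ‖v‖^2) (u0 : H) :
    ∃ y : H, (∫ s in (0:ℝ)..T, ‖Q (Sg P (T-s) (-(A2:ℂ) • y))‖^2) ≤ A2 * ‖u0‖^2 ∧
      ‖Sg P T u0 + ∫ s in (0:ℝ)..T, Sg P (T-s) (Q (Sg P (T-s) (-(A2:ℂ) • y)))‖ ≤ δ * ‖u0‖ := by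
  have hcS := Sg_cont P
  have hcSv := Sg_cont_apply P
  obtain ⟨F, hF⟩ : ∃ F : ℝ → H →L[ℂ] H, F = fun t => Sg P t * Q * Sg P t := ⟨_, rfl⟩
  have hFc : Continuous F := by rw [hF]; exact (hcS.mul continuous_const).mul hcS
  have hFv : ∀ t v, F t v = Sg P t (Q (Sg P t v)) := fun t v => by rw [hF]; rfl
  obtain ⟨G, hG⟩ : ∃ G : H →L[ℂ] H, G = ∫ t in (0:ℝ)..T, F t := ⟨_, rfl⟩
  have hGv : ∀ v, G v = ∫ t in (0:ℝ)..T, Sg P t (Q (Sg P t v)) := by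
    intro v
    rw [hG, ContinuousLinearMap.intervalIntegral_apply (hFc.intervalIntegrable _ _)]
    simp only [hFv]
  have hGin : ∀ v, ⟪G v, v⟫_ℂ = ((∫ t in (0:ℝ)..T, ‖Q (Sg P t v)‖^2 : ℝ) : ℂ) := by
    intro v
    have hcv := hcSv v
    have hint : IntervalIntegrable (fun t => Sg P t (Q (Sg P t v))) volume 0 T := by
      have : Continuous (fun t => Sg P t (Q (Sg P t v))) := hcS.clm_apply (Q.continuous.comp hcv)
      exact this.intervalIntegrable _ _
    have h1 : ⟪v, G v⟫_ℂ = ∫ t in (0:ℝ)..T, ⟪v, Sg P t (Q (Sg P t v))⟫_ℂ := by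
      rw [hGv]
      exact ((innerSL ℂ v).intervalIntegral_comp_comm hint).symm
    have h2 : ∀ t, ⟪v, Sg P t (Q (Sg P t v))⟫_ℂ = ((‖Q (Sg P t v)‖^2 : ℝ) : ℂ) := by
      intro t
      rw [← Sg_sym hP, ← hQi, ← hQs, inner_self_eq_norm_sq_to_K, hQi]; norm_cast
    simp only [h2] at h1
    rw [intervalIntegral.integral_ofReal] at h1
    rw [← inner_conj_symm, h1, Complex.conj_ofReal]
  obtain ⟨B, hB⟩ : ∃ B : H →L[ℂ] H, B = (A2:ℂ) • G + ((δ^2:ℝ):ℂ) • 1 := ⟨_, rfl⟩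
  have hBv : ∀ v, B v = (A2:ℂ) • G v + ((δ^2:ℝ):ℂ) • v := fun v => by rw [hB]; rfl
  have hBin : ∀ v, ⟪B v, v⟫_ℂ = ((A2 * (∫ t in (0:ℝ)..T, ‖Q (Sg P t v)‖^2) + δ^2 * ‖v‖^2 : ℝ) : ℂ) := by
    intro v
    rw [hBv, inner_add_left, inner_smul_left, inner_smul_left, hGin, inner_self_eq_norm_sq_to_K, Complex.conj_ofReal, Complex.conj_ofReal]
    push_cast; rfl
  have hO0 : ∀ v, 0 ≤ ∫ t in (0:ℝ)..T, ‖Q (Sg P t v)‖^2 := fun v => intervalIntegral.integral_nonneg hT.le fun _ _ => sq_nonneg _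
  have hunit : IsUnit B := by
    refine ContinuousLinearMap.isUnit_of_forall_le_norm_inner_map B (c := ⟨δ^2, by positivity⟩) (by exact_mod_cast (by positivity : 0 < δ^2)) fun v => ?_
    have h0 := mul_nonneg hA2.le (hO0 v)
    rw [hBin, Complex.norm_real, Real.norm_of_nonneg (by positivity)]
    change ‖v‖^2 * δ^2 ≤ _
    linarith
  obtain ⟨y, hy⟩ := (ContinuousLinearMap.isUnit_iff_bijective.1 hunit).2 (Sg P T u0)
  obtain ⟨O, hO⟩ : ∃ O, O = ∫ t in (0:ℝ)..T, ‖Q (Sg P t y)‖^2 := ⟨_, rfl⟩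
  have hO0y := hO0 y
  rw [← hO] at hO0y
  have h1 : A2 * O + δ^2 * ‖y‖^2 ≤ ‖u0‖ * ‖Sg P T y‖ := by
    have g1 := hBin y
    rw [hy, Sg_sym hP, ← hO] at g1
    have g2 := norm_inner_le_norm (𝕜 := ℂ) u0 (Sg P T y)
    rw [g1, Complex.norm_real, Real.norm_of_nonneg (by positivity)] at g2
    exact g2
  have h2 := hobs y
  rw [← hO] at h2
  have h3 : A2 * O + δ^2 * ‖y‖^2 ≤ ‖u0‖^2 := by
    by_contra hcon
    push Not at hcon
    have g0 : 0 ≤ A2 * O + δ^2 * ‖y‖^2 := by positivity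
    have g1 : (A2 * O + δ^2 * ‖y‖^2)^2 ≤ ‖u0‖^2 * (A2 * O + δ^2 * ‖y‖^2) := by
      calc _ ≤ (‖u0‖ * ‖Sg P T y‖)^2 := pow_le_pow_left₀ g0 h1 2
        _ = ‖u0‖^2 * ‖Sg P T y‖^2 := by ring
        _ ≤ _ := mul_le_mul_of_nonneg_left h2 (sq_nonneg _)
    have g2 : 0 < A2 * O + δ^2 * ‖y‖^2 := lt_of_le_of_lt (sq_nonneg _) hcon
    nlinarith
  refine ⟨y, ?_, ?_⟩
  · have e : ∀ s, ‖Q (Sg P (T-s) (-(A2:ℂ) • y))‖^2 = A2^2 * ‖Q (Sg P (T-s) y)‖^2 := by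
      intro s
      rw [map_smul, map_smul, norm_smul, norm_neg, Complex.norm_real, Real.norm_of_nonneg hA2.le, mul_pow]
    simp only [e]
    rw [intervalIntegral.integral_const_mul, intervalIntegral.integral_comp_sub_left (fun s => ‖Q (Sg P s y)‖^2) T, sub_self, sub_zero, ← hO]
    have : 0 ≤ δ^2 * ‖y‖^2 := by positivity
    have g := mul_le_mul_of_nonneg_left (by linarith : A2 * O ≤ ‖u0‖^2) hA2.le
    linarith
  · rw [intervalIntegral.integral_comp_sub_left (fun s => Sg P s (Q (Sg P s (-(A2:ℂ) • y)))) T, sub_self, sub_zero, ← hGv, map_smul, ← hy, hBv]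
    have e : (A2:ℂ) • G y + ((δ^2:ℝ):ℂ) • y + -(A2:ℂ) • G y = ((δ^2:ℝ):ℂ) • y := by module
    rw [e, norm_smul, Complex.norm_real, Real.norm_of_nonneg (by positivity)]
    have g1 : (δ * ‖y‖)^2 ≤ ‖u0‖^2 := by
      have := mul_nonneg hA2.le hO0y
      rw [mul_pow]; linarith
    have g2 := le_of_sq_le_sq g1 (norm_nonneg _)
    calc δ^2 * ‖y‖ = δ * (δ * ‖y‖) := by ring
      _ ≤ _ := mul_le_mul_of_nonneg_left g2 hδ.le

end

open scoped InnerProductSpace in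
lemma Q_le {d : ℕ} {Q : Hsp d →L[ℂ] Hsp d} (hQs : ∀ v w, ⟪Q v, w⟫_ℂ = ⟪v, Q w⟫_ℂ) (hQi : ∀ v, Q (Q v) = Q v) (v : Hsp d) :
    ‖Q v‖ ≤ ‖v‖ := by
  have h1 : ‖⟪Q v, Q v⟫_ℂ‖ ≤ ‖v‖ * ‖Q v‖ := by
    rw [hQs, hQi]; exact norm_inner_le_norm _ _
  rw [inner_self_eq_norm_sq_to_K] at h1
  simp at h1
  by_contra hc
  push Not at hc
  have h0 := norm_nonneg v
  nlinarith

lemma final_T {C1 C ε T M : ℝ} (hC1 : 0 < C1) (hC : 0 < C) (hε : 0 < ε) (hT : 0 < T) (hM : 1 ≤ M) (hTC : T ≤ C)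
    (hTe : T ≤ (2*C/C1)^(1/ε)) :
    Real.exp (C1/T) ≤ (C/T * Real.exp (C * M^(2*(1+ε)) / T^(1+ε)))^2 := by
  have a1 : 1 ≤ C/T := (one_le_div hT).2 hTC
  have a2 : T^ε ≤ 2*C/C1 := by
    have := Real.rpow_le_rpow hT.le hTe hε.le
    rwa [← Real.rpow_mul (by positivity), one_div_mul_cancel hε.ne', Real.rpow_one] at this
  have a3 : 1 ≤ M^(2*(1+ε)) := Real.one_le_rpow hM (by positivity)
  have a4 : T^(1+ε) = T * T^ε := by rw [Real.rpow_add hT, Real.rpow_one]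
  have p : 0 < T^ε := Real.rpow_pos_of_pos hT _
  have a5 : C1/T ≤ 2*(C * M^(2*(1+ε)) / T^(1+ε)) := by
    rw [a4, div_le_iff₀ hT]
    have : 2*(C * M^(2*(1+ε)) / (T * T^ε)) * T = 2*C*M^(2*(1+ε)) / T^ε := by field_simp
    rw [this, le_div_iff₀ p]
    rw [le_div_iff₀ hC1] at a2
    nlinarith
  set E := C * M^(2*(1+ε)) / T^(1+ε)
  calc Real.exp (C1/T) ≤ Real.exp (2*E) := Real.exp_le_exp.2 a5
    _ = 1^2 * (Real.exp E)^2 := by rw [← Real.exp_nat_mul]; simp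
    _ ≤ (C/T)^2 * (Real.exp E)^2 := mul_le_mul_of_nonneg_right (pow_le_pow_left₀ zero_le_one a1 2) (sq_nonneg _)
    _ = _ := by ring

lemma final_h {c2 C ε T M h he : ℝ} (hc2 : 0 < c2) (hC : C = c2/4) (hε : 0 < ε) (hT : 0 < T) (hT1 : T ≤ 1) (hM : 1 ≤ M)
    (hh : 0 < h) (hhe0 : 0 < he) (hle : h ≤ he * (T/M)^((1+ε)/2)) (hhe : he^2 ≤ C^2/3) :
    h ≤ he ∧ 3 * Real.exp (-(c2*T/(2*h^2))) ≤ C * Real.exp (-C*T/h^2) := by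
  have q0 : 0 < T/M := by positivity
  have q1 : T/M ≤ T := div_le_self hT.le hM
  have r1 : (T/M)^((1+ε)/2) ≤ 1 := Real.rpow_le_one q0.le (q1.trans hT1) (by positivity)
  have r0 : 0 ≤ (T/M)^((1+ε)/2) := by positivity
  have r2 : ((T/M)^((1+ε)/2))^2 ≤ T := by
    rw [← Real.rpow_natCast, ← Real.rpow_mul q0.le]
    have : (1+ε)/2*((2:ℕ):ℝ) = 1+ε := by push_cast; ring
    rw [this]
    calc (T/M)^(1+ε) ≤ (T/M)^(1:ℝ) := Real.rpow_le_rpow_of_exponent_ge q0 (q1.trans hT1) (by linarith)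
      _ = T/M := Real.rpow_one _
      _ ≤ T := q1
  refine ⟨hle.trans (by nlinarith), ?_⟩
  have s1 : h^2 ≤ he^2 * T := by
    calc h^2 ≤ (he * (T/M)^((1+ε)/2))^2 := pow_le_pow_left₀ hh.le hle 2
      _ = he^2 * ((T/M)^((1+ε)/2))^2 := by ring
      _ ≤ _ := mul_le_mul_of_nonneg_left r2 (sq_nonneg _)
  have hCp : 0 < C := by rw [hC]; positivity
  have h2 : 0 < h^2 := by positivity
  have s2 : 3/C ≤ C*T/h^2 := by
    rw [div_le_div_iff₀ hCp h2]
    nlinarith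
  have s3 : 3/C ≤ Real.exp (C*T/h^2) := s2.trans (by linarith [Real.add_one_le_exp (C*T/h^2)])
  have e : -(c2*T/(2*h^2)) = -(C*T/h^2) + (-C*T/h^2) := by rw [hC]; field_simp; ring
  rw [e, Real.exp_add, ← mul_assoc]
  refine mul_le_mul_of_nonneg_right ?_ (Real.exp_pos _).le
  rw [Real.exp_neg, ← div_eq_mul_inv, div_le_iff₀ (Real.exp_pos _)]
  rw [div_le_iff₀ hCp] at s3
  linarith

/-- Uniform approximate null-controllability from an equidistributed set, small time:
for `0 < T < K_ε(1+‖V‖_∞^{2/3})` and `h ≤ h_ε(T/(1+‖V‖_∞^{2/3}))^{(1+ε)/2}` there is a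
control `g` supported in `ω` with cost `≤ (C/T)exp(C(1+‖V‖_∞^{2/3})^{2(1+ε)}/T^{1+ε})‖u₀‖`
whose mild solution satisfies `‖u(T)‖ ≤ C e^{−CT/h²}‖u₀‖`. -/
theorem stmt_8 (d : ℕ) (V : (Fin d → ℝ) → ℝ) (hVcont : Continuous V)
    (hVbdd : BddAbove (Set.range fun x => |V x|))
    (L γ : ℝ) (ω : Set (Fin d → ℝ)) (hωopen : IsOpen ω) (hω : Equidistributed d L γ ω) :
    ∀ ε : ℝ, 0 < ε → ε ≤ 1 →
    ∃ Kε > (0:ℝ), ∃ hε > (0:ℝ), ∃ C > (0:ℝ),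
      ∀ T : ℝ, 0 < T → T < Kε * (1 + supNorm d V ^ ((2:ℝ)/3)) →
      ∀ h : ℝ, 0 < h →
        h ≤ hε * (T / (1 + supNorm d V ^ ((2:ℝ)/3))) ^ ((1 + ε) / 2) →
      ∀ P : Hsp d →L[ℂ] Hsp d, RealizesPh d h V P →
      ∀ u₀ : Hsp d, ∃ g : ℝ → Hsp d,
        (∀ (t : ℝ) (k : Fin d → ℤ), pt d h k ∉ ω → (g t : ∀ _ : (Fin d → ℤ), ℂ) k = 0) ∧
        (∫ t in Set.Ioc (0:ℝ) T, ‖g t‖ ^ 2)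
            ≤ (C / T * Real.exp (C * (1 + supNorm d V ^ ((2:ℝ)/3)) ^ (2 * (1 + ε))
                / T ^ (1 + ε)) * ‖u₀‖) ^ 2 ∧
        ‖NormedSpace.exp ((-(T:ℂ)) • P) u₀
            + ∫ s in Set.Ioc (0:ℝ) T, NormedSpace.exp ((-(((T - s : ℝ)):ℂ)) • P) (g s)‖
          ≤ C * Real.exp (-C * T / h ^ 2) * ‖u₀‖ := by

  intro ε hε hε1
  have hVx : ∀ x, |V x| ≤ supNorm d V := fun x => le_ciSup hVbdd x
  have hv0 : 0 ≤ supNorm d V := (abs_nonneg _).trans (hVx 0)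
  set M := 1 + supNorm d V ^ ((2:ℝ)/3) with hMdef
  have hM : 1 ≤ M := by
    have : 0 ≤ supNorm d V ^ ((2:ℝ)/3) := Real.rpow_nonneg hv0 _
    linarith
  have hM0 : 0 < M := by linarith
  obtain ⟨C1, hC1, c2, hc2, T0, hT0, h0, hh0, H⟩ := obs d L γ (supNorm d V) ω hv0 hω
  set C := c2/4 with hCdef
  have hC : 0 < C := by positivity
  set K := min (min T0 C) (min 1 ((2*C/C1)^(1/ε))) with hK
  have hKp : 0 < K := lt_min (lt_min hT0 hC) (lt_min one_pos (Real.rpow_pos_of_pos (by positivity) _))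
  refine ⟨K/M, by positivity, min h0 (C/2), lt_min hh0 (by positivity), C, hC, ?_⟩
  intro T hT hTK h hh hhle P hP u₀
  rw [div_mul_cancel₀ _ hM0.ne'] at hTK
  have t1 : T ≤ T0 := hTK.le.trans ((min_le_left _ _).trans (min_le_left _ _))
  have t2 : T ≤ C := hTK.le.trans ((min_le_left _ _).trans (min_le_right _ _))
  have t3 : T ≤ 1 := hTK.le.trans ((min_le_right _ _).trans (min_le_left _ _))
  have t4 : T ≤ (2*C/C1)^(1/ε) := hTK.le.trans ((min_le_right _ _).trans (min_le_right _ _))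
  have he0 : 0 < min h0 (C/2) := lt_min hh0 (by positivity)
  have he2 : (min h0 (C/2))^2 ≤ C^2/3 := by
    have := pow_le_pow_left₀ he0.le (min_le_right h0 (C/2)) 2
    linarith [sq_nonneg C]
  obtain ⟨f1, f2⟩ := final_h hc2 hCdef hε hT t3 hM hh he0 hhle he2
  have f3 := final_T hC1 hC hε hT hM t2 t4
  obtain ⟨Q, hQ, hQs, hQi⟩ := exists_Q d {x | pt d h x ∈ ω}
  have hobs := H h T hh (f1.trans (min_le_left _ _)) hT t1 V P Q hP hVx hQ (Q_le hQs hQi)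
  have hobs' : ∀ v, ‖Sg P T v‖^2 ≤ Real.exp (C1/T) * (∫ τ in (0:ℝ)..T, ‖Q (Sg P τ v)‖^2)
      + (3 * Real.exp (-(c2*T/(2*h^2))))^2 * ‖v‖^2 := by
    intro v
    refine (hobs v).trans ?_
    have e : (3 * Real.exp (-(c2*T/(2*h^2))))^2 = 9 * Real.exp (-(c2*T/h^2)) := by
      rw [mul_pow, ← Real.exp_nat_mul]
      have : ((2:ℕ):ℝ) * (-(c2*T/(2*h^2))) = -(c2*T/h^2) := by push_cast; field_simp
      rw [this]; norm_num
    rw [e]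
    have : 0 ≤ Real.exp (-(c2*T/h^2)) * ‖v‖^2 := by positivity
    linarith
  obtain ⟨y, hy1, hy2⟩ := hum (P_sa hP hVx) hQs hQi hT (Real.exp_pos (C1/T))
    (by positivity : 0 < 3 * Real.exp (-(c2*T/(2*h^2)))) hobs' u₀
  refine ⟨fun s => Q (Sg P (T-s) (-((Real.exp (C1/T) : ℝ):ℂ) • y)), ?_, ?_, ?_⟩
  · intro t k hk
    exact (hQ _ k).trans (Set.indicator_of_notMem (s := {x | pt d h x ∈ ω}) hk _)
  · rw [intervalIntegral.integral_of_le hT.le] at hy1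
    refine hy1.trans ?_
    rw [mul_pow]
    exact mul_le_mul_of_nonneg_right f3 (sq_nonneg _)
  · rw [intervalIntegral.integral_of_le hT.le] at hy2
    exact hy2.trans (mul_le_mul_of_nonneg_right f2 (norm_nonneg _))
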